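/- Let (ΛV,d) be a pure coformal elliptic minimal Sullivan model. Then for every integer r ≥ 2, (r−2)·cat(ΛV) + MTC(ΛV) ≤ MTC_r(ΛV), where MTC(ΛV) = MTC₂(ΛV) is the usual module rational topological complexity. -/

import Mathlib

noncomputable section

namespace RHT

/-- A graded-commutative differential graded algebra over `ℚ`, graded by `ℕ`,
with a degree `+1` differential satisfying the graded Leibniz rule. -/
class GCDGA (A : Type) extends Ring A, Algebra ℚ A where
  grading : ℕ → Submodule ℚ A
  gradedAlgebra : GradedAlgebra grading
  grading_comm : ∀ (i j : ℕ) (a b : A), a ∈ grading i → b ∈ grading j →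
    a * b = ((-1 : ℚ) ^ (i * j)) • (b * a)
  d : A →ₗ[ℚ] A
  d_sq : ∀ a : A, d (d a) = 0
  d_grading : ∀ (i : ℕ) (a : A), a ∈ grading i → d a ∈ grading (i + 1)
  d_leibniz : ∀ (i : ℕ) (a b : A), a ∈ grading i →
    d (a * b) = d a * b + ((-1 : ℚ) ^ i) • (a * d b)

/-- The grading of a gcdga, with the algebra explicit. -/
def Gr (A : Type) [GCDGA A] : ℕ → Submodule ℚ A := GCDGA.grading

/-- The differential of a gcdga, with the algebra explicit. -/
def Dd (A : Type) [GCDGA A] : A →ₗ[ℚ] A := GCDGA.d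

/-- Morphisms of cdga's: `ℚ`-algebra morphisms preserving the grading and
commuting with the differentials. -/
def IsDGAHom {A B : Type} [GCDGA A] [GCDGA B] (f : A →ₐ[ℚ] B) : Prop :=
  (∀ a : A, f (Dd A a) = Dd B (f a)) ∧
    ∀ (i : ℕ) (a : A), a ∈ Gr A i → f a ∈ Gr B i

theorem isDGAHom_id (A : Type) [GCDGA A] : IsDGAHom (AlgHom.id ℚ A) :=
  ⟨fun _ => rfl, fun _ _ h => h⟩

/-- A quasi-isomorphism: a morphism inducing an isomorphism in cohomology
(stated elementwise: surjectivity and injectivity on cohomology classes). -/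
def QuasiIso {A B : Type} [GCDGA A] [GCDGA B] (f : A →ₐ[ℚ] B) : Prop :=
  (∀ b : B, Dd B b = 0 → ∃ a : A, Dd A a = 0 ∧ ∃ c : B, f a - b = Dd B c) ∧
    ∀ a : A, Dd A a = 0 → (∃ c : B, f a = Dd B c) → ∃ e : A, a = Dd A e

/-- Injectivity in cohomology, stated elementwise. -/
def CohomologyInjective {A B : Type} [GCDGA A] [GCDGA B] (f : A →ₐ[ℚ] B) : Prop :=
  ∀ a : A, Dd A a = 0 → (∃ c : B, f a = Dd B c) → ∃ e : A, a = Dd A e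

/-- A homotopy retraction for a morphism `ρ` of cdga's: a factorization of `ρ`
through a surjective quasi-isomorphism `q : C → Q` (playing the role of the
relative Sullivan model of `ρ`) together with a cdga retraction `τ`. -/
structure HtpyRetraction {T Q : Type} [GCDGA T] [GCDGA Q] (ρ : T →ₐ[ℚ] Q) where
  C : Type
  [instC : GCDGA C]
  j : T →ₐ[ℚ] C
  q : C →ₐ[ℚ] Q
  τ : C →ₐ[ℚ] T
  j_dga : IsDGAHom j
  q_dga : IsDGAHom q
  τ_dga : IsDGAHom τ
  q_surj : Function.Surjective q
  q_quasi : QuasiIso q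
  hqj : q.comp j = ρ
  hτj : τ.comp j = AlgHom.id ℚ T

attribute [instance] HtpyRetraction.instC

/-- A homotopy retraction of `T`-modules for a morphism `ρ : T → Q` of cdga's:
as above, but the retraction `τ` is only required to be a morphism of
differential `T`-modules. -/
structure ModHtpyRetraction {T Q : Type} [GCDGA T] [GCDGA Q] (ρ : T →ₐ[ℚ] Q) where
  C : Type
  [instC : GCDGA C]
  j : T →ₐ[ℚ] C
  q : C →ₐ[ℚ] Q
  τ : C →ₗ[ℚ] T
  j_dga : IsDGAHom j
  q_dga : IsDGAHom q
  q_surj : Function.Surjective q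
  q_quasi : QuasiIso q
  hqj : q.comp j = ρ
  τ_chain : ∀ c : C, τ (Dd C c) = Dd T (τ c)
  τ_mod : ∀ (t : T) (c : C), τ (j t * c) = t * τ c
  hτj : ∀ t : T, τ (j t) = t

attribute [instance] ModHtpyRetraction.instC

/-- `T`, together with the morphisms `ι j : A → T`, is the `r`-fold (graded)
tensor power of `A`, characterized as the `r`-fold coproduct of copies of `A`
in the category of cdga's. -/
structure TensorPower (A : Type) [GCDGA A] (r : ℕ) (T : Type) [GCDGA T] where
  ι : Fin r → (A →ₐ[ℚ] T)
  ι_dga : ∀ j, IsDGAHom (ι j)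
  coprod : ∀ (B : Type) [GCDGA B] (f : Fin r → (A →ₐ[ℚ] B)), (∀ j, IsDGAHom (f j)) →
    ∃! g : T →ₐ[ℚ] B, IsDGAHom g ∧ ∀ j, g.comp (ι j) = f j

/-- The `r`-fold multiplication morphism `μ : A^{⊗ r} → A`, i.e. the fold map
of the coproduct. -/
noncomputable def TensorPower.mu {A : Type} [GCDGA A] {r : ℕ} {T : Type} [GCDGA T]
    (TP : TensorPower A r T) : T →ₐ[ℚ] A :=
  (TP.coprod A (fun _ => AlgHom.id ℚ A) (fun _ => isDGAHom_id A)).choose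

/-- The kernel of the `r`-fold multiplication, as a `ℚ`-submodule (ideal). -/
noncomputable def TensorPower.kerMu {A : Type} [GCDGA A] {r : ℕ} {T : Type} [GCDGA T]
    (TP : TensorPower A r T) : Submodule ℚ T :=
  LinearMap.ker TP.mu.toLinearMap

/-- A witness that `TC_r(ΛV) ≤ n`: the projection
`ρ^r_n : (ΛV)^{⊗ r} → (ΛV)^{⊗ r}/(ker μ^r)^{n+1}` admits a homotopy retraction
of cdga's.  The quotient is encoded as a surjective cdga morphism with kernel
`(ker μ^r)^{n+1}`. -/
structure TCWitness (A : Type) [GCDGA A] (r n : ℕ) where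
  T : Type
  [instT : GCDGA T]
  TP : TensorPower A r T
  Q : Type
  [instQ : GCDGA Q]
  ρ : T →ₐ[ℚ] Q
  ρ_dga : IsDGAHom ρ
  ρ_surj : Function.Surjective ρ
  ρ_ker : LinearMap.ker ρ.toLinearMap = TP.kerMu ^ (n + 1)
  retr : Nonempty (HtpyRetraction ρ)

/-- The higher rational topological complexity `TC_r`. -/
noncomputable def TC (A : Type) [GCDGA A] (r : ℕ) : ℕ :=
  sInf {n | Nonempty (TCWitness A r n)}

/-- A witness that `MTC_r(ΛV) ≤ n`: `ρ^r_n` admits a homotopy retraction of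
`(ΛV)^{⊗ r}`-modules. -/
structure MTCWitness (A : Type) [GCDGA A] (r n : ℕ) where
  T : Type
  [instT : GCDGA T]
  TP : TensorPower A r T
  Q : Type
  [instQ : GCDGA Q]
  ρ : T →ₐ[ℚ] Q
  ρ_dga : IsDGAHom ρ
  ρ_surj : Function.Surjective ρ
  ρ_ker : LinearMap.ker ρ.toLinearMap = TP.kerMu ^ (n + 1)
  retr : Nonempty (ModHtpyRetraction ρ)

/-- The higher module rational topological complexity `MTC_r`. -/
noncomputable def MTC (A : Type) [GCDGA A] (r : ℕ) : ℕ :=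
  sInf {n | Nonempty (MTCWitness A r n)}

/-- A witness that `HTC_r(ΛV) ≤ n`: `ρ^r_n` is injective in cohomology. -/
structure HTCWitness (A : Type) [GCDGA A] (r n : ℕ) where
  T : Type
  [instT : GCDGA T]
  TP : TensorPower A r T
  Q : Type
  [instQ : GCDGA Q]
  ρ : T →ₐ[ℚ] Q
  ρ_dga : IsDGAHom ρ
  ρ_surj : Function.Surjective ρ
  ρ_ker : LinearMap.ker ρ.toLinearMap = TP.kerMu ^ (n + 1)
  inj : CohomologyInjective ρ

/-- The invariant `HTC_r`. -/
noncomputable def HTC (A : Type) [GCDGA A] (r : ℕ) : ℕ :=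
  sInf {n | Nonempty (HTCWitness A r n)}

/-- A minimal Sullivan model structure on a gcdga `A`: a simply-connected
graded space of generators `V` of finite type, the word-length grading `lam`
(`lam k` is `Λ^k V`), freeness of `A` over `V` as a graded-commutative
algebra (expressed by the universal property), and minimality `d V ⊆ Λ^{≥2}V`. -/
structure MinimalSullivan (A : Type) [GCDGA A] where
  V : ℕ → Submodule ℚ A
  lam : ℕ → Submodule ℚ A
  V_le : ∀ n, V n ≤ Gr A n
  V0 : V 0 = ⊥
  V1 : V 1 = ⊥
  V_fin : ∀ n, FiniteDimensional ℚ (V n)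
  lam_zero : lam 0 = 1
  lam_one : lam 1 = ⨆ n, V n
  lam_mul : ∀ p q, lam p * lam q ≤ lam (p + q)
  lam_internal : DirectSum.IsInternal lam
  minimal : ∀ (n : ℕ), ∀ v ∈ V n, Dd A v ∈ ⨆ k, ⨆ (_ : 2 ≤ k), lam k
  free : ∀ (B : Type) [GCDGA B] (f : ∀ n, V n →ₗ[ℚ] B),
    (∀ (n : ℕ) (v : V n), f n v ∈ Gr B n) →
    ∃! g : A →ₐ[ℚ] B, (∀ (i : ℕ) (a : A), a ∈ Gr A i → g a ∈ Gr B i) ∧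
      ∀ (n : ℕ) (v : V n), g (v : A) = f n v

namespace MinimalSullivan

variable {A : Type} [GCDGA A] (S : MinimalSullivan A)

/-- The even part of the space of generators. -/
def Veven : Submodule ℚ A := ⨆ n, S.V (2 * n)

/-- The odd part of the space of generators. -/
def Vodd : Submodule ℚ A := ⨆ n, S.V (2 * n + 1)

/-- The homotopy characteristic `χ_π = dim V^even - dim V^odd`. -/
noncomputable def chiPi : ℤ :=
  (Module.finrank ℚ S.Veven : ℤ) - (Module.finrank ℚ S.Vodd : ℤ)

/-- Purity: `d V^even = 0` and `d V^odd ⊆ Λ V^even`. -/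
def Pure : Prop :=
  (∀ a ∈ S.Veven, Dd A a = 0) ∧
    ∀ a ∈ S.Vodd, Dd A a ∈ Algebra.adjoin ℚ (S.Veven : Set A)

/-- Coformality: the differential is quadratic, `d V ⊆ Λ² V`. -/
def Coformal : Prop := ∀ (n : ℕ), ∀ v ∈ S.V n, Dd A v ∈ S.lam 2

/-- Constant length `l` of the differential: `d V ⊆ Λ^l V`. -/
def ConstantLength (l : ℕ) : Prop := ∀ (n : ℕ), ∀ v ∈ S.V n, Dd A v ∈ S.lam l

end MinimalSullivan

/-- The cohomology of a gcdga, as a `ℚ`-module. -/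
def CohClasses (A : Type) [GCDGA A] :=
  LinearMap.ker (Dd A) ⧸ ((LinearMap.range (Dd A)).comap (LinearMap.ker (Dd A)).subtype)

instance (A : Type) [GCDGA A] : AddCommGroup (CohClasses A) := by
  unfold CohClasses; infer_instance

instance (A : Type) [GCDGA A] : Module ℚ (CohClasses A) := by
  unfold CohClasses; infer_instance

/-- Ellipticity: both the generating space `V` and the cohomology are
finite-dimensional. -/
def Elliptic (A : Type) [GCDGA A] (S : MinimalSullivan A) : Prop :=
  FiniteDimensional ℚ (⨆ n, S.V n : Submodule ℚ A) ∧ FiniteDimensional ℚ (CohClasses A)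

/-- A witness of formality: a quasi-isomorphism to a gcdga with zero
differential. -/
structure FormalityWitness (A : Type) [GCDGA A] where
  B : Type
  [instB : GCDGA B]
  hd : Dd B = 0
  ψ : A →ₐ[ℚ] B
  ψ_dga : IsDGAHom ψ
  ψ_quasi : QuasiIso ψ

/-- Formality of a (Sullivan) cdga. -/
def Formal (A : Type) [GCDGA A] : Prop := Nonempty (FormalityWitness A)

/-- A witness that `cat(ΛV) ≤ n`: the projection `ΛV → ΛV/Λ^{>n}V` admits a
homotopy retraction.  The quotient is encoded as a surjective cdga morphism
whose kernel is `Λ^{>n}V`. -/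
structure CatWitness (A : Type) [GCDGA A] (S : MinimalSullivan A) (n : ℕ) where
  Q : Type
  [instQ : GCDGA Q]
  π : A →ₐ[ℚ] Q
  π_dga : IsDGAHom π
  π_surj : Function.Surjective π
  π_ker : LinearMap.ker π.toLinearMap = ⨆ k, ⨆ (_ : n < k), S.lam k
  retr : Nonempty (HtpyRetraction π)

/-- The rational LS-category. -/
noncomputable def cat (A : Type) [GCDGA A] (S : MinimalSullivan A) : ℕ :=
  sInf {n | Nonempty (CatWitness A S n)}

/-- A witness that `zcl_r(ΛV) ≥ p`: `p` cocycles in `(ΛV)^{⊗ r}` whose classes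
are zero-divisors (killed by `H(μ^r)`) and whose product is not exact. -/
structure ZclWitness (A : Type) [GCDGA A] (r p : ℕ) where
  T : Type
  [instT : GCDGA T]
  TP : TensorPower A r T
  a : Fin p → T
  closed : ∀ i, Dd T (a i) = 0
  zero_div : ∀ i, ∃ b : A, TP.mu (a i) = Dd A b
  prod_ne : ∀ b : T, (List.ofFn a).prod ≠ Dd T b

/-- The `r`-zero-divisor-cuplength `zcl_r`. -/
noncomputable def zcl (A : Type) [GCDGA A] (r : ℕ) : ℕ :=
  sSup {p | Nonempty (ZclWitness A r p)}

/-- A witness that `cl_ℚ(ΛV) ≥ p`: `p` cocycles of positive degree with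
non-exact product. -/
structure ClWitness (A : Type) [GCDGA A] (p : ℕ) where
  a : Fin p → A
  pos : ∀ i, a i ∈ ⨆ k, ⨆ (_ : 0 < k), Gr A k
  closed : ∀ i, Dd A (a i) = 0
  prod_ne : ∀ b : A, (List.ofFn a).prod ≠ Dd A b

/-- The rational cuplength `cl_ℚ`. -/
noncomputable def clQ (A : Type) [GCDGA A] : ℕ :=
  sSup {p | Nonempty (ClWitness A p)}

section basics
variable {A B : Type} [GCDGA A] [GCDGA B]

instance : GradedAlgebra (Gr A) := GCDGA.gradedAlgebra

theorem gr_mul {i j : ℕ} {a b : A} (ha : a ∈ Gr A i) (hb : b ∈ Gr A j) : a * b ∈ Gr A (i + j) :=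
  SetLike.mul_mem_graded ha hb

theorem gr_one : (1 : A) ∈ Gr A 0 := SetLike.one_mem_graded _

theorem gr_pow {i : ℕ} {a : A} (ha : a ∈ Gr A i) (n : ℕ) : a ^ n ∈ Gr A (n * i) := by
  simpa using SetLike.pow_mem_graded n ha

theorem gr_comm {i j : ℕ} {a b : A} (ha : a ∈ Gr A i) (hb : b ∈ Gr A j) :
    a * b = ((-1 : ℚ) ^ (i * j)) • (b * a) := GCDGA.grading_comm i j a b ha hb

@[simp] theorem d_d (a : A) : Dd A (Dd A a) = 0 := GCDGA.d_sq a

theorem d_gr {i : ℕ} {a : A} (ha : a ∈ Gr A i) : Dd A a ∈ Gr A (i + 1) := GCDGA.d_grading i a ha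

theorem hom_induction {p : A → Prop} (hom : ∀ (n : ℕ) (x : A), x ∈ Gr A n → p x)
    (add : ∀ x y, p x → p y → p (x + y)) (a : A) : p a :=
  DirectSum.Decomposition.inductionOn (Gr A) (hom 0 0 (zero_mem _)) (fun m => hom _ m m.2) add a

theorem iSup_gr : (⨆ n, Gr A n) = ⊤ :=
  (DirectSum.Decomposition.isInternal (Gr A)).submodule_iSup_eq_top

/-- The projection onto the component of degree `n`. -/
def pr (A : Type) [GCDGA A] (n : ℕ) : A →ₗ[ℚ] A := GradedAlgebra.proj (Gr A) n

theorem pr_mem (n : ℕ) (a : A) : pr A n a ∈ Gr A n := by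
  rw [pr, GradedAlgebra.proj_apply]; exact Subtype.mem _

theorem pr_same {n : ℕ} {a : A} (h : a ∈ Gr A n) : pr A n a = a := by
  rw [pr, GradedAlgebra.proj_apply]; exact DirectSum.decompose_of_mem_same _ h

theorem pr_ne {m n : ℕ} {a : A} (h : a ∈ Gr A m) (hn : m ≠ n) : pr A n a = 0 := by
  rw [pr, GradedAlgebra.proj_apply]; exact DirectSum.decompose_of_mem_ne _ h hn

theorem pr_eq_of_mem {m : ℕ} {a : A} (h : a ∈ Gr A m) (n : ℕ) :
    pr A n a = if m = n then a else 0 := by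
  split_ifs with e
  · exact e ▸ pr_same h
  · exact pr_ne h e

theorem mem_of_pr {P : Submodule ℚ A} {a : A} (h : ∀ n, pr A n a ∈ P) : a ∈ P := by
  classical
  rw [← DirectSum.sum_support_decompose (Gr A) a]
  refine Submodule.sum_mem _ fun i _ => ?_
  have := h i
  rwa [pr, GradedAlgebra.proj_apply] at this

theorem eq_of_pr {a b : A} (h : ∀ n, pr A n a = pr A n b) : a = b := by
  have : a - b ∈ (⊥ : Submodule ℚ A) := mem_of_pr fun n => by simp [h n]
  exact sub_eq_zero.1 (by simpa using this)

theorem pr_finite (a : A) : ∃ N, ∀ n, N < n → pr A n a = 0 := by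
  refine hom_induction (p := fun a => ∃ N, ∀ n, N < n → pr A n a = 0) ?_ ?_ a
  · exact fun n x hx => ⟨n, fun m hm => pr_ne hx hm.ne⟩
  · rintro x y ⟨N, hN⟩ ⟨N', hN'⟩
    exact ⟨max N N', fun n hn => by
      rw [map_add, hN n (lt_of_le_of_lt (le_max_left _ _) hn),
        hN' n (lt_of_le_of_lt (le_max_right _ _) hn), add_zero]⟩

/-- The scaling automorphism multiplying the degree `i` component by `c ^ i`. -/
def scl (A : Type) [GCDGA A] (c : ℚ) : A →ₗ[ℚ] A :=
  (DirectSum.toModule ℚ ℕ A fun i => c ^ i • (Gr A i).subtype) ∘ₗ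
    (DirectSum.decomposeLinearEquiv (Gr A)).toLinearMap

theorem scl_hom (c : ℚ) {n : ℕ} {a : A} (h : a ∈ Gr A n) : scl A c a = c ^ n • a := by
  lift a to Gr A n using h
  simp only [scl, LinearMap.comp_apply, LinearEquiv.coe_coe, DirectSum.decomposeLinearEquiv_apply,
    DirectSum.decompose_coe]
  erw [DirectSum.toModule_lof]
  simp

/-- The scaling automorphism as a morphism of algebras. -/
def sc (A : Type) [GCDGA A] (c : ℚ) : A →ₐ[ℚ] A :=
  AlgHom.ofLinearMap (scl A c) (by rw [scl_hom c gr_one]; simp) fun x y => by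
    refine hom_induction (p := fun x => scl A c (x * y) = scl A c x * scl A c y) ?_ ?_ x
    · intro n x hx
      refine hom_induction (p := fun y => scl A c (x * y) = scl A c x * scl A c y) ?_ ?_ y
      · intro m y hy
        rw [scl_hom c hx, scl_hom c hy, scl_hom c (gr_mul hx hy), smul_mul_smul_comm, pow_add]
      · intro y z hy hz; rw [mul_add, map_add, map_add, hy, hz, mul_add]
    · intro y z hy hz; rw [add_mul, map_add, map_add, hy, hz, add_mul]

theorem sc_hom (c : ℚ) {n : ℕ} {a : A} (h : a ∈ Gr A n) : sc A c a = c ^ n • a := scl_hom c h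

/-- The degree involution. -/
abbrev sg (A : Type) [GCDGA A] : A →ₐ[ℚ] A := sc A (-1)

theorem sg_hom {n : ℕ} {a : A} (h : a ∈ Gr A n) : sg A a = (-1 : ℚ) ^ n • a := sc_hom _ h

theorem sc_gr (c : ℚ) {n : ℕ} {a : A} (h : a ∈ Gr A n) : sc A c a ∈ Gr A n := by
  rw [sc_hom c h]; exact Submodule.smul_mem _ _ h

@[simp] theorem sg_sg (a : A) : sg A (sg A a) = a := by
  refine hom_induction (p := fun a => sg A (sg A a) = a) ?_ ?_ a
  · intro n x hx
    rw [sg_hom hx, map_smul, sg_hom hx, smul_smul, ← mul_pow]; simp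
  · intro x y hx hy; rw [map_add, map_add, hx, hy]

theorem pr_sc (c : ℚ) (n : ℕ) (a : A) : pr A n (sc A c a) = c ^ n • pr A n a := by
  refine hom_induction (p := fun a => pr A n (sc A c a) = c ^ n • pr A n a) ?_ ?_ a
  · intro m x hx
    rw [sc_hom c hx, map_smul, pr_eq_of_mem hx]
    split_ifs with h
    · rw [h]
    · simp
  · intro x y hx hy; simp only [map_add, hx, hy, smul_add]

theorem pr_d (n : ℕ) (a : A) : pr A (n + 1) (Dd A a) = Dd A (pr A n a) := by
  refine hom_induction (p := fun a => pr A (n + 1) (Dd A a) = Dd A (pr A n a)) ?_ ?_ a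
  · intro m x hx
    rw [pr_eq_of_mem (d_gr hx), pr_eq_of_mem hx]
    by_cases h : m = n <;> simp [h]
  · intro x y hx hy; simp only [map_add, hx, hy]

theorem pr_zero_d (a : A) : pr A 0 (Dd A a) = 0 := by
  refine hom_induction (p := fun a => pr A 0 (Dd A a) = 0) ?_ ?_ a
  · intro m x hx
    exact pr_ne (d_gr hx) (by omega)
  · intro x y hx hy; simp only [map_add, hx, hy, add_zero]

theorem pr_hom_comm {f : A →ₗ[ℚ] B} (h : ∀ i a, a ∈ Gr A i → f a ∈ Gr B i) (n : ℕ) (a : A) :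
    pr B n (f a) = f (pr A n a) := by
  refine hom_induction (p := fun a => pr B n (f a) = f (pr A n a)) ?_ ?_ a
  · intro m x hx
    rw [pr_eq_of_mem (h m x hx), pr_eq_of_mem hx]
    split_ifs <;> simp
  · intro x y hx hy; simp only [map_add, hx, hy]

theorem sg_d (a : A) : sg A (Dd A a) = - Dd A (sg A a) := by
  refine hom_induction (p := fun a => sg A (Dd A a) = - Dd A (sg A a)) ?_ ?_ a
  · intro m x hx
    rw [sg_hom (d_gr hx), sg_hom hx, map_smul, pow_succ]; simp
  · intro x y hx hy; simp only [map_add, hx, hy, neg_add]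

theorem d_mul (a b : A) : Dd A (a * b) = Dd A a * b + sg A a * Dd A b := by
  refine hom_induction (p := fun a => Dd A (a * b) = Dd A a * b + sg A a * Dd A b) ?_ ?_ a
  · intro m x hx
    rw [sg_hom hx, smul_mul_assoc]; exact GCDGA.d_leibniz m x b hx
  · intro x y hx hy; simp only [map_add, add_mul, hx, hy]; abel

@[simp] theorem d_one : Dd A 1 = 0 := by
  have := d_mul (1 : A) 1
  simpa using this

@[simp] theorem d_algebraMap (c : ℚ) : Dd A (algebraMap ℚ A c) = 0 := by
  rw [Algebra.algebraMap_eq_smul_one, map_smul, d_one, smul_zero]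

/-- The power of the degree involution. -/
theorem sc_pow_eq (k : ℕ) (a : A) : sc A ((-1) ^ k) a = (if Odd k then sg A a else a) := by
  split_ifs with h
  · rw [h.neg_one_pow]
  · rw [(Nat.not_odd_iff_even.1 h).neg_one_pow]
    refine hom_induction (p := fun a => sc A 1 a = a) ?_ ?_ a
    · intro m x hx; rw [sc_hom _ hx]; simp
    · intro x y hx hy; rw [map_add, hx, hy]

theorem mul_comm_sc {k : ℕ} {w : A} (hw : w ∈ Gr A k) (a : A) :
    w * a = sc A ((-1) ^ k) a * w := by
  refine hom_induction (p := fun a => w * a = sc A ((-1) ^ k) a * w) ?_ ?_ a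
  · intro m x hx
    rw [sc_hom _ hx, gr_comm hw hx, ← pow_mul, smul_mul_assoc]
  · intro x y hx hy; rw [map_add, mul_add, add_mul, hx, hy]

theorem mul_comm_even {k : ℕ} {w : A} (hw : w ∈ Gr A k) (hk : ¬ Odd k) (a : A) :
    w * a = a * w := by rw [mul_comm_sc hw, sc_pow_eq, if_neg hk]

theorem mul_comm_odd {k : ℕ} {w : A} (hw : w ∈ Gr A k) (hk : Odd k) (a : A) :
    w * a = sg A a * w := by rw [mul_comm_sc hw, sc_pow_eq, if_pos hk]

theorem odd_sq {k : ℕ} {w : A} (hw : w ∈ Gr A k) (hk : Odd k) : w * w = 0 := by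
  have h := mul_comm_odd hw hk w
  rw [sg_hom hw, hk.neg_one_pow, neg_one_smul, neg_mul] at h
  have h2 : (2 : ℚ) • (w * w) = 0 := by rw [two_smul]; nth_rewrite 1 [h]; exact neg_add_cancel _
  exact (smul_eq_zero.1 h2).resolve_left two_ne_zero

theorem odd_pow {k : ℕ} {w : A} (hw : w ∈ Gr A k) (hk : Odd k) {l : ℕ} (hl : 2 ≤ l) :
    w ^ l = 0 := by
  obtain ⟨l, rfl⟩ := Nat.exists_eq_add_of_le hl
  rw [pow_add, pow_two, odd_sq hw hk, zero_mul]

theorem sc_dga_comm {f : A →ₗ[ℚ] B} (h : ∀ i a, a ∈ Gr A i → f a ∈ Gr B i) (c : ℚ) (a : A) :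
    f (sc A c a) = sc B c (f a) := by
  refine hom_induction (p := fun a => f (sc A c a) = sc B c (f a)) ?_ ?_ a
  · intro m x hx
    rw [sc_hom _ hx, sc_hom _ (h m x hx), map_smul]
  · intro x y hx hy; simp only [map_add, hx, hy]

theorem IsDGAHom.sc {f : A →ₐ[ℚ] B} (h : IsDGAHom f) (c : ℚ) (a : A) :
    f (sc A c a) = RHT.sc B c (f a) := sc_dga_comm (f := f.toLinearMap) h.2 c a

theorem IsDGAHom.pr {f : A →ₐ[ℚ] B} (h : IsDGAHom f) (n : ℕ) (a : A) :
    RHT.pr B n (f a) = f (RHT.pr A n a) := pr_hom_comm (f := f.toLinearMap) h.2 n a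

theorem IsDGAHom.comp {C : Type} [GCDGA C] {f : A →ₐ[ℚ] B} {g : B →ₐ[ℚ] C} (hf : IsDGAHom f)
    (hg : IsDGAHom g) : IsDGAHom (g.comp f) :=
  ⟨fun a => by simp [hf.1, hg.1], fun i a ha => hg.2 i _ (hf.2 i a ha)⟩

theorem mem_gr_iff {n : ℕ} {a : A} : a ∈ Gr A n ↔ sc A 2 a = (2 : ℚ) ^ n • a := by
  refine ⟨sc_hom 2, fun h => ?_⟩
  have key : ∀ m, m ≠ n → pr A m a = 0 := fun m hm => by
    have h2 := pr_sc 2 m a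
    rw [h, map_smul] at h2
    have h3 : ((2 : ℚ) ^ n - 2 ^ m) • pr A m a = 0 := by rw [sub_smul, h2, sub_self]
    rcases smul_eq_zero.1 h3 with h4 | h4
    · exact absurd (Nat.pow_right_injective (le_refl 2)
        (by exact_mod_cast (sub_eq_zero.1 h4).symm)) hm
    · exact h4
  refine mem_of_pr fun m => ?_
  by_cases hm : m = n
  · exact hm ▸ pr_mem m a
  · rw [key m hm]; exact zero_mem _

/-- The subalgebra on which an algebra map commutes with scaling. -/
theorem graded_of_gen {f : A →ₐ[ℚ] B} {s : Set A} (hs : Algebra.adjoin ℚ s = ⊤)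
    (h : ∀ x ∈ s, ∃ n, x ∈ Gr A n ∧ f x ∈ Gr B n) :
    ∀ (i : ℕ) (a : A), a ∈ Gr A i → f a ∈ Gr B i := by
  have : f.comp (sc A 2) = (sc B 2).comp f := by
    refine AlgHom.ext_of_adjoin_eq_top hs fun x hx => ?_
    obtain ⟨n, h1, h2⟩ := h x hx
    simp [sc_hom 2 h1, sc_hom 2 h2]
  intro i a ha
  rw [mem_gr_iff]
  have h2 := DFunLike.congr_fun this a
  simp only [AlgHom.comp_apply] at h2
  rw [← h2, sc_hom 2 ha, map_smul]

theorem dga_of_gen {f : A →ₐ[ℚ] B} {s : Set A} (hs : Algebra.adjoin ℚ s = ⊤)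
    (h : ∀ x ∈ s, ∃ n, x ∈ Gr A n ∧ f x ∈ Gr B n) (hd : ∀ x ∈ s, f (Dd A x) = Dd B (f x)) :
    IsDGAHom f := by
  have hg := graded_of_gen hs h
  refine ⟨fun a => ?_, hg⟩
  have ha : a ∈ Algebra.adjoin ℚ s := hs ▸ Algebra.mem_top
  induction ha using Algebra.adjoin_induction with
  | mem x hx => exact hd x hx
  | algebraMap r => simp
  | add x y _ _ hx hy => simp [hx, hy]
  | mul x y _ _ hx hy =>
    rw [d_mul, map_add, map_mul, map_mul, hx, hy, map_mul, d_mul]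
    congr 2
    exact sc_dga_comm (f := f.toLinearMap) hg _ _

/-- Homogeneous submodules. -/
def Homog (P : Submodule ℚ A) : Prop := ∀ x ∈ P, ∀ n, pr A n x ∈ P

theorem Homog.sup {ι : Sort*} {P : ι → Submodule ℚ A} (h : ∀ i, Homog (P i)) :
    Homog (⨆ i, P i) := fun x hx n => by
  have : (⨆ i, P i) ≤ (⨆ i, P i).comap (pr A n) :=
    iSup_le fun i y hy => Submodule.mem_iSup_of_mem i (h i y hy n)
  exact this hx

theorem Homog.inf {P Q : Submodule ℚ A} (h : Homog P) (h' : Homog Q) : Homog (P ⊓ Q) :=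
  fun x hx n => ⟨h x hx.1 n, h' x hx.2 n⟩

theorem Homog.sup2 {P Q : Submodule ℚ A} (h : Homog P) (h' : Homog Q) : Homog (P ⊔ Q) := by
  intro x hx n
  have : P ⊔ Q ≤ (P ⊔ Q).comap (RHT.pr A n) :=
    sup_le (fun x hx => Submodule.mem_sup_left (h x hx n))
      (fun x hx => Submodule.mem_sup_right (h' x hx n))
  exact this hx

theorem homog_span {s : Set A} (h : ∀ x ∈ s, ∃ n, x ∈ Gr A n) : Homog (Submodule.span ℚ s) := by
  intro x hx n
  have : Submodule.span ℚ s ≤ (Submodule.span ℚ s).comap (pr A n) := by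
    rw [Submodule.span_le]
    intro y hy
    obtain ⟨m, hm⟩ := h y hy
    change pr A n y ∈ Submodule.span ℚ s
    rw [pr_eq_of_mem hm]
    split_ifs
    exacts [Submodule.subset_span hy, zero_mem _]
  exact this hx

theorem Homog.le_span {P : Submodule ℚ A} (h : Homog P) :
    P ≤ Submodule.span ℚ {x : A | x ∈ P ∧ ∃ n, x ∈ Gr A n} := fun x hx =>
  mem_of_pr fun n => Submodule.subset_span ⟨h x hx n, n, pr_mem n x⟩

open scoped Pointwise in
theorem Homog.mul {P Q : Submodule ℚ A} (h : Homog P) (h' : Homog Q) : Homog (P * Q) := by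
  have e : P * Q = Submodule.span ℚ ({x : A | x ∈ P ∧ ∃ n, x ∈ Gr A n} *
      {x : A | x ∈ Q ∧ ∃ n, x ∈ Gr A n}) := by
    rw [← Submodule.span_mul_span]
    refine le_antisymm (mul_le_mul' h.le_span h'.le_span) (mul_le_mul' ?_ ?_) <;>
    · rw [Submodule.span_le]; exact fun x hx => hx.1
  rw [e]
  refine homog_span ?_
  rintro _ ⟨x, ⟨-, n, hn⟩, y, ⟨-, m, hm⟩, rfl⟩
  exact ⟨n + m, gr_mul hn hm⟩

theorem homog_one : Homog (1 : Submodule ℚ A) := by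
  rw [Submodule.one_eq_span]
  exact homog_span fun (x : A) hx => ⟨0, by rw [Set.mem_singleton_iff.1 hx]; exact gr_one⟩

theorem Homog.pow {P : Submodule ℚ A} (h : Homog P) (n : ℕ) : Homog (P ^ n) := by
  induction n with
  | zero => rw [pow_zero]; exact homog_one
  | succ n ih => rw [pow_succ]; exact ih.mul h

theorem Homog.sc_mem {P : Submodule ℚ A} (h : Homog P) (c : ℚ) {x : A} (hx : x ∈ P) :
    sc A c x ∈ P :=
  mem_of_pr fun n => by rw [pr_sc]; exact Submodule.smul_mem _ _ (h x hx n)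

theorem homog_ker {f : A →ₐ[ℚ] B} (hf : IsDGAHom f) : Homog (LinearMap.ker f.toLinearMap) := by
  intro x hx n
  rw [LinearMap.mem_ker, AlgHom.toLinearMap_apply] at hx ⊢
  rw [← hf.pr, hx, map_zero]

theorem homog_ker_d : Homog (LinearMap.ker (Dd A)) := by
  intro x hx n
  rw [LinearMap.mem_ker] at hx ⊢
  rw [← pr_d, hx, map_zero]

theorem homog_range_d : Homog (LinearMap.range (Dd A)) := by
  rintro _ ⟨y, rfl⟩ n
  cases n with
  | zero => rw [pr_zero_d]; exact zero_mem _
  | succ n => rw [pr_d]; exact ⟨_, rfl⟩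

/-- A primitive of a homogeneous exact element can be chosen homogeneous. -/
theorem exact_hom {n : ℕ} {x y : A} (h : x = Dd A y) (hx : x ∈ Gr A (n + 1)) :
    x = Dd A (pr A n y) := by
  rw [← pr_d, ← h, pr_same hx]

end basics

section construct

/-- A grading from a compatible family of projections. -/
@[reducible] def gradedOfProj {R : Type} [Ring R] [Algebra ℚ R] (gr : ℕ → Submodule ℚ R) (P : ℕ → R →ₗ[ℚ] R)
    (same : ∀ n, ∀ x ∈ gr n, P n x = x) (ne : ∀ m n, m ≠ n → ∀ x ∈ gr m, P n x = 0)
    (top : (⨆ n, gr n) = ⊤) (one : (1 : R) ∈ gr 0)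
    (mul : ∀ i j a b, a ∈ gr i → b ∈ gr j → a * b ∈ gr (i + j)) : GradedAlgebra gr :=
  have hi : DirectSum.IsInternal gr := by
    refine DirectSum.isInternal_submodule_of_iSupIndep_of_iSup_eq_top ?_ top
    intro n
    rw [Submodule.disjoint_def]
    intro x hx hx'
    have : (⨆ j, ⨆ (_ : j ≠ n), gr j) ≤ LinearMap.ker (P n) :=
      iSup_le fun j => iSup_le fun hj y hy => ne j n hj y hy
    rw [← same n x hx]
    exact this hx'
  { hi.chooseDecomposition with
    one_mem := one
    mul_mem := fun i j a b => mul i j a b }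

/-- A gcdga from homogeneous spanning sets. -/
@[reducible] def mkG {R : Type} [Ring R] [Algebra ℚ R] (H : ℕ → Set R) (P : ℕ → R →ₗ[ℚ] R) (D : R →ₗ[ℚ] R)
    (same : ∀ n, ∀ x ∈ H n, P n x = x) (ne : ∀ m n, m ≠ n → ∀ x ∈ H m, P n x = 0)
    (top : ∀ x, x ∈ Submodule.span ℚ (⋃ n, H n)) (one : (1 : R) ∈ Submodule.span ℚ (H 0))
    (mul : ∀ i j, ∀ a ∈ H i, ∀ b ∈ H j, a * b ∈ Submodule.span ℚ (H (i + j)))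
    (comm : ∀ i j, ∀ a ∈ H i, ∀ b ∈ H j, a * b = ((-1 : ℚ) ^ (i * j)) • (b * a))
    (dd : ∀ i, ∀ a ∈ H i, D (D a) = 0)
    (dg : ∀ i, ∀ a ∈ H i, D a ∈ Submodule.span ℚ (H (i + 1)))
    (lb : ∀ i j, ∀ a ∈ H i, ∀ b ∈ H j, D (a * b) = D a * b + ((-1 : ℚ) ^ i) • (a * D b)) :
    GCDGA R where
  grading n := Submodule.span ℚ (H n)
  gradedAlgebra := by
    refine gradedOfProj _ P ?_ ?_ ?_ one ?_
    · intro n x hx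
      exact LinearMap.eqOn_span (f := P n) (g := LinearMap.id) (fun y hy => same n y hy) hx
    · intro m n h x hx
      exact LinearMap.eqOn_span (f := P n) (g := 0) (fun y hy => ne m n h y hy) hx
    · rw [← Submodule.span_iUnion]
      exact eq_top_iff.2 fun x _ => top x
    · intro i j a b ha hb
      have : Submodule.span ℚ (H i) * Submodule.span ℚ (H j) ≤ Submodule.span ℚ (H (i + j)) := by
        rw [Submodule.span_mul_span, Submodule.span_le]
        rintro _ ⟨x, hx, y, hy, rfl⟩
        exact mul i j x hx y hy
      exact this (Submodule.mul_mem_mul ha hb)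
  grading_comm i j a b ha hb := by
    induction ha, hb using Submodule.span_induction₂ with
    | mem_mem x y hx hy => exact comm i j x hx y hy
    | zero_left => simp
    | zero_right => simp
    | add_left x y z _ _ _ h1 h2 => rw [add_mul, h1, h2, mul_add, smul_add]
    | add_right x y z _ _ _ h1 h2 => rw [mul_add, h1, h2, add_mul, smul_add]
    | smul_left c x y _ _ h => rw [smul_mul_assoc, h, mul_smul_comm, smul_comm]
    | smul_right c x y _ _ h => rw [mul_smul_comm, h, smul_mul_assoc, smul_comm]
  d := D
  d_sq a := by
    induction top a using Submodule.span_induction with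
    | mem x hx => obtain ⟨i, hi⟩ := Set.mem_iUnion.1 hx; exact dd i x hi
    | zero => simp
    | add x y _ _ h1 h2 => rw [map_add, map_add, h1, h2, add_zero]
    | smul c x _ h => rw [map_smul, map_smul, h, smul_zero]
  d_grading i a ha := by
    have : Submodule.span ℚ (H i) ≤ (Submodule.span ℚ (H (i + 1))).comap D := by
      rw [Submodule.span_le]; exact fun x hx => dg i x hx
    exact this ha
  d_leibniz i a b ha := by
    induction ha, top b using Submodule.span_induction₂ with
    | mem_mem x y hx hy => obtain ⟨j, hj⟩ := Set.mem_iUnion.1 hy; exact lb i j x hx y hj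
    | zero_left => simp
    | zero_right => simp
    | add_left x y z _ _ _ h1 h2 => simp only [add_mul, map_add, h1, h2, smul_add]; abel
    | add_right x y z _ _ _ h1 h2 => simp only [mul_add, map_add, h1, h2, smul_add]; abel
    | smul_left c x y _ _ h =>
      simp only [smul_mul_assoc, map_smul, h, smul_add, smul_comm c]
    | smul_right c x y _ _ h =>
      simp only [mul_smul_comm, map_smul, h, smul_add, smul_comm c]

theorem desc {A Q M : Type} [AddCommGroup A] [Module ℚ A] [AddCommGroup Q] [Module ℚ Q]
    [AddCommGroup M] [Module ℚ M] (ρ : A →ₗ[ℚ] Q) (hs : Function.Surjective ρ)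
    (f : A →ₗ[ℚ] M) (h : ∀ a, ρ a = 0 → f a = 0) : ∃ g : Q →ₗ[ℚ] M, ∀ a, g (ρ a) = f a := by
  obtain ⟨s, hs⟩ := ρ.exists_rightInverse_of_surjective (LinearMap.range_eq_top.2 hs)
  refine ⟨f ∘ₗ s, fun a => ?_⟩
  have h1 : ρ (s (ρ a)) = ρ a := LinearMap.congr_fun hs (ρ a)
  have := h (s (ρ a) - a) (by rw [map_sub, h1, sub_self])
  rw [map_sub, sub_eq_zero] at this
  exact this

theorem top_of_gr {A : Type} [GCDGA A] (x : A) :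
    x ∈ Submodule.span ℚ (⋃ n, (Gr A n : Set A)) := by
  rw [Submodule.span_iUnion]
  simp only [Submodule.span_eq, iSup_gr, Submodule.mem_top]

theorem exists_quotient_aux {A Q : Type} [GCDGA A] [Ring Q] [Algebra ℚ Q] (ρ : A →ₐ[ℚ] Q)
    (hs : Function.Surjective ρ) (hh : Homog (LinearMap.ker ρ.toLinearMap))
    (hd : ∀ x, ρ x = 0 → ρ (Dd A x) = 0) :
    ∃ (Q' : Type) (_ : GCDGA Q') (ρ' : A →ₐ[ℚ] Q'), IsDGAHom ρ' ∧ Function.Surjective ρ' ∧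
      LinearMap.ker ρ'.toLinearMap = LinearMap.ker ρ.toLinearMap := by
  choose P hP using fun n => desc ρ.toLinearMap hs (ρ.toLinearMap ∘ₗ pr A n)
    (fun a ha => hh a ha n)
  obtain ⟨D, hD⟩ := desc ρ.toLinearMap hs (ρ.toLinearMap ∘ₗ Dd A) hd
  simp only [AlgHom.toLinearMap_apply, LinearMap.comp_apply] at hP hD
  let inst : GCDGA Q := mkG (fun n => ρ '' (Gr A n)) P D
    (by rintro n _ ⟨x, hx, rfl⟩; rw [hP, pr_same hx])
    (by rintro m n h _ ⟨x, hx, rfl⟩; rw [hP, pr_ne hx h, map_zero])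
    (by
      intro x
      obtain ⟨a, rfl⟩ := hs x
      have h1 := Submodule.mem_map_of_mem (f := ρ.toLinearMap) (top_of_gr a)
      rw [Submodule.map_span, Set.image_iUnion] at h1
      exact h1)
    (Submodule.subset_span ⟨1, gr_one, map_one ρ⟩)
    (by
      rintro i j _ ⟨a, ha, rfl⟩ _ ⟨b, hb, rfl⟩
      exact Submodule.subset_span ⟨_, gr_mul ha hb, map_mul ρ a b⟩)
    (by
      rintro i j _ ⟨a, ha, rfl⟩ _ ⟨b, hb, rfl⟩
      rw [← map_mul, gr_comm ha hb, map_smul, map_mul])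
    (by rintro i _ ⟨a, ha, rfl⟩; rw [hD, hD, d_d, map_zero])
    (by rintro i _ ⟨a, ha, rfl⟩; rw [hD]; exact Submodule.subset_span ⟨_, d_gr ha, rfl⟩)
    (by
      rintro i j _ ⟨a, ha, rfl⟩ _ ⟨b, hb, rfl⟩
      rw [← map_mul, hD, hD, hD, d_mul, sg_hom ha]; simp)
  exact ⟨Q, inst, ρ, ⟨fun a => (hD a).symm, fun i a ha => Submodule.subset_span ⟨a, ha, rfl⟩⟩,
    hs, rfl⟩

theorem exists_quotient {A : Type} [GCDGA A] (I : Submodule ℚ A)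
    (hl : ∀ a, ∀ x ∈ I, a * x ∈ I) (hr : ∀ a, ∀ x ∈ I, x * a ∈ I) (hh : Homog I)
    (hd : ∀ x ∈ I, Dd A x ∈ I) :
    ∃ (Q : Type) (_ : GCDGA Q) (ρ : A →ₐ[ℚ] Q), IsDGAHom ρ ∧ Function.Surjective ρ ∧
      LinearMap.ker ρ.toLinearMap = I := by
  let J : Ideal A := { I.toAddSubmonoid with smul_mem' := fun a x hx => hl a x hx }
  have : J.IsTwoSided := ⟨fun b hx => hr b _ hx⟩
  have hJ : ∀ x, x ∈ J ↔ x ∈ I := fun x => Iff.rfl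
  have hk : LinearMap.ker (Ideal.Quotient.mkₐ ℚ J).toLinearMap = I := by
    ext x
    rw [LinearMap.mem_ker, AlgHom.toLinearMap_apply, Ideal.Quotient.mkₐ_eq_mk,
      Ideal.Quotient.eq_zero_iff_mem, hJ]
  have := exists_quotient_aux (Ideal.Quotient.mkₐ ℚ J) (Ideal.Quotient.mkₐ_surjective ℚ J)
    (by rw [hk]; exact hh) (fun x hx => by
      have hx' : x ∈ LinearMap.ker (Ideal.Quotient.mkₐ ℚ J).toLinearMap := hx
      rw [hk] at hx'
      have h2 := hd x hx'
      rw [← hk] at h2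
      exact h2)
  rwa [hk] at this

theorem exists_sub {A : Type} [GCDGA A] (S : Subalgebra ℚ A)
    (hh : Homog (Subalgebra.toSubmodule S)) (hd : ∀ x ∈ S, Dd A x ∈ S) :
    ∃ (C : Type) (_ : GCDGA C) (i : C →ₐ[ℚ] A), IsDGAHom i ∧ Function.Injective i ∧
      (∀ x, x ∈ S ↔ ∃ y, i y = x) ∧ ∀ n y, i y ∈ Gr A n → y ∈ Gr C n := by
  let P : ℕ → S →ₗ[ℚ] S := fun n => (pr A n).restrict (p := Subalgebra.toSubmodule S)
    (q := Subalgebra.toSubmodule S) (fun x hx => hh x hx n)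
  let D : S →ₗ[ℚ] S := (Dd A).restrict (p := Subalgebra.toSubmodule S)
    (q := Subalgebra.toSubmodule S) hd
  have hP : ∀ n (x : S), ((P n x : S) : A) = pr A n x := fun n x => rfl
  have hD : ∀ (x : S), ((D x : S) : A) = Dd A x := fun x => rfl
  let inst : GCDGA S := mkG (fun n => {x : S | (x : A) ∈ Gr A n}) P D
    (fun n x hx => Subtype.ext (by rw [hP, pr_same hx]))
    (fun m n h x hx => Subtype.ext (by rw [hP, pr_ne hx h]; rfl))
    (by
      intro x
      obtain ⟨N, hN⟩ := pr_finite (x : A)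
      have : x = ∑ n ∈ Finset.range (N + 1), P n x := by
        apply Subtype.ext
        rw [AddSubmonoidClass.coe_finsetSum]
        simp only [hP]
        apply eq_of_pr
        intro m
        rw [map_sum]
        simp only [pr_eq_of_mem (pr_mem _ _)]
        rw [Finset.sum_ite_eq' (Finset.range (N + 1)) m (fun n => pr A n (x : A))]
        split_ifs with h
        · rfl
        · exact hN m (by simpa using h)
      rw [this]
      exact Submodule.sum_mem _ fun n _ => Submodule.subset_span
        (Set.mem_iUnion.2 ⟨n, pr_mem n (x : A)⟩))
    (Submodule.subset_span gr_one)
    (fun i j a ha b hb => Submodule.subset_span (gr_mul ha hb))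
    (fun i j a ha b hb => Subtype.ext (gr_comm ha hb))
    (fun i a ha => Subtype.ext (by rw [hD, hD, d_d]; rfl))
    (fun i a ha => Submodule.subset_span (d_gr ha))
    (fun i j a ha b hb => Subtype.ext (GCDGA.d_leibniz i (a : A) b ha))
  refine ⟨S, inst, S.val, ⟨fun a => rfl, fun n a ha => ?_⟩, Subtype.val_injective, fun x => ?_,
    fun n y hy => Submodule.subset_span hy⟩
  · have : Submodule.span ℚ {x : S | (x : A) ∈ Gr A n} ≤ (Gr A n).comap S.val.toLinearMap :=
      Submodule.span_le.2 fun x hx => hx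
    exact this ha
  · exact ⟨fun h => ⟨⟨x, h⟩, rfl⟩, by rintro ⟨y, rfl⟩; exact y.2⟩

theorem exists_prod (A B : Type) [GCDGA A] [GCDGA B] :
    ∃ (C : Type) (_ : GCDGA C) (p : C →ₐ[ℚ] A) (q : C →ₐ[ℚ] B), IsDGAHom p ∧ IsDGAHom q ∧
      (∀ a b, ∃ c, p c = a ∧ q c = b) ∧ (∀ c c', p c = p c' → q c = q c' → c = c') ∧
      ∀ n c, p c ∈ Gr A n → q c ∈ Gr B n → c ∈ Gr C n := by
  let inst : GCDGA (A × B) := mkG (fun n => {x : A × B | x.1 ∈ Gr A n ∧ x.2 ∈ Gr B n})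
    (fun n => (pr A n).prodMap (pr B n)) ((Dd A).prodMap (Dd B))
    (fun n x hx => Prod.ext (pr_same hx.1) (pr_same hx.2))
    (fun m n h x hx => Prod.ext (pr_ne hx.1 h) (pr_ne hx.2 h))
    (by
      intro x
      have h1 := Submodule.mem_map_of_mem (f := LinearMap.inl ℚ A B) (top_of_gr x.1)
      have h2 := Submodule.mem_map_of_mem (f := LinearMap.inr ℚ A B) (top_of_gr x.2)
      rw [Submodule.map_span, Set.image_iUnion] at h1 h2
      have h3 : x = LinearMap.inl ℚ A B x.1 + LinearMap.inr ℚ A B x.2 := by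
        ext <;> simp
      rw [h3]
      refine Submodule.add_mem _ (Submodule.span_mono (Set.iUnion_mono fun n => ?_) h1)
        (Submodule.span_mono (Set.iUnion_mono fun n => ?_) h2)
      · rintro _ ⟨a, ha, rfl⟩; exact ⟨ha, zero_mem _⟩
      · rintro _ ⟨a, ha, rfl⟩; exact ⟨zero_mem _, ha⟩)
    (Submodule.subset_span ⟨gr_one, gr_one⟩)
    (fun i j a ha b hb => Submodule.subset_span ⟨gr_mul ha.1 hb.1, gr_mul ha.2 hb.2⟩)
    (fun i j a ha b hb => Prod.ext (gr_comm ha.1 hb.1) (gr_comm ha.2 hb.2))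
    (fun i a ha => Prod.ext (d_d a.1) (d_d a.2))
    (fun i a ha => Submodule.subset_span ⟨d_gr ha.1, d_gr ha.2⟩)
    (fun i j a ha b hb => Prod.ext (GCDGA.d_leibniz i _ _ ha.1) (GCDGA.d_leibniz i _ _ ha.2))
  refine ⟨A × B, inst, AlgHom.fst ℚ A B, AlgHom.snd ℚ A B, ⟨fun a => rfl, fun n a ha => ?_⟩,
    ⟨fun a => rfl, fun n a ha => ?_⟩, fun a b => ⟨(a, b), rfl, rfl⟩,
    fun c c' h h' => Prod.ext h h', fun n c h h' => Submodule.subset_span ⟨h, h'⟩⟩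
  · have : Submodule.span ℚ {x : A × B | x.1 ∈ Gr A n ∧ x.2 ∈ Gr B n} ≤
        (Gr A n).comap (AlgHom.fst ℚ A B).toLinearMap := Submodule.span_le.2 fun x hx => hx.1
    exact this ha
  · have : Submodule.span ℚ {x : A × B | x.1 ∈ Gr A n ∧ x.2 ∈ Gr B n} ≤
        (Gr B n).comap (AlgHom.snd ℚ A B).toLinearMap := Submodule.span_le.2 fun x hx => hx.2
    exact this ha

theorem exists_zero_d (A : Type) [GCDGA A] :
    ∃ (B : Type) (_ : GCDGA B) (e : A ≃ₐ[ℚ] B), Dd B = 0 ∧ ∀ n a, a ∈ Gr A n ↔ e a ∈ Gr B n := by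
  let inst : GCDGA A :=
    { (inferInstance : Ring A), (inferInstance : Algebra ℚ A) with
      grading := Gr A
      gradedAlgebra := inferInstance
      grading_comm := fun i j a b => gr_comm
      d := 0
      d_sq := fun _ => rfl
      d_grading := fun i a _ => zero_mem _
      d_leibniz := fun i a b _ => by simp }
  exact ⟨A, inst, AlgEquiv.refl, rfl, fun n a => Iff.rfl⟩

/-- A gcdga reduced to the base field. -/
def IsBase (K : Type) [GCDGA K] : Prop := Function.Bijective (algebraMap ℚ K)

theorem exists_base : ∃ (K : Type) (_ : GCDGA K), IsBase K := by
  let inst : GCDGA ℚ := mkG (fun n => {x | n ≠ 0 → x = 0})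
    (fun n => if n = 0 then LinearMap.id else 0) 0
    (fun n x hx => by
      split_ifs with h
      · rfl
      · exact (hx h).symm)
    (fun m n h x hx => by
      split_ifs with h'
      · exact hx (by omega)
      · rfl)
    (fun x => Submodule.subset_span (Set.mem_iUnion.2 ⟨0, fun h => absurd rfl h⟩))
    (Submodule.subset_span fun h => absurd rfl h)
    (fun i j a ha b hb => Submodule.subset_span fun h => by
      by_cases hi : i = 0
      · rw [hb (by omega), mul_zero]
      · rw [ha hi, zero_mul])
    (fun i j a ha b hb => by
      by_cases hi : i = 0
      · subst hi; simp; exact mul_comm a b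
      · rw [ha hi]; simp)
    (fun _ _ _ => rfl) (fun _ _ _ => zero_mem _) (fun _ _ _ _ _ _ => by simp)
  exact ⟨ℚ, inst, Function.bijective_id⟩

section base
variable {K : Type} [GCDGA K]

theorem IsBase.gr (hK : IsBase K) (x : K) : x ∈ Gr K 0 := by
  obtain ⟨c, rfl⟩ := hK.2 x
  rw [Algebra.algebraMap_eq_smul_one]
  exact Submodule.smul_mem _ _ gr_one

theorem IsBase.d (hK : IsBase K) (x : K) : Dd K x = 0 := by
  obtain ⟨c, rfl⟩ := hK.2 x
  exact d_algebraMap c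

theorem IsBase.exists_unit (hK : IsBase K) (B : Type) [GCDGA B] :
    ∃ u : K →ₐ[ℚ] B, IsDGAHom u := by
  let e : ℚ ≃ₐ[ℚ] K := AlgEquiv.ofBijective (Algebra.ofId ℚ K) hK
  refine ⟨(Algebra.ofId ℚ B).comp e.symm.toAlgHom, fun a => ?_, fun n a ha => ?_⟩
  · rw [hK.d, map_zero]
    exact (d_algebraMap _).symm
  · by_cases h : n = 0
    · subst h
      change algebraMap ℚ B _ ∈ _
      rw [Algebra.algebraMap_eq_smul_one]
      exact Submodule.smul_mem _ _ gr_one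
    · have : a = 0 := by rw [← pr_same ha, pr_ne (hK.gr a) (Ne.symm h)]
      rw [this, map_zero]; exact zero_mem _

theorem IsBase.hom_ext (hK : IsBase K) {B : Type} [Ring B] [Algebra ℚ B] (f g : K →ₐ[ℚ] B) :
    f = g := by
  ext x
  obtain ⟨c, rfl⟩ := hK.2 x
  rw [AlgHom.commutes, AlgHom.commutes]

end base

end construct

/-- `B'` is the elementary extension `B ⊗ Λw` with `dw = z`, `w` of degree `k`. -/
structure IsHirsch (B B' : Type) [GCDGA B] [GCDGA B'] (i : B →ₐ[ℚ] B') (k : ℕ) (w : B') (z : B) :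
    Prop where
  hz : z ∈ Gr B (k + 1)
  dz : Dd B z = 0
  dga : IsDGAHom i
  hw : w ∈ Gr B' k
  dw : Dd B' w = i z
  span : ∀ P : Submodule ℚ B', (∀ b l, i b * w ^ l ∈ P) → ∀ x, x ∈ P
  lin : ∀ (M : Type) [AddCommGroup M] [Module ℚ M] (φ : ℕ → B →ₗ[ℚ] M),
    (Odd k → ∀ l, 2 ≤ l → φ l = 0) → ∃ Φ : B' →ₗ[ℚ] M, ∀ l b, Φ (i b * w ^ l) = φ l b

section even
open Polynomial

theorem exists_hirsch_even (B : Type) [GCDGA B] (k : ℕ) (hk : ¬ Odd k) (z : B)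
    (hz : z ∈ Gr B (k + 1)) (dz : Dd B z = 0) :
    ∃ (B' : Type) (_ : GCDGA B') (i : B →ₐ[ℚ] B') (w : B'), IsHirsch B B' i k w z := by
  have hk' : Even k := Nat.not_odd_iff_even.1 hk
  have hk1 : Odd (k + 1) := hk'.add_one
  let mon : ℕ → B →ₗ[ℚ] B[X] := fun l => (monomial l).restrictScalars ℚ
  have hmon : ∀ l b, mon l b = monomial l b := fun l b => rfl
  have hmul : ∀ l b l' b', mon l b * mon l' b' = mon (l + l') (b * b') := fun l b l' b' => by
    simp only [hmon, monomial_mul_monomial]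
  have lext : ∀ (M : Type) [AddCommGroup M] [Module ℚ M] (φ : ℕ → B →ₗ[ℚ] M) (l : ℕ) (b : B),
      Polynomial.lsum φ (mon l b) = φ l b := fun M _ _ φ l b => by
    rw [lsum_apply, hmon, sum_monomial_index]; simp
  have hspan : ∀ (P : Submodule ℚ B[X]), (∀ l b, mon l b ∈ P) → ∀ x, x ∈ P := by
    intro P h x
    rw [x.as_sum_support]
    exact Submodule.sum_mem _ fun l _ => h l _
  let D : B[X] →ₗ[ℚ] B[X] := Polynomial.lsum fun l =>
    mon l ∘ₗ Dd B + (l : ℚ) • (mon (l - 1) ∘ₗ LinearMap.mulRight ℚ z ∘ₗ (sg B).toLinearMap)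
  have hD : ∀ l b, D (mon l b) = mon l (Dd B b) + (l : ℚ) • mon (l - 1) (sg B b * z) := fun l b => by
    rw [lext]; rfl
  let P : ℕ → B[X] →ₗ[ℚ] B[X] := fun n => Polynomial.lsum fun l =>
    if k * l ≤ n then mon l ∘ₗ pr B (n - k * l) else 0
  have hP : ∀ n l b, P n (mon l b) = if k * l ≤ n then mon l (pr B (n - k * l) b) else 0 := by
    intro n l b
    rw [lext]; split_ifs <;> rfl
  have hzz : ∀ b : B, z * b = sg B b * z := fun b => mul_comm_odd hz hk1 b
  have hsgz : sg B z = - z := by rw [sg_hom hz, hk1.neg_one_pow, neg_one_smul]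
  let H : ℕ → Set B[X] := fun n => {p | ∃ l m b, b ∈ Gr B m ∧ m + k * l = n ∧ p = mon l b}
  have Hmem : ∀ n l m b, b ∈ Gr B m → m + k * l = n → mon l b ∈ H n :=
    fun n l m b h h' => ⟨l, m, b, h, h', rfl⟩
  have sgn : ∀ m l, (-1 : ℚ) ^ (m + k * l) = (-1) ^ m := fun m l => by
    rw [pow_add, pow_mul, hk'.neg_one_pow, one_pow, mul_one]
  have lmon : ∀ (l : ℕ) (b : B), mon l b ∈ Submodule.span ℚ (⋃ n, H n) := fun l b => by
    have : (⊤ : Submodule ℚ B) ≤ (Submodule.span ℚ (⋃ n, H n)).comap (mon l) := by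
      rw [← iSup_gr, iSup_le_iff]
      exact fun n x hx => Submodule.subset_span (Set.mem_iUnion.2 ⟨_, Hmem _ l n x hx rfl⟩)
    exact this Submodule.mem_top
  have h1 : mon 0 (1 : B) = 1 := rfl
  let inst : GCDGA B[X] := mkG H P D
    (by
      rintro n _ ⟨l, m, b, hb, rfl, rfl⟩
      rw [hP, if_pos (Nat.le_add_left _ _), Nat.add_sub_cancel, pr_same hb])
    (by
      rintro n n' hn _ ⟨l, m, b, hb, rfl, rfl⟩
      rw [hP]
      split_ifs with h
      · rw [pr_ne hb (by omega), map_zero]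
      · rfl)
    (hspan _ lmon)
    (Submodule.subset_span (h1 ▸ Hmem 0 0 0 1 gr_one (by simp)))
    (by
      rintro i j _ ⟨l, m, b, hb, rfl, rfl⟩ _ ⟨l', m', b', hb', rfl, rfl⟩
      rw [hmul]
      exact Submodule.subset_span (Hmem _ _ _ _ (gr_mul hb hb') (by ring)))
    (by
      rintro i j _ ⟨l, m, b, hb, rfl, rfl⟩ _ ⟨l', m', b', hb', rfl, rfl⟩
      rw [hmul, hmul, gr_comm hb hb', map_smul, add_comm l' l]
      congr 1
      rw [show (m + k * l) * (m' + k * l') = m * m' + k * (l * m' + l' * m + k * l * l') by ring,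
        sgn])
    (by
      rintro i _ ⟨l, m, b, hb, rfl, rfl⟩
      rw [hD, map_add, map_smul, hD, hD, d_d, d_mul, dz, map_mul (sg B), hsgz]
      have : z * z = 0 := odd_sq hz hk1
      simp [sg_d, mul_assoc, this])
    (by
      rintro i _ ⟨l, m, b, hb, rfl, rfl⟩
      rw [hD]
      refine Submodule.add_mem _ (Submodule.subset_span (Hmem _ _ _ _ (d_gr hb) (by ring))) ?_
      rcases l with _ | l
      · simp
      · exact Submodule.smul_mem _ _ (Submodule.subset_span (Hmem _ _ _ _
          (gr_mul (sc_gr _ hb) hz) (by simp only [Nat.add_sub_cancel]; ring))))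
    (by
      rintro i j _ ⟨l, m, b, hb, rfl, rfl⟩ _ ⟨l', m', b', hb', rfl, rfl⟩
      rw [sgn, ← smul_mul_assoc, ← map_smul, ← sg_hom hb]
      simp only [hD, hmul, add_mul, mul_add, smul_mul_assoc, mul_smul_comm, d_mul, map_add,
        map_mul (sg B)]
      have e1 : (l : ℚ) • mon (l - 1 + l') (sg B b * z * b') =
          (l : ℚ) • mon (l + l' - 1) (sg B b * sg B b' * z) := by
        rcases l with _ | l
        · simp
        · rw [mul_assoc, hzz, ← mul_assoc]; congr 3; omega
      have e2 : (l' : ℚ) • mon (l + (l' - 1)) (sg B b * (sg B b' * z)) =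
          (l' : ℚ) • mon (l + l' - 1) (sg B b * sg B b' * z) := by
        rcases l' with _ | l
        · simp
        · rw [← mul_assoc]; rfl
      rw [e1, e2]
      push_cast
      rw [add_smul]
      abel)
  have hGr : ∀ n l m b, b ∈ Gr B m → m + k * l = n → mon l b ∈ Gr B[X] n :=
    fun n l m b h h' => Submodule.subset_span (Hmem n l m b h h')
  let i : B →ₐ[ℚ] B[X] := AlgHom.ofLinearMap (mon 0) h1 fun x y => by rw [hmul]
  have hX : ∀ l, (mon 1 1) ^ l = mon l 1 := fun l => by
    induction l with
    | zero => rw [pow_zero, h1]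
    | succ l ih => rw [pow_succ, ih, hmul, mul_one]
  have hi : ∀ b l, i b * (mon 1 1) ^ l = mon l b := fun b l => by
    rw [hX]
    change mon 0 b * mon l 1 = _
    rw [hmul, zero_add, mul_one]
  refine ⟨B[X], inst, i, mon 1 1, hz, dz, ⟨fun b => ?_, fun n b hb => ?_⟩, ?_, ?_, ?_, ?_⟩
  · change mon 0 (Dd B b) = D (mon 0 b)
    rw [hD]; simp
  · exact hGr n 0 n b hb (by simp)
  · exact hGr k 1 0 1 gr_one (by simp)
  · change D (mon 1 1) = mon 0 z
    rw [hD]; simp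
  · intro P hP x
    exact hspan P (fun l b => hi b l ▸ hP b l) x
  · intro M _ _ φ _
    exact ⟨Polynomial.lsum φ, fun l b => by rw [hi, lext]⟩

end even

section odd

/-- The underlying module of the extension by an odd generator. -/
@[ext] structure OddX (B : Type) where
  /-- constant coefficient -/
  fst : B
  /-- top coefficient -/
  snd : B

variable {B : Type} [GCDGA B]

namespace OddX

instance : Add (OddX B) := ⟨fun x y => ⟨x.fst + y.fst, x.snd + y.snd⟩⟩
instance : Zero (OddX B) := ⟨⟨0, 0⟩⟩
instance : Neg (OddX B) := ⟨fun x => ⟨-x.fst, -x.snd⟩⟩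

instance : AddCommGroup (OddX B) :=
  { AddGroup.ofLeftAxioms (G := OddX B)
      (fun _ _ _ => OddX.ext (add_assoc _ _ _) (add_assoc _ _ _))
      (fun _ => OddX.ext (zero_add _) (zero_add _))
      (fun _ => OddX.ext (neg_add_cancel _) (neg_add_cancel _)) with
    add_comm := fun _ _ => OddX.ext (add_comm _ _) (add_comm _ _) }

@[simp] theorem fst_add (x y : OddX B) : (x + y).fst = x.fst + y.fst := rfl
@[simp] theorem snd_add (x y : OddX B) : (x + y).snd = x.snd + y.snd := rfl
@[simp] theorem fst_zero : (0 : OddX B).fst = 0 := rfl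
@[simp] theorem snd_zero : (0 : OddX B).snd = 0 := rfl

instance : Module ℚ (OddX B) where
  smul c x := ⟨c • x.fst, c • x.snd⟩
  one_smul _ := OddX.ext (one_smul _ _) (one_smul _ _)
  mul_smul _ _ _ := OddX.ext (mul_smul _ _ _) (mul_smul _ _ _)
  smul_zero _ := OddX.ext (smul_zero _) (smul_zero _)
  smul_add _ _ _ := OddX.ext (smul_add _ _ _) (smul_add _ _ _)
  add_smul _ _ _ := OddX.ext (add_smul _ _ _) (add_smul _ _ _)
  zero_smul _ := OddX.ext (zero_smul _ _) (zero_smul _ _)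

@[simp] theorem fst_smul (c : ℚ) (x : OddX B) : (c • x).fst = c • x.fst := rfl
@[simp] theorem snd_smul (c : ℚ) (x : OddX B) : (c • x).snd = c • x.snd := rfl

instance : Mul (OddX B) := ⟨fun x y => ⟨x.fst * y.fst, x.fst * y.snd + x.snd * sg B y.fst⟩⟩
instance : One (OddX B) := ⟨⟨1, 0⟩⟩

@[simp] theorem fst_mul (x y : OddX B) : (x * y).fst = x.fst * y.fst := rfl
@[simp] theorem snd_mul (x y : OddX B) :
    (x * y).snd = x.fst * y.snd + x.snd * sg B y.fst := rfl
@[simp] theorem fst_one : (1 : OddX B).fst = 1 := rfl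
@[simp] theorem snd_one : (1 : OddX B).snd = 0 := rfl

instance : Ring (OddX B) :=
  { (inferInstance : AddCommGroup (OddX B)) with
    mul_assoc := fun x y z => OddX.ext (mul_assoc _ _ _)
      (by simp [mul_add, add_mul, mul_assoc, add_assoc])
    one_mul := fun x => OddX.ext (one_mul _) (by simp)
    mul_one := fun x => OddX.ext (mul_one _) (by simp)
    left_distrib := fun x y z => OddX.ext (mul_add _ _ _) (by simp [mul_add]; abel)
    right_distrib := fun x y z => OddX.ext (add_mul _ _ _) (by simp [add_mul]; abel)
    zero_mul := fun x => OddX.ext (zero_mul _) (by simp)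
    mul_zero := fun x => OddX.ext (mul_zero _) (by simp) }

instance : Algebra ℚ (OddX B) := Algebra.ofModule
  (fun c x y => OddX.ext (by simp) (by simp))
  (fun c x y => OddX.ext (by simp) (by simp))

end OddX

theorem exists_hirsch_odd (B : Type) [GCDGA B] (k : ℕ) (hk : Odd k) (z : B)
    (hz : z ∈ Gr B (k + 1)) (dz : Dd B z = 0) :
    ∃ (B' : Type) (_ : GCDGA B') (i : B →ₐ[ℚ] B') (w : B'), IsHirsch B B' i k w z := by
  have hk1 : ¬ Odd (k + 1) := Nat.not_odd_iff_even.2 hk.add_one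
  let f : OddX B →ₗ[ℚ] B := ⟨⟨OddX.fst, fun _ _ => rfl⟩, fun _ _ => rfl⟩
  let s : OddX B →ₗ[ℚ] B := ⟨⟨OddX.snd, fun _ _ => rfl⟩, fun _ _ => rfl⟩
  let u : B →ₗ[ℚ] OddX B := ⟨⟨fun b => ⟨b, 0⟩, fun _ _ => OddX.ext rfl (by simp)⟩,
    fun _ _ => OddX.ext rfl (by simp)⟩
  let v : B →ₗ[ℚ] OddX B := ⟨⟨fun b => ⟨0, b⟩, fun _ _ => OddX.ext (by simp) rfl⟩,
    fun _ _ => OddX.ext (by simp) rfl⟩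
  have hfu : ∀ b, (u b).fst = b := fun _ => rfl
  have hsu : ∀ b, (u b).snd = 0 := fun _ => rfl
  have hfv : ∀ b, (v b).fst = 0 := fun _ => rfl
  have hsv : ∀ b, (v b).snd = b := fun _ => rfl
  have hx : ∀ x : OddX B, x = u x.fst + v x.snd := fun x => by ext <;> simp [hfu, hsu, hfv, hsv]
  have huu : ∀ a b, u a * u b = u (a * b) := fun a b => by ext <;> simp [hfu, hsu]
  have huv : ∀ a b, u a * v b = v (a * b) := fun a b => by ext <;> simp [hfu, hsu, hfv, hsv]
  have hvu : ∀ a b, v a * u b = v (a * sg B b) := fun a b => by ext <;> simp [hfu, hsu, hfv, hsv]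
  have hvv : ∀ a b, v a * v b = 0 := fun a b => by ext <;> simp [hfv, hsv]
  let D : OddX B →ₗ[ℚ] OddX B := u ∘ₗ (Dd B ∘ₗ f + LinearMap.mulRight ℚ z ∘ₗ (sg B).toLinearMap ∘ₗ s)
    + v ∘ₗ Dd B ∘ₗ s
  have hDu : ∀ b, D (u b) = u (Dd B b) := fun b => by
    change u (Dd B b + sg B 0 * z) + v (Dd B 0) = _
    simp
  have hDv : ∀ b, D (v b) = u (sg B b * z) + v (Dd B b) := fun b => by
    change u (Dd B 0 + sg B b * z) + v (Dd B b) = _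
    simp
  let P : ℕ → OddX B →ₗ[ℚ] OddX B := fun n => u ∘ₗ pr B n ∘ₗ f +
    if k ≤ n then v ∘ₗ pr B (n - k) ∘ₗ s else 0
  have hPu : ∀ n b, P n (u b) = u (pr B n b) := fun n b => by
    change u (pr B n b) + (if k ≤ n then v ∘ₗ pr B (n - k) ∘ₗ s else 0) (u b) = _
    have : s (u b) = 0 := rfl
    split_ifs <;> simp [this]
  have hPv : ∀ n b, P n (v b) = if k ≤ n then v (pr B (n - k) b) else 0 := fun n b => by
    change u (pr B n 0) + (if k ≤ n then v ∘ₗ pr B (n - k) ∘ₗ s else 0) (v b) = _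
    have : s (v b) = b := rfl
    split_ifs <;> simp [this]
  let H : ℕ → Set (OddX B) := fun n => {p | (∃ b, b ∈ Gr B n ∧ p = u b) ∨
    ∃ m b, b ∈ Gr B m ∧ m + k = n ∧ p = v b}
  have Hu : ∀ n b, b ∈ Gr B n → u b ∈ Submodule.span ℚ (H n) :=
    fun n b h => Submodule.subset_span (Or.inl ⟨b, h, rfl⟩)
  have Hv : ∀ n m b, b ∈ Gr B m → m + k = n → v b ∈ Submodule.span ℚ (H n) :=
    fun n m b h h' => Submodule.subset_span (Or.inr ⟨m, b, h, h', rfl⟩)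
  have hle : ∀ n, Submodule.span ℚ (H n) ≤ Submodule.span ℚ (⋃ n, H n) := fun n =>
    Submodule.span_mono (Set.subset_iUnion H n)
  have hsp : ∀ x, x ∈ Submodule.span ℚ (⋃ n, H n) := fun x => by
    have h1 : (⊤ : Submodule ℚ B) ≤ (Submodule.span ℚ (⋃ n, H n)).comap u := by
      rw [← iSup_gr, iSup_le_iff]
      exact fun n x hx => hle n (Hu n x hx)
    have h2 : (⊤ : Submodule ℚ B) ≤ (Submodule.span ℚ (⋃ n, H n)).comap v := by
      rw [← iSup_gr, iSup_le_iff]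
      exact fun n x hx => hle (n + k) (Hv _ n x hx rfl)
    rw [hx x]
    exact Submodule.add_mem _ (h1 Submodule.mem_top) (h2 Submodule.mem_top)
  have hzz : ∀ b : B, z * b = b * z := fun b => mul_comm_even hz hk1 b
  have hsgz : sg B z = z := by
    rw [sg_hom hz, (Nat.not_odd_iff_even.1 hk1).neg_one_pow, one_smul]
  have p1 : ∀ m, (-1 : ℚ) ^ (m * k) = (-1) ^ m := fun m => by
    rw [mul_comm, pow_mul, hk.neg_one_pow]
  have p2 : ∀ m : ℕ, (-1 : ℚ) ^ (m + k) = - (-1) ^ m := fun m => by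
    rw [pow_add, hk.neg_one_pow, mul_neg_one]
  let inst : GCDGA (OddX B) := mkG H P D
    (by
      rintro n _ (⟨b, hb, rfl⟩ | ⟨m, b, hb, rfl, rfl⟩)
      · rw [hPu, pr_same hb]
      · rw [hPv, if_pos (Nat.le_add_left _ _), Nat.add_sub_cancel, pr_same hb])
    (by
      rintro n n' hn _ (⟨b, hb, rfl⟩ | ⟨m, b, hb, rfl, rfl⟩)
      · rw [hPu, pr_ne hb hn, map_zero]
      · rw [hPv]
        split_ifs with h
        · rw [pr_ne hb (by omega), map_zero]
        · rfl)
    hsp (Hu 0 1 gr_one)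
    (by
      rintro i j _ (⟨b, hb, rfl⟩ | ⟨m, b, hb, rfl, rfl⟩) _ (⟨b', hb', rfl⟩ | ⟨m', b', hb', rfl, rfl⟩)
      · rw [huu]; exact Hu _ _ (gr_mul hb hb')
      · rw [huv]; exact Hv _ _ _ (gr_mul hb hb') (by ring)
      · rw [hvu]; exact Hv _ _ _ (gr_mul hb (sc_gr _ hb')) (by ring)
      · rw [hvv]; exact zero_mem _)
    (by
      rintro i j _ (⟨b, hb, rfl⟩ | ⟨m, b, hb, rfl, rfl⟩) _ (⟨b', hb', rfl⟩ | ⟨m', b', hb', rfl, rfl⟩)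
      · rw [huu, huu, gr_comm hb hb', map_smul]
      · rw [huv, hvu, gr_comm hb hb', sg_hom hb, mul_add, pow_add, p1, map_smul, mul_smul_comm,
          map_smul, smul_smul, mul_assoc, ← mul_pow]
        simp
      · rw [huv, hvu, gr_comm hb (sc_gr _ hb'), sg_hom hb', add_mul, pow_add, mul_comm k, p1,
          map_smul, smul_mul_assoc, map_smul, smul_smul]
      · rw [hvv, hvv, smul_zero])
    (by
      rintro i _ (⟨b, hb, rfl⟩ | ⟨m, b, hb, rfl, rfl⟩)
      · rw [hDu, hDu, d_d, map_zero]
      · rw [hDv, map_add, hDu, hDv, d_d, map_zero, d_mul, dz, sg_d]; simp)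
    (by
      rintro i _ (⟨b, hb, rfl⟩ | ⟨m, b, hb, rfl, rfl⟩)
      · rw [hDu]; exact Hu _ _ (d_gr hb)
      · rw [hDv]
        exact Submodule.add_mem _ (Hu _ _
          (show _ ∈ Gr B (m + (k + 1)) from gr_mul (sc_gr _ hb) hz)) (Hv _ _ _ (d_gr hb) (by ring)))
    (by
      rintro i j _ (⟨b, hb, rfl⟩ | ⟨m, b, hb, rfl, rfl⟩) _ (⟨b', hb', rfl⟩ | ⟨m', b', hb', rfl, rfl⟩)
      · rw [← smul_mul_assoc, ← map_smul, ← sg_hom hb, huu, hDu, hDu, hDu, huu, huu, d_mul, map_add]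
      · rw [← smul_mul_assoc, ← map_smul, ← sg_hom hb]
        simp only [hDv, hDu, mul_add, huv, huu, d_mul, map_add, map_mul (sg B), mul_assoc]
        abel
      · rw [p2, neg_smul, ← smul_mul_assoc, ← map_smul, ← sg_hom hb]
        simp only [hDv, hDu, add_mul, hvu, huu, d_mul, map_add, map_mul (sg B), sg_sg, sg_d,
          mul_assoc, hzz, mul_neg, map_neg]
        abel
      · rw [p2, neg_smul, ← smul_mul_assoc, ← map_smul, ← sg_hom hb]
        simp only [hvv, hDv, add_mul, mul_add, huv, hvu, map_mul (sg B), sg_sg, hsgz, mul_assoc,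
          hzz, map_zero]
        abel)
  have h1 : u 1 = 1 := rfl
  let i : B →ₐ[ℚ] OddX B := AlgHom.ofLinearMap u h1 fun x y => (huu x y).symm
  have hi0 : ∀ b, i b * v 1 ^ 0 = u b := fun b => by rw [pow_zero, mul_one]; rfl
  have hi1 : ∀ b, i b * v 1 ^ 1 = v b := fun b => by
    rw [pow_one]
    change u b * v 1 = _
    rw [huv, mul_one]
  have hi2 : ∀ l, 2 ≤ l → v (1 : B) ^ l = 0 := fun l hl => by
    obtain ⟨l, rfl⟩ := Nat.exists_eq_add_of_le hl
    rw [pow_add, pow_two, hvv, zero_mul]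
  refine ⟨OddX B, inst, i, v 1, hz, dz, ⟨fun b => (hDu b).symm, fun n b hb => Hu n b hb⟩,
    Hv k 0 1 gr_one (by simp), ?_, ?_, ?_⟩
  · change D (v 1) = u z
    rw [hDv]; simp
  · intro P hP x
    rw [hx x]
    exact Submodule.add_mem _ (hi0 x.fst ▸ hP x.fst 0) (hi1 x.snd ▸ hP x.snd 1)
  · intro M _ _ φ h
    refine ⟨φ 0 ∘ₗ f + φ 1 ∘ₗ s, fun l b => ?_⟩
    rcases l with _ | _ | l
    · rw [hi0]
      change φ 0 b + φ 1 0 = _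
      simp
    · rw [hi1]
      change φ 0 0 + φ 1 b = _
      simp
    · rw [hi2 (l + 2) (by omega), h hk (l + 2) (by omega)]; simp

theorem exists_hirsch (B : Type) [GCDGA B] (k : ℕ) (z : B)
    (hz : z ∈ Gr B (k + 1)) (dz : Dd B z = 0) :
    ∃ (B' : Type) (_ : GCDGA B') (i : B →ₐ[ℚ] B') (w : B'), IsHirsch B B' i k w z := by
  by_cases hk : Odd k
  exacts [exists_hirsch_odd B k hk z hz dz, exists_hirsch_even B k hk z hz dz]

end odd

section hirsch
variable {B B' : Type} [GCDGA B] [GCDGA B'] {i : B →ₐ[ℚ] B'} {k : ℕ} {w : B'} {z : B}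

theorem adjoin_homog (A : Type) [GCDGA A] : Algebra.adjoin ℚ {x : A | ∃ n, x ∈ Gr A n} = ⊤ := by
  rw [eq_top_iff]
  intro x _
  refine hom_induction (p := fun x => x ∈ Algebra.adjoin ℚ {x : A | ∃ n, x ∈ Gr A n})
    (fun n x hx => Algebra.subset_adjoin ⟨n, hx⟩) (fun x y hx hy => add_mem hx hy) x

namespace IsHirsch


theorem lext (h : IsHirsch B B' i k w z) {M : Type*} [AddCommGroup M] [Module ℚ M] {f g : B' →ₗ[ℚ] M}
    (H : ∀ b l, f (i b * w ^ l) = g (i b * w ^ l)) : f = g := by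
  ext x
  exact h.span (LinearMap.eqLocus f g) H x

theorem pow_zero_of_odd (h : IsHirsch B B' i k w z) (hk : Odd k) {l : ℕ} (hl : 2 ≤ l) : w ^ l = 0 := odd_pow h.hw hk hl

theorem adjoin (h : IsHirsch B B' i k w z) {s : Set B} (hs : Algebra.adjoin ℚ s = ⊤) :
    Algebra.adjoin ℚ (i '' s ∪ {w}) = ⊤ := by
  rw [eq_top_iff]
  intro x _
  refine h.span (Subalgebra.toSubmodule (Algebra.adjoin ℚ (i '' s ∪ {w}))) (fun b l => ?_) x
  change i b * w ^ l ∈ Algebra.adjoin ℚ (i '' s ∪ {w})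
  have hw' : w ∈ Algebra.adjoin ℚ (i '' s ∪ {w}) := Algebra.subset_adjoin (Or.inr rfl)
  refine mul_mem ?_ (pow_mem hw' l)
  have : i b ∈ (Algebra.adjoin ℚ s).map i := ⟨b, by rw [hs]; trivial, rfl⟩
  rw [AlgHom.map_adjoin] at this
  exact Algebra.adjoin_mono Set.subset_union_left this

theorem hom_ext (h : IsHirsch B B' i k w z) {R : Type*} [Ring R] [Algebra ℚ R] {f g : B' →ₐ[ℚ] R} (h1 : f.comp i = g.comp i)
    (h2 : f w = g w) : f = g := by
  have := h.lext (f := f.toLinearMap) (g := g.toLinearMap) fun b l => by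
    have := DFunLike.congr_fun h1 b
    simp only [AlgHom.comp_apply] at this
    simp [this, h2]
  exact AlgHom.toLinearMap_injective this

theorem mul_mono (h : IsHirsch B B' i k w z) (b b' : B) (l l' : ℕ) :
    (i b * w ^ l) * (i b' * w ^ l') = i (b * sc B ((-1) ^ (l * k)) b') * w ^ (l + l') := by
  have h1 := mul_comm_sc (gr_pow h.hw l) (i b')
  rw [mul_assoc, ← mul_assoc (w ^ l), h1, ← h.dga.sc, map_mul, pow_add]
  simp only [mul_assoc]

theorem d_pow (h : IsHirsch B B' i k w z) {l : ℕ} (hl : Odd k → l < 2) : Dd B' (w ^ l) = (l : ℚ) • (i z * w ^ (l - 1)) := by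
  by_cases hk : Odd k
  · have := hl hk
    interval_cases l
    · simp
    · simp [h.dw]
  · induction l with
    | zero => simp
    | succ l ih =>
      rw [pow_succ', d_mul, h.dw, ih (fun h' => absurd h' hk), Nat.add_sub_cancel, mul_smul_comm,
        sg_hom h.hw, (Nat.not_odd_iff_even.1 hk).neg_one_pow, one_smul, ← mul_assoc,
        mul_comm_even h.hw hk, mul_assoc]
      rcases l with _ | l
      · simp
      · rw [Nat.add_sub_cancel, ← pow_succ', Nat.cast_succ (l + 1), add_smul, one_smul, add_comm]

theorem d_mono (h : IsHirsch B B' i k w z) (b : B) {l : ℕ} (hl : Odd k → l < 2) : Dd B' (i b * w ^ l) =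
    i (Dd B b) * w ^ l + (l : ℚ) • (i (sg B b * z) * w ^ (l - 1)) := by
  rw [d_mul, h.d_pow hl, h.dga.1, ← h.dga.sc, mul_smul_comm, map_mul, mul_assoc]

theorem univ (h : IsHirsch B B' i k w z) {D : Type} [GCDGA D] (f : B →ₐ[ℚ] D) (hf : IsDGAHom f) {c : D} (hc : c ∈ Gr D k)
    (hd : Dd D c = f z) : ∃ g : B' →ₐ[ℚ] D, IsDGAHom g ∧ g.comp i = f ∧ g w = c := by
  obtain ⟨G, hG⟩ := h.lin D (fun l => LinearMap.mulRight ℚ (c ^ l) ∘ₗ f.toLinearMap)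
    (fun hk l hl => by ext b; simp [odd_pow hc hk hl])
  have hG' : ∀ l b, G (i b * w ^ l) = f b * c ^ l := hG
  have hmul : ∀ x y, G (x * y) = G x * G y := by
    intro x y
    refine h.span (LinearMap.eqLocus (G ∘ₗ LinearMap.mulRight ℚ y) (LinearMap.mulRight ℚ (G y) ∘ₗ G))
      (fun b l => ?_) x
    change G (i b * w ^ l * y) = G (i b * w ^ l) * G y
    refine h.span (LinearMap.eqLocus (G ∘ₗ LinearMap.mulLeft ℚ (i b * w ^ l))
      (LinearMap.mulLeft ℚ (G (i b * w ^ l)) ∘ₗ G)) (fun b' l' => ?_) y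
    change G (i b * w ^ l * (i b' * w ^ l')) = G (i b * w ^ l) * G (i b' * w ^ l')
    rw [h.mul_mono, hG', hG', hG', mul_assoc, ← mul_assoc (c ^ l), mul_comm_sc (gr_pow hc l),
      ← hf.sc, map_mul, pow_add]
    simp only [mul_assoc]
  have h1 : G 1 = 1 := by simpa using hG' 0 1
  let g : B' →ₐ[ℚ] D := AlgHom.ofLinearMap G h1 hmul
  have hgi : g.comp i = f := by
    ext b
    change G (i b) = f b
    simpa using hG' 0 b
  have hgi' : ∀ b, g (i b) = f b := fun b => DFunLike.congr_fun hgi b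
  have hgw : g w = c := by
    change G w = c
    simpa using hG' 1 1
  refine ⟨g, dga_of_gen (h.adjoin (adjoin_homog B)) ?_ ?_, hgi, hgw⟩
  · rintro _ (⟨b, ⟨n, hb⟩, rfl⟩ | rfl)
    · exact ⟨n, h.dga.2 n b hb, by rw [hgi']; exact hf.2 n b hb⟩
    · exact ⟨k, h.hw, by rw [hgw]; exact hc⟩
  · rintro _ (⟨b, ⟨n, hb⟩, rfl⟩ | rfl)
    · rw [← h.dga.1, hgi', hgi', hf.1]
    · rw [h.dw, hgi', hgw, hd]

theorem of_iso (h : IsHirsch B B' i k w z) {B'' : Type} [GCDGA B''] {i' : B →ₐ[ℚ] B''} {w' : B''}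
    (hi' : IsDGAHom i') (hw' : w' ∈ Gr B'' k) (hdw : Dd B'' w' = i' z)
    (θ : B'' →ₐ[ℚ] B') (θ' : B' →ₐ[ℚ] B'') (hθ : ∀ x, θ' (θ x) = x) (h1 : ∀ b, θ (i' b) = i b)
    (h2 : θ w' = w) : IsHirsch B B'' i' k w' z := by
  have key : ∀ b l, θ' (i b * w ^ l) = i' b * w' ^ l := fun b l => by
    rw [← h1, ← h2, ← map_pow, ← map_mul, hθ]
  refine ⟨h.hz, h.dz, hi', hw', hdw, fun P hP x => ?_, fun M _ _ φ hφ => ?_⟩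
  · have := h.span (P.comap θ'.toLinearMap) (fun b l => by
      change θ' _ ∈ P
      rw [key]; exact hP b l) (θ x)
    change θ' (θ x) ∈ P at this
    rwa [hθ] at this
  · obtain ⟨Φ, hΦ⟩ := h.lin M φ hφ
    refine ⟨Φ ∘ₗ θ.toLinearMap, fun l b => ?_⟩
    change Φ (θ _) = _
    rw [map_mul, map_pow, h1, h2, hΦ]

theorem shift (h : IsHirsch B B' i k w z) {c : B} (hc : c ∈ Gr B k) : IsHirsch B B' i k (w + i c) (z + Dd B c) := by
  obtain ⟨B'', _, i'', w'', h''⟩ := exists_hirsch B k (z + Dd B c) (add_mem h.hz (d_gr hc))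
    (by rw [map_add, h.dz, d_d, add_zero])
  obtain ⟨θ, -, h1, h2⟩ := h.univ i'' h''.dga (c := w'' - i'' c)
    (sub_mem h''.hw (h''.dga.2 k c hc)) (by rw [map_sub, h''.dw, map_add, ← h''.dga.1]; abel)
  obtain ⟨θ', -, h1', h2'⟩ := h''.univ i h.dga (c := w + i c)
    (add_mem h.hw (h.dga.2 k c hc)) (by rw [map_add, h.dw, map_add, ← h.dga.1])
  have e1 : ∀ b, θ (i b) = i'' b := fun b => DFunLike.congr_fun h1 b
  have e2 : ∀ b, θ' (i'' b) = i b := fun b => DFunLike.congr_fun h1' b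
  have e3 : θ'.comp θ = AlgHom.id ℚ B' := h.hom_ext (by ext b; simp [e1, e2])
    (by simp [h2, h2', e2])
  refine h''.of_iso h.dga (add_mem h.hw (h.dga.2 k c hc))
    (by rw [map_add, h.dw, map_add, ← h.dga.1]) θ θ' (fun x => DFunLike.congr_fun e3 x) e1 ?_
  rw [map_add, h2, e1]; abel

theorem coeffs (h : IsHirsch B B' i k w z) (hk : Odd k) : ∃ bt tp : B' →ₗ[ℚ] B, (∀ b, bt (i b) = b) ∧ (∀ b, bt (i b * w) = 0) ∧
    (∀ b, tp (i b) = 0) ∧ (∀ b, tp (i b * w) = b) ∧ ∀ x, x = i (bt x) + i (tp x) * w := by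
  obtain ⟨bt, hb⟩ := h.lin B (fun l => if l = 0 then LinearMap.id else 0)
    (fun _ l hl => if_neg (by omega))
  obtain ⟨tp, ht⟩ := h.lin B (fun l => if l = 1 then LinearMap.id else 0)
    (fun _ l hl => if_neg (by omega))
  have b0 := fun b => hb 0 b
  have b1 := fun b => hb 1 b
  have t0 := fun b => ht 0 b
  have t1 := fun b => ht 1 b
  simp only [pow_zero, mul_one, pow_one, if_true, one_ne_zero, if_false, zero_ne_one,
    LinearMap.id_apply, LinearMap.zero_apply] at b0 b1 t0 t1
  refine ⟨bt, tp, b0, b1, t0, t1, fun x => ?_⟩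
  have := h.lext (f := LinearMap.id)
    (g := i.toLinearMap ∘ₗ bt + LinearMap.mulRight ℚ w ∘ₗ i.toLinearMap ∘ₗ tp) (fun b l => by
      rcases l with _ | _ | l
      · simp [b0, t0]
      · simp [b1, t1]
      · rw [h.pow_zero_of_odd hk (by omega)]; simp)
  exact LinearMap.congr_fun this x

end IsHirsch

section contract
variable {C C1 C2 : Type} [GCDGA C] [GCDGA C1] [GCDGA C2] {i1 : C →ₐ[ℚ] C1} {i2 : C1 →ₐ[ℚ] C2}
  {m : ℕ} {y : C1} {w : C2}

theorem contract_homotopy (h1 : IsHirsch C C1 i1 (m + 1) y 0) (h2 : IsHirsch C1 C2 i2 m w y)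
    {p : C2 →ₐ[ℚ] C} (hp : ∀ c, p (i2 (i1 c)) = c) (hy : p (i2 y) = 0) (hw : p w = 0) :
    ∃ H : C2 →ₗ[ℚ] C2, ∀ x, Dd C2 (H x) + H (Dd C2 x) = x - i2 (i1 (p x)) := by
  have dI : ∀ c, Dd C2 (i2 (i1 c)) = i2 (i1 (Dd C c)) := fun c => by rw [← h2.dga.1, ← h1.dga.1]
  have sI : ∀ c, sg C2 (i2 (i1 c)) = i2 (i1 (sg C c)) := fun c => by rw [← h2.dga.sc, ← h1.dga.sc]
  have dY : ∀ l, Dd C2 (i2 y ^ l) = 0 := fun l => by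
    rw [← map_pow, ← h2.dga.1]
    by_cases hl : Odd (m + 1) → l < 2
    · rw [h1.d_pow hl]; simp
    · push Not at hl
      rw [h1.pow_zero_of_odd hl.1 hl.2]; simp
  have lin2 : ∀ ψ : ℕ → ℕ → C →ₗ[ℚ] C2, (∀ a b, (Odd (m + 1) ∧ 2 ≤ a) ∨ (Odd m ∧ 2 ≤ b) → ψ a b = 0) →
      ∃ H : C2 →ₗ[ℚ] C2, ∀ a b c, H (i2 (i1 c) * i2 y ^ a * w ^ b) = ψ a b c := by
    intro ψ hψ
    choose φ hφ using fun b => h1.lin C2 (fun a => ψ a b) (fun ho a ha => hψ a b (Or.inl ⟨ho, ha⟩))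
    obtain ⟨H, hH⟩ := h2.lin C2 φ (fun ho b hb => h1.lext fun c a => by
      rw [hφ, hψ a b (Or.inr ⟨ho, hb⟩)]; rfl)
    exact ⟨H, fun a b c => by rw [← map_pow, ← map_mul, hH, hφ]⟩
  have ext2 : ∀ f g : C2 →ₗ[ℚ] C2, (∀ a b c, (Odd (m + 1) → a < 2) → (Odd m → b < 2) →
      f (i2 (i1 c) * i2 y ^ a * w ^ b) = g (i2 (i1 c) * i2 y ^ a * w ^ b)) → f = g := by
    intro f g hfg
    refine h2.lext fun c1 b => ?_
    have : (f ∘ₗ LinearMap.mulRight ℚ (w ^ b)) ∘ₗ i2.toLinearMap =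
        (g ∘ₗ LinearMap.mulRight ℚ (w ^ b)) ∘ₗ i2.toLinearMap := h1.lext fun c a => by
      change f (i2 (i1 c * y ^ a) * w ^ b) = g (i2 (i1 c * y ^ a) * w ^ b)
      by_cases ha : Odd (m + 1) → a < 2
      · by_cases hb : Odd m → b < 2
        · rw [map_mul i2, map_pow i2]; exact hfg a b c ha hb
        · push Not at hb
          rw [h2.pow_zero_of_odd hb.1 hb.2]; simp
      · push Not at ha
        rw [h1.pow_zero_of_odd ha.1 ha.2]; simp
    exact LinearMap.congr_fun this c1
  have pI : ∀ a b c, p (i2 (i1 c) * i2 y ^ a * w ^ b) = if a = 0 ∧ b = 0 then c else 0 := by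
    intro a b c
    rw [map_mul, map_mul, map_pow, map_pow, hp, hy, hw]
    rcases a with _ | a <;> rcases b with _ | b <;> simp
  have sY : sg C2 (i2 y) = (-1 : ℚ) ^ (m + 1) • i2 y := sg_hom (h2.dga.2 _ _ h1.hw)
  rcases Nat.even_or_odd m with hm | hm
  · have hm1 : Odd (m + 1) := hm.add_one
    have hm' : ¬ Odd m := Nat.not_odd_iff_even.2 hm
    obtain ⟨H, hH⟩ := lin2 (fun a b => if a = 1 then
      (((b : ℚ) + 1)⁻¹) • (LinearMap.mulRight ℚ (w ^ (b + 1)) ∘ₗ i2.toLinearMap ∘ₗ i1.toLinearMap ∘ₗ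
        (sg C).toLinearMap) else 0) (fun a b hab => by
        rcases hab with hab | hab
        · rw [if_neg (by omega)]
        · exact absurd hab.1 hm')
    have H0 : ∀ (b : ℕ) c, H (i2 (i1 c) * w ^ b) = 0 := fun b c => by simpa using hH 0 b c
    have H1 : ∀ (b : ℕ) c, H (i2 (i1 c) * i2 y * w ^ b) = ((b : ℚ) + 1)⁻¹ • (i2 (i1 (sg C c)) * w ^ (b + 1)) :=
      fun b c => by simpa using hH 1 b c
    have dw : ∀ b : ℕ, Dd C2 (w ^ b) = (b : ℚ) • (i2 y * w ^ (b - 1)) := fun b =>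
      h2.d_pow fun ho => absurd ho hm'
    have yy : i2 y * i2 y = 0 := odd_sq (h2.dga.2 _ _ h1.hw) hm1
    refine ⟨H, fun x => LinearMap.congr_fun (f := Dd C2 ∘ₗ H + H ∘ₗ Dd C2)
      (g := LinearMap.id - i2.toLinearMap ∘ₗ i1.toLinearMap ∘ₗ p.toLinearMap)
      (ext2 _ _ fun a b c ha _ => ?_) x⟩
    change Dd C2 (H _) + H (Dd C2 _) = _ - i2 (i1 (p _))
    rw [pI]
    have ha := ha hm1
    have hb0 : (b : ℚ) + 1 ≠ 0 := by positivity
    interval_cases a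
    · rw [pow_zero, mul_one, H0, d_mul, dI, sI, dw, mul_smul_comm, ← mul_assoc, map_add, H0,
        map_smul, H1, sg_sg]
      rcases b with _ | b
      · simp
      · have hb0 : (b : ℚ) + 1 ≠ 0 := by positivity
        simp [smul_smul, hb0]
    · rw [pow_one, H1, d_mul, d_mul, dI, ← h2.dga.1, h1.dw, map_zero, map_zero, mul_zero, add_zero,
        map_mul (sg C2), sI, dw, sY, hm1.neg_one_pow, map_smul, d_mul, dI, dw, sI, sg_sg,
        map_add, H1, sg_d, Nat.add_sub_cancel]
      have e : i2 (i1 (sg C c)) * (-1 : ℚ) • i2 y * (b : ℚ) • (i2 y * w ^ (b - 1)) = 0 := by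
        simp only [mul_smul_comm, smul_mul_assoc]
        rw [← mul_assoc, mul_assoc _ (i2 y) (i2 y), yy]; simp
      rw [e, map_zero, add_zero]
      simp [smul_smul, hb0, mul_assoc]
  · have hm1 : ¬ Odd (m + 1) := Nat.not_odd_iff_even.2 hm.add_one
    obtain ⟨H, hH⟩ := lin2 (fun a b => if a ≠ 0 ∧ b = 0 then
      (LinearMap.mulRight ℚ (i2 y ^ (a - 1) * w) ∘ₗ i2.toLinearMap ∘ₗ i1.toLinearMap ∘ₗ
        (sg C).toLinearMap) else 0) (fun a b hab => by
        rcases hab with hab | hab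
        · exact absurd hab.1 hm1
        · rw [if_neg (by omega)])
    have H0 : ∀ c, H (i2 (i1 c)) = 0 := fun c => by simpa using hH 0 0 c
    have H1 : ∀ a c, H (i2 (i1 c) * i2 y ^ (a + 1)) = i2 (i1 (sg C c)) * i2 y ^ a * w :=
      fun a c => by simpa [mul_assoc] using hH (a + 1) 0 c
    have H2 : ∀ a c, H (i2 (i1 c) * i2 y ^ a * w) = 0 := fun a c => by simpa using hH a 1 c
    have sYp : ∀ a, sg C2 (i2 y ^ a) = i2 y ^ a := fun a => by
      rw [map_pow, sY, (Nat.not_odd_iff_even.1 hm1).neg_one_pow, one_smul]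
    refine ⟨H, fun x => LinearMap.congr_fun (f := Dd C2 ∘ₗ H + H ∘ₗ Dd C2)
      (g := LinearMap.id - i2.toLinearMap ∘ₗ i1.toLinearMap ∘ₗ p.toLinearMap)
      (ext2 _ _ fun a b c _ hb => ?_) x⟩
    change Dd C2 (H _) + H (Dd C2 _) = _ - i2 (i1 (p _))
    rw [pI]
    have hb := hb hm
    interval_cases b
    · rw [pow_zero, mul_one]
      rcases a with _ | a
      · simp [H0, dI]
      · rw [H1, d_mul, d_mul, d_mul, dY, dY, mul_zero, mul_zero, add_zero, add_zero, dI, dI, H1,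
          h2.dw, map_mul, sI, sYp, sg_sg, sg_d, mul_assoc _ _ (i2 y), ← pow_succ]
        simp
    · rw [pow_one, H2, d_mul, d_mul, dY, mul_zero, add_zero, dI, map_mul, sI, sYp, h2.dw, map_add,
        H2, mul_assoc _ _ (i2 y), ← pow_succ, H1, sg_sg]
      simp

theorem contract (h1 : IsHirsch C C1 i1 (m + 1) y 0) (h2 : IsHirsch C1 C2 i2 m w y) :
    ∃ p : C2 →ₐ[ℚ] C, IsDGAHom p ∧ (∀ c, p (i2 (i1 c)) = c) ∧ p (i2 y) = 0 ∧ p w = 0 ∧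
      ∀ x, Dd C2 x = 0 → ∃ u, x = i2 (i1 (p x)) + Dd C2 u := by
  obtain ⟨p1, hp1, e1, e1'⟩ := h1.univ (AlgHom.id ℚ C) (isDGAHom_id C) (c := 0) (zero_mem _) (by simp)
  obtain ⟨p, hp, e2, e2'⟩ := h2.univ p1 hp1 (c := 0) (zero_mem _) (by simp [e1'])
  have e3 : ∀ c, p (i2 c) = p1 c := fun c => DFunLike.congr_fun e2 c
  have e4 : ∀ c, p (i2 (i1 c)) = c := fun c => by rw [e3]; exact DFunLike.congr_fun e1 c
  have e5 : p (i2 y) = 0 := by rw [e3, e1']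
  obtain ⟨H, hH⟩ := contract_homotopy h1 h2 e4 e5 e2'
  refine ⟨p, hp, e4, e5, e2', fun x hx => ⟨H x, ?_⟩⟩
  have := hH x
  rw [hx, map_zero, add_zero] at this
  rw [this]; abel

end contract
end hirsch

theorem sc_neg_one_pow_invol {A : Type} [GCDGA A] (k : ℕ) (a : A) :
    sc A ((-1) ^ k) (sc A ((-1) ^ k) a) = a := by
  simp only [sc_pow_eq]
  split_ifs <;> simp

/-- Semifree extensions `T → C`, given through a well-ordered basis containing the unit. -/
def SemiFree {T C : Type} [GCDGA T] [GCDGA C] (j : T →ₐ[ℚ] C) : Prop :=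
  ∃ (κ : Type) (e : κ → C) (lt : κ → κ → Prop) (o : κ), WellFounded lt ∧ e o = 1 ∧
    (∀ (M : Type) [AddCommGroup M] [Module ℚ M] (act : T →ₐ[ℚ] Module.End ℚ M) (g : κ → M),
      ∃ F : C →ₗ[ℚ] M, (∀ t c, F (j t * c) = act t (F c)) ∧ ∀ α, F (e α) = g α) ∧
    (∀ S : Submodule ℚ C, (∀ t c, c ∈ S → j t * c ∈ S) → (∀ α, e α ∈ S) → ∀ x, x ∈ S) ∧
    ∀ α (S : Submodule ℚ C), (∀ t c, c ∈ S → j t * c ∈ S) → (∀ β, lt β α → e β ∈ S) →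
      Dd C (e α) ∈ S

/-- Every morphism out of `T` factors as a semifree extension followed by a surjective
quasi-isomorphism. -/
def Resolvable (T : Type) [GCDGA T] : Prop :=
  ∀ (Q : Type) [GCDGA Q] [Nontrivial Q] (ρ : T →ₐ[ℚ] Q), IsDGAHom ρ →
    ∃ (C : Type) (_ : GCDGA C) (j : T →ₐ[ℚ] C) (q : C →ₐ[ℚ] Q), IsDGAHom j ∧ IsDGAHom q ∧
      Function.Surjective q ∧ QuasiIso q ∧ (∀ t, q (j t) = ρ t) ∧ SemiFree j

theorem lift_one {M N : Type*} [AddCommGroup M] [Module ℚ M] [AddCommGroup N] [Module ℚ N]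
    {dM : M →ₗ[ℚ] M} {dN : N →ₗ[ℚ] N} {p : M →ₗ[ℚ] N}
    (sM : ∀ m, dM (dM m) = 0) (hp : ∀ m, p (dM m) = dN (p m)) (ps : Function.Surjective p)
    (q1 : ∀ n, dN n = 0 → ∃ m, dM m = 0 ∧ ∃ n', p m - n = dN n')
    (q2 : ∀ m, dM m = 0 → (∃ n, p m = dN n) → ∃ m', m = dM m')
    {u : M} {n : N} (hu : dM u = 0) (hn : p u = dN n) : ∃ m, dM m = u ∧ p m = n := by
  obtain ⟨m0, rfl⟩ := q2 u hu ⟨n, hn⟩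
  obtain ⟨a, ha, n', hn'⟩ := q1 (n - p m0) (by rw [map_sub, ← hn, hp, sub_self])
  obtain ⟨m', rfl⟩ := ps n'
  refine ⟨m0 + a - dM m', by rw [map_sub, map_add, ha, sM]; abel, ?_⟩
  rw [map_sub, map_add, hp, ← hn']; abel

theorem SemiFree.lift {T C M N : Type} [GCDGA T] [GCDGA C] {j : T →ₐ[ℚ] C} (hj : IsDGAHom j)
    (h : SemiFree j) [AddCommGroup M] [Module ℚ M] [AddCommGroup N] [Module ℚ N]
    {dM : M →ₗ[ℚ] M} {dN : N →ₗ[ℚ] N} {p : M →ₗ[ℚ] N}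
    (act : T →ₐ[ℚ] Module.End ℚ M) (actN : T →ₐ[ℚ] Module.End ℚ N)
    (leib : ∀ t m, dM (act t m) = act (Dd T t) m + act (sg T t) (dM m))
    (pact : ∀ t m, p (act t m) = actN t (p m))
    (sM : ∀ m, dM (dM m) = 0) (hp : ∀ m, p (dM m) = dN (p m)) (ps : Function.Surjective p)
    (q1 : ∀ n, dN n = 0 → ∃ m, dM m = 0 ∧ ∃ n', p m - n = dN n')
    (q2 : ∀ m, dM m = 0 → (∃ n, p m = dN n) → ∃ m', m = dM m')
    (φ : C →ₗ[ℚ] N) (φT : ∀ t c, φ (j t * c) = actN t (φ c)) (φd : ∀ c, φ (Dd C c) = dN (φ c))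
    {m1 : M} (hm1 : dM m1 = 0) (hpm1 : p m1 = φ 1) :
    ∃ F : C →ₗ[ℚ] M, (∀ t c, F (j t * c) = act t (F c)) ∧ (∀ c, F (Dd C c) = dM (F c)) ∧
      (∀ c, p (F c) = φ c) ∧ F 1 = m1 := by
  classical
  obtain ⟨κ, e, lt, o, wf, eo, lin, span, tri⟩ := h
  choose ext extT exte using lin M act
  let good : (κ → M) → κ → M → Prop := fun g α m => dM m = ext g (Dd C (e α)) ∧ p m = φ (e α)
  let step : ∀ α, (∀ β, lt β α → M) → M := fun α rec =>
    if α = o then m1 else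
      if H : ∃ m, good (fun β => if hb : lt β α then rec β hb else 0) α m then H.choose else 0
  let g : κ → M := wf.fix step
  have geq : ∀ α, g α = step α (fun β _ => g β) := fun α => wf.fix_eq step α
  have stab : ∀ (f f' : C →ₗ[ℚ] M), (∀ t c, f (j t * c) = act t (f c)) →
      (∀ t c, f' (j t * c) = act t (f' c)) → ∀ t c, c ∈ LinearMap.eqLocus f f' →
      j t * c ∈ LinearMap.eqLocus f f' := by
    intro f f' hf hf' t c hc
    rw [LinearMap.mem_eqLocus] at hc ⊢
    rw [hf, hf', hc]
  let S : Submodule ℚ C := LinearMap.eqLocus (p ∘ₗ ext g) φ ⊓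
    LinearMap.eqLocus (dM ∘ₗ ext g) (ext g ∘ₗ Dd C)
  have memS : ∀ c, c ∈ S ↔ p (ext g c) = φ c ∧ dM (ext g c) = ext g (Dd C c) := fun c => Iff.rfl
  have stabS : ∀ t c, c ∈ S → j t * c ∈ S := by
    intro t c hc
    rw [memS] at hc ⊢
    rw [extT, pact, hc.1, φT, leib, hc.2, d_mul, map_add, ← hj.1, extT, ← hj.sc, extT]
    exact ⟨rfl, rfl⟩
  have main : ∀ α, e α ∈ S := by
    intro α
    induction α using wf.induction with
    | _ α ih =>
      rw [memS, exte]
      by_cases hα : α = o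
      · have : g α = m1 := by rw [geq]; exact if_pos hα
        subst hα
        rw [this, eo, d_one, map_zero]
        exact ⟨hpm1, hm1⟩
      · let g' : κ → M := fun β => if lt β α then g β else 0
        have h1 : ext g (Dd C (e α)) = ext g' (Dd C (e α)) :=
          tri α (LinearMap.eqLocus (ext g) (ext g')) (stab _ _ (extT g) (extT g')) fun β hβ => by
            rw [LinearMap.mem_eqLocus, exte, exte]
            exact (if_pos hβ).symm
        have h2 := tri α S stabS ih
        rw [memS, d_d, map_zero] at h2
        have h3 : ∃ m, good g' α m := by
          obtain ⟨m, hm⟩ := lift_one sM hp ps q1 q2 (u := ext g (Dd C (e α))) (n := φ (e α)) h2.2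
            (by rw [h2.1, φd])
          exact ⟨m, by rw [hm.1, h1], hm.2⟩
        have h4 : g α = h3.choose := by
          rw [geq]
          change (if α = o then m1 else _) = _
          rw [if_neg hα]
          exact dif_pos h3
        have h5 := h3.choose_spec
        rw [← h4] at h5
        exact ⟨h5.2, by rw [h5.1, h1]⟩
  have all := span S stabS main
  refine ⟨ext g, extT g, fun c => ((memS c).1 (all c)).2.symm, fun c => ((memS c).1 (all c)).1, ?_⟩
  rw [← eo, exte, geq]
  exact if_pos rfl

theorem QuasiIso.lift_elt {C Q : Type} [GCDGA C] [GCDGA Q] {q : C →ₐ[ℚ] Q} (hq : IsDGAHom q)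
    (qs : Function.Surjective q) (qq : QuasiIso q) {k : ℕ} {u : C} {n : Q} (hu : Dd C u = 0)
    (hug : u ∈ Gr C (k + 1)) (hn : n ∈ Gr Q k) (h : q u = Dd Q n) :
    ∃ c ∈ Gr C k, Dd C c = u ∧ q c = n := by
  obtain ⟨m, h1, h2⟩ := lift_one (p := q.toLinearMap) (dM := Dd C) (dN := Dd Q) d_d hq.1 qs qq.1
    qq.2 hu h
  refine ⟨pr C k m, pr_mem _ _, by rw [← pr_d, h1, pr_same hug], ?_⟩
  rw [← hq.pr]
  change q m = n at h2
  rw [h2, pr_same hn]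

theorem SemiFree.hirsch_both {T T' C C1 : Type} [GCDGA T] [GCDGA T'] [GCDGA C] [GCDGA C1]
    {i : T →ₐ[ℚ] T'} {i1 : C →ₐ[ℚ] C1} {k : ℕ} {w : T'} {W : C1} {ζ : T} {Z : C} {j : T →ₐ[ℚ] C}
    {j' : T' →ₐ[ℚ] C1} (hj : IsDGAHom j)
    (hT : IsHirsch T T' i k w ζ) (hC : IsHirsch C C1 i1 k W Z) (h1 : ∀ t, j' (i t) = i1 (j t))
    (h2 : j' w = W) (h : SemiFree j) : SemiFree j' := by
  obtain ⟨κ, e, lt, o, wf, eo, lin, span, tri⟩ := h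
  have W_comm : ∀ l c, W ^ l * i1 c = i1 (sc C ((-1) ^ (l * k)) c) * W ^ l := fun l c => by
    rw [mul_comm_sc (gr_pow hC.hw l), hC.dga.sc]
  refine ⟨κ, fun α => i1 (e α), lt, o, wf, by simp [eo], fun M _ _ act g => ?_,
    fun S hS he => ?_, fun α S hS he => ?_⟩
  · obtain ⟨F, FT, Fe⟩ := lin M (act.comp i) g
    obtain ⟨G, hG⟩ := hC.lin M (fun l => act (w ^ l) ∘ₗ F ∘ₗ (sc C ((-1) ^ (l * k))).toLinearMap)
      (fun hk l hl => by rw [odd_pow hT.hw hk hl, map_zero]; rfl)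
    have hG' : ∀ l c, G (W ^ l * i1 c) = act (w ^ l) (F c) := fun l c => by
      rw [W_comm, hG]
      change act (w ^ l) (F (sc C _ (sc C _ c))) = _
      rw [sc_neg_one_pow_invol]
    have span' : ∀ P : Submodule ℚ C1, (∀ c l, W ^ l * i1 c ∈ P) → ∀ x, x ∈ P := fun P hP x =>
      hC.span P (fun c l => by
        have := hP (sc C ((-1) ^ (l * k)) c) l
        rwa [W_comm, sc_neg_one_pow_invol] at this) x
    refine ⟨G, fun t => ?_, fun α => ?_⟩
    · have ht : t ∈ Algebra.adjoin ℚ (i '' Set.univ ∪ {w}) := by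
        rw [hT.adjoin (s := Set.univ) (Algebra.adjoin_univ _ _)]; trivial
      induction ht using Algebra.adjoin_induction with
      | mem t ht =>
        refine span' (LinearMap.eqLocus (G ∘ₗ LinearMap.mulLeft ℚ (j' t)) (act t ∘ₗ G))
          fun c l => ?_
        change G (j' t * (W ^ l * i1 c)) = act t (G (W ^ l * i1 c))
        rcases ht with ⟨t, -, rfl⟩ | rfl
        · have e1 : i1 (j t) * W ^ l = W ^ l * i1 (j (sc T ((-1) ^ (l * k)) t)) := by
            rw [W_comm, hj.sc, sc_neg_one_pow_invol]
          have e2 : i t * w ^ l = w ^ l * i (sc T ((-1) ^ (l * k)) t) := by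
            rw [mul_comm_sc (gr_pow hT.hw l), ← hT.dga.sc, sc_neg_one_pow_invol]
          rw [h1, ← mul_assoc, e1, mul_assoc, ← map_mul, hG', hG', FT, ← Module.End.mul_apply,
            ← Module.End.mul_apply, AlgHom.comp_apply, ← map_mul, ← map_mul, e2]
        · rw [h2, ← mul_assoc, ← pow_succ', hG', hG', ← Module.End.mul_apply, ← map_mul,
            ← pow_succ']
      | algebraMap r => intro c; simp [Algebra.algebraMap_eq_smul_one]
      | add x y _ _ hx hy => intro c; simp [add_mul, hx, hy]
      | mul x y _ _ hx hy => intro c; rw [map_mul j', mul_assoc, hx, hy, map_mul act]; rfl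
    · have := hG' 0 (e α)
      simp only [pow_zero, one_mul, map_one, Module.End.one_apply] at this
      rw [this, Fe]
  · have h3 : ∀ c, i1 c ∈ S := span (S.comap i1.toLinearMap) (fun t c hc => by
      change i1 (j t * c) ∈ S
      rw [map_mul, ← h1]; exact hS _ _ hc) he
    refine hC.span S fun c l => ?_
    have := hS (w ^ l) _ (h3 (sc C ((-1) ^ (l * k)) c))
    rwa [map_pow, h2, W_comm, sc_neg_one_pow_invol] at this
  · rw [← hC.dga.1]
    exact tri α (S.comap i1.toLinearMap) (fun t c hc => by
      change i1 (j t * c) ∈ S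
      rw [map_mul, ← h1]; exact hS _ _ hc) he

theorem SemiFree.hirsch {T C C' : Type} [GCDGA T] [GCDGA C] [GCDGA C'] {i : C →ₐ[ℚ] C'} {k : ℕ}
    {w : C'} {z : C} {j : T →ₐ[ℚ] C} (hC : IsHirsch C C' i k w z) (h : SemiFree j) :
    SemiFree (i.comp j) := by
  classical
  obtain ⟨κ, e, lt, o, wf, eo, lin, span, tri⟩ := h
  let r : κ × ℕ → κ × ℕ → Prop := fun a b => a.2 < b.2 ∨ (a.2 = b.2 ∧ lt a.1 b.1)
  have wfr : WellFounded r := by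
    have w1 := WellFounded.prod_lex (α := ℕ) (β := κ) (ra := (· < ·)) (rb := lt) wellFounded_lt wf
    refine Subrelation.wf (r := InvImage (Prod.Lex (· < ·) lt) Prod.swap) ?_ (InvImage.wf _ w1)
    rintro ⟨a, b⟩ ⟨a', b'⟩ hab
    rcases hab with hab | ⟨hab, hab'⟩
    · exact Prod.Lex.left _ _ hab
    · change b = b' at hab
      subst hab
      exact Prod.Lex.right _ hab'
  let κ' := {p : κ × ℕ // Odd k → p.2 < 2}
  refine ⟨κ', fun p => i (e p.1.1) * w ^ p.1.2, fun a b => r a.1 b.1, ⟨(o, 0), fun _ => by simp⟩,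
    InvImage.wf Subtype.val wfr, by simp [eo], fun M _ _ act g => ?_, fun S hS he => ?_,
    fun α S hS he => ?_⟩
  · choose F FT Fe using fun l : ℕ => lin M act
      (fun a => if hl : Odd k → l < 2 then g ⟨(a, l), hl⟩ else 0)
    obtain ⟨G, hG⟩ := hC.lin M (fun l => if Odd k → l < 2 then F l else 0)
      (fun hk l hl => if_neg fun h => absurd (h hk) (by omega))
    refine ⟨G, fun t => ?_, fun α => ?_⟩
    · refine hC.span (LinearMap.eqLocus (G ∘ₗ LinearMap.mulLeft ℚ (i.comp j t)) (act t ∘ₗ G))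
          fun c l => ?_
      change G (i (j t) * (i c * w ^ l)) = act t (G (i c * w ^ l))
      rw [← mul_assoc, ← map_mul, hG, hG]
      split_ifs
      · exact FT _ _ _
      · simp
    · rw [hG, if_pos α.2, Fe, dif_pos α.2]
  · refine hC.span S fun c l => ?_
    by_cases hl : Odd k → l < 2
    · refine span (S.comap (LinearMap.mulRight ℚ (w ^ l) ∘ₗ i.toLinearMap)) (fun t c hc => ?_)
        (fun a => he ⟨(a, l), hl⟩) c
      change i (j t * c) * w ^ l ∈ S
      rw [map_mul, mul_assoc]
      exact hS t _ hc
    · push Not at hl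
      rw [odd_pow hC.hw hl.1 hl.2, mul_zero]; exact zero_mem _
  · obtain ⟨⟨a, l⟩, hl⟩ := α
    have st : ∀ l t c, c ∈ S.comap (LinearMap.mulRight ℚ (w ^ l) ∘ₗ i.toLinearMap) →
        j t * c ∈ S.comap (LinearMap.mulRight ℚ (w ^ l) ∘ₗ i.toLinearMap) := by
      intro l t c hc
      change i (j t * c) * w ^ l ∈ S
      rw [map_mul, mul_assoc]
      exact hS t _ hc
    change Dd C' (i (e a) * w ^ l) ∈ S
    rw [hC.d_mono _ hl]
    refine add_mem ?_ ?_
    · exact tri a (S.comap (LinearMap.mulRight ℚ (w ^ l) ∘ₗ i.toLinearMap)) (st l)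
        (fun β hβ => he ⟨(β, l), hl⟩ (Or.inr ⟨rfl, hβ⟩))
    · rcases l with _ | l
      · simp
      · refine Submodule.smul_mem _ _ ?_
        exact span (S.comap (LinearMap.mulRight ℚ (w ^ l) ∘ₗ i.toLinearMap)) (st l)
          (fun β => he ⟨(β, l), fun hk => by have := hl hk; simp at this; omega⟩
            (Or.inl (Nat.lt_succ_self l))) _

theorem IsBase.resolvable {K : Type} [GCDGA K] (hK : IsBase K) : Resolvable K := by
  intro Q _ _ ρ hρ
  have hι : ∀ t : K, ∃ r : ℚ, t = algebraMap ℚ K r := fun t => by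
    obtain ⟨r, hr⟩ := hK.2 t
    exact ⟨r, hr.symm⟩
  refine ⟨Q, inferInstance, ρ, AlgHom.id ℚ Q, hρ, isDGAHom_id Q, Function.surjective_id,
    ⟨fun b hb => ⟨b, hb, 0, by simp⟩, fun a _ h => h⟩, fun t => rfl, ?_⟩
  have l1 : LinearIndepOn ℚ id ({1} : Set Q) := LinearIndepOn.singleton one_ne_zero
  obtain ⟨b1, hb1, o1, s1, l1⟩ := exists_linearIndepOn_id_extension l1
    (t := (LinearMap.ker (Dd Q) : Set Q)) (by simp)
  obtain ⟨b, hb, h1b, s2, l2⟩ := exists_linearIndepOn_id_extension l1 (Set.subset_univ b1)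
  have sb : ⊤ ≤ Submodule.span ℚ (Set.range (Subtype.val : b → Q)) := by
    rw [Subtype.range_coe]; exact fun x _ => s2 trivial
  let B : Module.Basis b ℚ Q := Module.Basis.mk l2 sb
  have hB : ∀ α, B α = α := fun α => by simp [B]
  refine ⟨b, Subtype.val, fun x y => x.1 ∈ b1 ∧ y.1 ∉ b1, ⟨1, h1b (o1 rfl)⟩, ?_, rfl,
    fun M _ _ act g => ⟨B.constr ℚ g, fun t c => ?_, fun α => ?_⟩, fun S _ he x => ?_,
    fun α S _ he => ?_⟩
  · have h0 : ∀ y : b, y.1 ∈ b1 → Acc (fun x y : b => x.1 ∈ b1 ∧ y.1 ∉ b1) y := fun y hy =>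
      ⟨y, fun x hx => absurd hy hx.2⟩
    exact ⟨fun y => ⟨y, fun x hx => h0 x hx.1⟩⟩
  · obtain ⟨r, rfl⟩ := hι t
    simp [Algebra.algebraMap_eq_smul_one]
  · rw [← hB, Module.Basis.constr_basis]
  · have h3 := sb (Submodule.mem_top (x := x))
    refine Submodule.span_le.2 ?_ h3
    rintro _ ⟨α, rfl⟩
    exact he α
  · by_cases hα : α.1 ∈ b1
    · have : Dd Q α.1 = 0 := hb1 hα
      rw [this]; exact zero_mem _
    · have h3 : Dd Q α.1 ∈ Submodule.span ℚ b1 := s1 (by simp)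
      refine Submodule.span_le.2 ?_ h3
      exact fun x hx => he ⟨x, h1b hx⟩ ⟨hx, hα⟩

theorem IsHirsch.resolvable {T T' : Type} [GCDGA T] [GCDGA T'] {i : T →ₐ[ℚ] T'} {m : ℕ} {w : T'}
    {ζ : T} (h : IsHirsch T T' i (m + 1) w ζ) (hT : Resolvable T) : Resolvable T' := by
  intro Q _ _ ρ hρ
  obtain ⟨C, _, j, q, hj, hq, qs, qq, hqj, hsf⟩ := hT Q (ρ.comp i) (h.dga.comp hρ)
  obtain ⟨c, hc, hdc, hqc⟩ := qq.lift_elt hq qs (u := j ζ) (n := ρ w)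
    (by rw [← hj.1, h.dz, map_zero]) (hj.2 _ _ h.hz) (hρ.2 _ _ h.hw)
    (by rw [hqj, ← hρ.1, h.dw]; rfl)
  obtain ⟨C1, _, i1, y, h1⟩ := exists_hirsch C (m + 1) 0 (zero_mem _) (map_zero _)
  obtain ⟨C2, _, i2, v, h2⟩ := exists_hirsch C1 m y h1.hw (by rw [h1.dw, map_zero])
  obtain ⟨p, hp, pI, py, pv, pH⟩ := contract h1 h2
  have h1' := h1.shift hc
  rw [zero_add, hdc] at h1'
  obtain ⟨j1, hj1, e1, e2⟩ := h.univ (i1.comp j) (hj.comp h1.dga) (c := y + i1 c) h1'.hw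
    (by rw [h1'.dw]; rfl)
  have e1 : ∀ t, j1 (i t) = i1 (j t) := fun t => DFunLike.congr_fun e1 t
  have sf1 : SemiFree j1 := hsf.hirsch_both hj h h1' e1 e2
  have sf2 := sf1.hirsch h2
  refine ⟨C2, inferInstance, i2.comp j1, q.comp p, hj1.comp h2.dga, hp.comp hq, fun x => ?_,
    ⟨fun x hx => ?_, fun x hx ⟨n, hn⟩ => ?_⟩, fun t => ?_, sf2⟩
  · obtain ⟨a, rfl⟩ := qs x
    exact ⟨i2 (i1 a), by simp [pI]⟩
  · obtain ⟨a, ha, n, hn⟩ := qq.1 x hx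
    exact ⟨i2 (i1 a), by rw [← h2.dga.1, ← h1.dga.1, ha, map_zero, map_zero], n, by simp [pI, hn]⟩
  · obtain ⟨u, hu⟩ := pH x hx
    obtain ⟨a, ha⟩ := qq.2 (p x) (by rw [← hp.1, hx, map_zero]) ⟨n, hn⟩
    exact ⟨i2 (i1 a) + u, by rw [hu, ha, map_add, ← h2.dga.1, ← h1.dga.1]⟩
  · have : (q.comp (p.comp (i2.comp j1))) = ρ := by
      refine h.hom_ext ?_ ?_
      · ext t; simp [e1, pI, hqj]
      · simp [e2, py, pI, hqc]
    exact DFunLike.congr_fun this t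

theorem exists_of_pieces {A M : Type} [GCDGA A] [AddCommGroup M] [Module ℚ M] (f : ℕ → A →ₗ[ℚ] M) :
    ∃ F : A →ₗ[ℚ] M, ∀ n, ∀ x ∈ Gr A n, F x = f n x := by
  classical
  refine ⟨DirectSum.toModule ℚ ℕ M (fun n => f n ∘ₗ (Gr A n).subtype) ∘ₗ
    (DirectSum.decomposeLinearEquiv (Gr A)).toLinearMap, fun n x hx => ?_⟩
  lift x to Gr A n using hx
  simp

/-- Cohomology vanishes in large degrees. -/
def Bdd (A : Type) [GCDGA A] : Prop := ∃ N : ℕ, ∀ n, N < n → ∀ x ∈ Gr A n, Dd A x = 0 →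
  ∃ y, x = Dd A y

/-- The degree zero part consists of scalars. -/
def Conn (A : Type) [GCDGA A] : Prop := ∀ x ∈ Gr A 0, ∃ c : ℚ, x = algebraMap ℚ A c

theorem exists_gen_inverse (A : Type) [GCDGA A] : ∃ g : A →ₗ[ℚ] A, (∀ x ∈ Gr A 0, g x = 0) ∧
    (∀ n, ∀ x ∈ Gr A (n + 1), g x ∈ Gr A n) ∧ ∀ x, Dd A (g (Dd A x)) = Dd A x := by
  obtain ⟨s, hs⟩ := (Dd A).rangeRestrict.exists_rightInverse_of_surjective
    (LinearMap.range_rangeRestrict _)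
  obtain ⟨g0, hg0⟩ := s.exists_extend
  have h0 : ∀ x, Dd A (g0 (Dd A x)) = Dd A x := fun x => by
    have h1 := LinearMap.congr_fun hg0 ⟨Dd A x, x, rfl⟩
    have h2 := congrArg Subtype.val (LinearMap.congr_fun hs ⟨Dd A x, x, rfl⟩)
    simp only [LinearMap.comp_apply, Submodule.subtype_apply] at h1
    rw [h1]
    exact h2
  obtain ⟨g, hg⟩ := exists_of_pieces (A := A) (M := A)
    (fun n => match n with | 0 => 0 | n + 1 => pr A n ∘ₗ g0)
  refine ⟨g, fun x hx => by rw [hg 0 x hx]; rfl, fun n x hx => ?_, fun x => ?_⟩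
  · rw [hg _ x hx]; exact pr_mem _ _
  · refine hom_induction (p := fun x => Dd A (g (Dd A x)) = Dd A x) (fun n x hx => ?_)
      (fun x y hx hy => by simp only [map_add, hx, hy]) x
    rw [hg _ _ (d_gr hx)]
    change Dd A (pr A n (g0 (Dd A x))) = _
    rw [← pr_d, h0, pr_same (d_gr hx)]

theorem Bdd.contraction {A : Type} [GCDGA A] (h : Bdd A) : ∃ (N : ℕ) (G P : A →ₗ[ℚ] A),
    (∀ x, P x = x - Dd A (G x) - G (Dd A x)) ∧ (∀ x, sg A (G x) = - G (sg A x)) ∧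
    ∀ n, N < n → ∀ x ∈ Gr A n, P x = 0 := by
  obtain ⟨N, hN⟩ := h
  obtain ⟨g, g0, g1, gd⟩ := exists_gen_inverse A
  have sgg : ∀ x, sg A (g x) = - g (sg A x) := fun x => by
    refine hom_induction (p := fun x => sg A (g x) = - g (sg A x)) (fun n x hx => ?_)
      (fun x y hx hy => by simp only [map_add, hx, hy, neg_add]) x
    rcases n with _ | n
    · rw [g0 x hx, sg_hom hx, map_smul, g0 x hx]; simp
    · rw [sg_hom hx, sg_hom (g1 n x hx), map_smul, pow_succ]; simp
  let R : A →ₗ[ℚ] A := LinearMap.id - Dd A ∘ₗ g - g ∘ₗ Dd A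
  have hR : ∀ x, R x = x - Dd A (g x) - g (Dd A x) := fun x => rfl
  have Rd : ∀ x, R (Dd A x) = 0 := fun x => by rw [hR, gd]; simp
  have dR : ∀ x, Dd A (R x) = 0 := fun x => by rw [hR]; simp [gd]
  refine ⟨N, g - g ∘ₗ g ∘ₗ Dd A, R ∘ₗ R, fun x => ?_, fun x => ?_, fun n hn x hx => ?_⟩
  · simp only [LinearMap.comp_apply, LinearMap.sub_apply, hR, map_sub, d_d, gd, map_zero]
    abel
  · simp only [LinearMap.comp_apply, LinearMap.sub_apply, map_sub, sgg, sg_d, map_neg]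
    abel
  · have : R x ∈ Gr A n := by
      rw [hR]
      refine sub_mem (sub_mem hx ?_) (g1 _ _ (d_gr hx))
      rcases n with _ | n
      · rw [g0 x hx, map_zero]; exact zero_mem _
      · exact d_gr (g1 _ _ hx)
    obtain ⟨y, hy⟩ := hN n hn _ this (dR x)
    change R (R x) = 0
    rw [hy, Rd]

/-- `E` is the graded tensor product of `T` and `B`. -/
structure IsTens (T B E : Type) [GCDGA T] [GCDGA B] [GCDGA E] (i : T →ₐ[ℚ] E) (ι : B →ₐ[ℚ] E) :
    Prop where
  idga : IsDGAHom i
  ιdga : IsDGAHom ι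
  span : ∀ P : Submodule ℚ E, (∀ t b, i t * ι b ∈ P) → ∀ x, x ∈ P
  lin : ∀ (M : Type) [AddCommGroup M] [Module ℚ M] (act : T →ₐ[ℚ] Module.End ℚ M) (φ : B →ₗ[ℚ] M),
    ∃ Φ : E →ₗ[ℚ] M, ∀ t b, Φ (i t * ι b) = act t (φ b)

namespace IsTens

variable {T B E : Type} [GCDGA T] [GCDGA B] [GCDGA E] {i : T →ₐ[ℚ] E} {ι : B →ₐ[ℚ] E}

theorem lext (h : IsTens T B E i ι) {M : Type*} [AddCommGroup M] [Module ℚ M] {f g : E →ₗ[ℚ] M}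
    (H : ∀ t b, f (i t * ι b) = g (i t * ι b)) : f = g := by
  ext x
  exact h.span (LinearMap.eqLocus f g) H x

theorem span_hom (h : IsTens T B E i ι) (P : Submodule ℚ E)
    (hP : ∀ m n t b, t ∈ Gr T m → b ∈ Gr B n → i t * ι b ∈ P) (x : E) : x ∈ P := by
  refine h.span P (fun t b => ?_) x
  refine hom_induction (p := fun t => i t * ι b ∈ P) (fun m t ht => ?_)
    (fun x y hx hy => by rw [map_add, add_mul]; exact add_mem hx hy) t
  exact hom_induction (p := fun b => i t * ι b ∈ P) (fun n b hb => hP m n t b ht hb)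
    (fun x y hx hy => by rw [map_add, mul_add]; exact add_mem hx hy) b

theorem lext_hom (h : IsTens T B E i ι) {M : Type*} [AddCommGroup M] [Module ℚ M] {f g : E →ₗ[ℚ] M}
    (H : ∀ m n t b, t ∈ Gr T m → b ∈ Gr B n → f (i t * ι b) = g (i t * ι b)) : f = g := by
  ext x
  exact h.span_hom (LinearMap.eqLocus f g) H x

theorem bil (h : IsTens T B E i ι) {M : Type} [AddCommGroup M] [Module ℚ M] (f : T →ₗ[ℚ] B →ₗ[ℚ] M) :
    ∃ Φ : E →ₗ[ℚ] M, ∀ t b, Φ (i t * ι b) = f t b := by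
  let act : T →ₐ[ℚ] Module.End ℚ (T →ₗ[ℚ] M) := AlgHom.ofLinearMap
    (LinearMap.mk₂ ℚ (fun t g => g ∘ₗ LinearMap.mulRight ℚ t)
      (fun t t' g => by ext; simp [mul_add]) (fun c t g => by ext; simp)
      (fun t g g' => by ext; simp) (fun c t g => by ext; simp))
    (by ext; simp) (fun t t' => by ext; simp [mul_assoc])
  have hact : ∀ t g s, act t g s = g (s * t) := fun _ _ _ => rfl
  obtain ⟨Φ, hΦ⟩ := h.lin _ act f.flip
  refine ⟨LinearMap.applyₗ 1 ∘ₗ Φ, fun t b => ?_⟩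
  rw [LinearMap.comp_apply, hΦ, LinearMap.applyₗ_apply_apply, hact, one_mul, LinearMap.flip_apply]

theorem adjoin (h : IsTens T B E i ι) {s : Set T} {s' : Set B} (hs : Algebra.adjoin ℚ s = ⊤)
    (hs' : Algebra.adjoin ℚ s' = ⊤) : Algebra.adjoin ℚ (i '' s ∪ ι '' s') = ⊤ := by
  rw [eq_top_iff]
  intro x _
  refine h.span (Subalgebra.toSubmodule (Algebra.adjoin ℚ (i '' s ∪ ι '' s'))) (fun t b => ?_) x
  change i t * ι b ∈ Algebra.adjoin ℚ (i '' s ∪ ι '' s')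
  refine mul_mem ?_ ?_
  · have : i t ∈ (Algebra.adjoin ℚ s).map i := ⟨t, by rw [hs]; trivial, rfl⟩
    rw [AlgHom.map_adjoin] at this
    exact Algebra.adjoin_mono Set.subset_union_left this
  · have : ι b ∈ (Algebra.adjoin ℚ s').map ι := ⟨b, by rw [hs']; trivial, rfl⟩
    rw [AlgHom.map_adjoin] at this
    exact Algebra.adjoin_mono Set.subset_union_right this

theorem hom_ext (h : IsTens T B E i ι) {R : Type*} [Ring R] [Algebra ℚ R] {f g : E →ₐ[ℚ] R} (h1 : ∀ t, f (i t) = g (i t))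
    (h2 : ∀ b, f (ι b) = g (ι b)) : f = g :=
  AlgHom.toLinearMap_injective (h.lext (f := f.toLinearMap) (g := g.toLinearMap) fun t b => by
    simp [h1, h2])

theorem univ (h : IsTens T B E i ι) {D : Type} [GCDGA D] {f : T →ₐ[ℚ] D} {g : B →ₐ[ℚ] D} (hf : IsDGAHom f)
    (hg : IsDGAHom g) : ∃ F : E →ₐ[ℚ] D, IsDGAHom F ∧ (∀ t, F (i t) = f t) ∧ ∀ b, F (ι b) = g b := by
  obtain ⟨Φ, hΦ⟩ := h.bil ((LinearMap.mul ℚ D).compl₁₂ f.toLinearMap g.toLinearMap)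
  have hΦ : ∀ t b, Φ (i t * ι b) = f t * g b := hΦ
  have hmul : ∀ x y, Φ (x * y) = Φ x * Φ y := by
    intro x y
    refine LinearMap.congr_fun (f := Φ ∘ₗ LinearMap.mulRight ℚ y)
      (g := LinearMap.mulRight ℚ (Φ y) ∘ₗ Φ) (h.lext_hom fun m n t b ht hb => ?_) x
    refine LinearMap.congr_fun (f := Φ ∘ₗ LinearMap.mulLeft ℚ (i t * ι b))
      (g := LinearMap.mulLeft ℚ (Φ (i t * ι b)) ∘ₗ Φ) (h.lext fun t' b' => ?_) y
    change Φ (i t * ι b * (i t' * ι b')) = Φ (i t * ι b) * Φ (i t' * ι b')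
    have e : i t * ι b * (i t' * ι b') = i (t * sc T ((-1) ^ n) t') * ι (b * b') := by
      rw [mul_assoc, ← mul_assoc (ι b), mul_comm_sc (h.ιdga.2 n b hb), ← h.idga.sc, map_mul,
        map_mul]
      simp only [mul_assoc]
    rw [e, hΦ, hΦ, hΦ, mul_assoc (f t), ← mul_assoc (g b), mul_comm_sc (hg.2 n b hb), ← hf.sc,
      map_mul, map_mul]
    simp only [mul_assoc]
  have h1 : Φ 1 = 1 := by simpa using hΦ 1 1
  let F : E →ₐ[ℚ] D := AlgHom.ofLinearMap Φ h1 hmul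
  have F1 : ∀ t, F (i t) = f t := fun t => by
    change Φ (i t) = f t
    simpa using hΦ t 1
  have F2 : ∀ b, F (ι b) = g b := fun b => by
    change Φ (ι b) = g b
    simpa using hΦ 1 b
  refine ⟨F, dga_of_gen (h.adjoin (adjoin_homog T) (adjoin_homog B)) ?_ ?_, F1, F2⟩
  · rintro _ (⟨b, ⟨n, hb⟩, rfl⟩ | ⟨b, ⟨n, hb⟩, rfl⟩)
    · exact ⟨n, h.idga.2 n b hb, by rw [F1]; exact hf.2 n b hb⟩
    · exact ⟨n, h.ιdga.2 n b hb, by rw [F2]; exact hg.2 n b hb⟩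
  · rintro _ (⟨b, ⟨n, hb⟩, rfl⟩ | ⟨b, ⟨n, hb⟩, rfl⟩)
    · rw [← h.idga.1, F1, F1, hf.1]
    · rw [← h.ιdga.1, F2, F2, hg.1]

theorem conn (h : IsTens T B E i ι) (hT : Conn T) (hB : Conn B) : Conn E := by
  intro x hx
  have key := h.span_hom ((LinearMap.range (Algebra.linearMap ℚ E)).comap (pr E 0))
    (fun m n t b ht hb => ?_) x
  · obtain ⟨c, hc⟩ := key
    exact ⟨c, by rw [← pr_same hx, ← hc]; rfl⟩
  · change pr E 0 (i t * ι b) ∈ LinearMap.range (Algebra.linearMap ℚ E)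
    have hm := gr_mul (h.idga.2 _ _ ht) (h.ιdga.2 _ _ hb)
    by_cases h0 : m + n = 0
    · obtain ⟨rfl, rfl⟩ : m = 0 ∧ n = 0 := by omega
      obtain ⟨c, rfl⟩ := hT t ht
      obtain ⟨c', rfl⟩ := hB b hb
      rw [pr_same hm]
      exact ⟨c * c', by simp⟩
    · rw [pr_ne hm h0]; exact zero_mem _

theorem bdd (h : IsTens T B E i ι) (hT : Bdd T) (hB : Bdd B) : Bdd E := by
  obtain ⟨N, G, P, hP, sG, P0⟩ := hT.contraction
  obtain ⟨N', G', P', hP', sG', P0'⟩ := hB.contraction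
  have mk : ∀ (u : T →ₗ[ℚ] T) (v : B →ₗ[ℚ] B), ∃ Φ : E →ₗ[ℚ] E, ∀ t b,
      Φ (i t * ι b) = i (u t) * ι (v b) := fun u v =>
    h.bil ((LinearMap.mul ℚ E).compl₁₂ (i.toLinearMap ∘ₗ u) (ι.toLinearMap ∘ₗ v))
  obtain ⟨H, hH⟩ := mk G LinearMap.id
  obtain ⟨H', hH'⟩ := mk (sg T).toLinearMap G'
  obtain ⟨R, hR⟩ := mk P LinearMap.id
  obtain ⟨R', hR'⟩ := mk LinearMap.id P'
  simp only [LinearMap.id_apply, AlgHom.toLinearMap_apply] at hH hH' hR hR'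
  have d_it : ∀ t b, Dd E (i t * ι b) = i (Dd T t) * ι b + i (sg T t) * ι (Dd B b) := fun t b => by
    rw [d_mul, ← h.idga.1, ← h.idga.sc, ← h.ιdga.1]
  have hh : ∀ x, R x = x - Dd E (H x) - H (Dd E x) := fun x =>
    LinearMap.congr_fun (g := LinearMap.id - Dd E ∘ₗ H - H ∘ₗ Dd E) (h.lext fun t b => by
      change R (i t * ι b) = i t * ι b - Dd E (H (i t * ι b)) - H (Dd E (i t * ι b))
      rw [hR, hH, d_it, d_it, map_add, hH, hH, sG, hP]
      simp only [map_sub, sub_mul, map_neg, neg_mul]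
      abel) x
  have hh' : ∀ x, R' x = x - Dd E (H' x) - H' (Dd E x) := fun x =>
    LinearMap.congr_fun (g := LinearMap.id - Dd E ∘ₗ H' - H' ∘ₗ Dd E) (h.lext fun t b => by
      change R' (i t * ι b) = i t * ι b - Dd E (H' (i t * ι b)) - H' (Dd E (i t * ι b))
      rw [hR', hH', d_it, d_it, map_add, hH', hH', hP', sg_d, sg_sg]
      simp only [map_sub, mul_sub, map_neg, neg_mul]
      abel) x
  refine ⟨N + N', fun n hn x hx hdx => ?_⟩
  have key : ∀ x, R' (R (pr E n x)) = 0 := fun x =>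
    LinearMap.congr_fun (f := R' ∘ₗ R ∘ₗ pr E n) (g := 0) (h.lext_hom fun m m' t b ht hb => by
      change R' (R (pr E n (i t * ι b))) = 0
      have hm := gr_mul (h.idga.2 _ _ ht) (h.ιdga.2 _ _ hb)
      by_cases h0 : m + m' = n
      · rw [← h0, pr_same hm, hR, hR']
        by_cases h1 : N < m
        · rw [P0 m h1 t ht]; simp
        · rw [P0' m' (by omega) b hb]; simp
      · rw [pr_ne hm h0, map_zero, map_zero]) x
  have e := key x
  rw [pr_same hx, hh' (R x), hh x, hdx, map_zero, sub_zero, map_sub (Dd E), hdx, d_d, sub_zero,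
    map_zero, sub_zero, sub_eq_zero] at e
  refine ⟨H x + H' (x - Dd E (H x)), ?_⟩
  rw [map_add, ← e]; abel

end IsTens

/-- `B` has tensor products with everything, preserving resolvability. -/
def Good (B : Type) [GCDGA B] : Prop := ∀ (T : Type) [GCDGA T],
  ∃ (E : Type) (_ : GCDGA E) (i : T →ₐ[ℚ] E) (ι : B →ₐ[ℚ] E), IsTens T B E i ι ∧
    (Resolvable T → Resolvable E)

/-- Iterated elementary extensions of the ground field, up to isomorphism. -/
inductive Tower : ∀ (A : Type) [GCDGA A], Prop
  | base (K : Type) [GCDGA K] (hK : IsBase K) : Tower K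
  | step (B B' : Type) [GCDGA B] [GCDGA B'] (i : B →ₐ[ℚ] B') (m : ℕ) (w : B') (z : B)
      (h : IsHirsch B B' i (m + 1) w z) (hB : Tower B) : Tower B'
  | iso (B B' : Type) [GCDGA B] [GCDGA B'] (f : B →ₐ[ℚ] B') (g : B' →ₐ[ℚ] B) (hf : IsDGAHom f)
      (hg : IsDGAHom g) (hfg : ∀ x, f (g x) = x) (hgf : ∀ x, g (f x) = x) (hB : Tower B) : Tower B'

theorem Tower.good {A : Type} [GCDGA A] (h : Tower A) : Good A := by
  induction h with
  | base K hK =>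
    intro T _
    obtain ⟨u, hu⟩ := hK.exists_unit T
    have hι : ∀ t : K, ∃ r : ℚ, algebraMap ℚ K r = t := hK.2
    refine ⟨T, inferInstance, AlgHom.id ℚ T, u, ⟨isDGAHom_id T, hu, fun P hP x => ?_,
      fun M _ _ act φ => ?_⟩, id⟩
    · simpa using hP x 1
    · refine ⟨act.toLinearMap.flip (φ 1), fun t b => ?_⟩
      obtain ⟨r, rfl⟩ := hι b
      simp [Algebra.algebraMap_eq_smul_one]
  | step B B' i0 m w z h hB ih =>
    intro T _
    obtain ⟨E, _, i, ι, hE, hres⟩ := ih T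
    obtain ⟨E', _, i1, w', h'⟩ := exists_hirsch E (m + 1) (ι z) (hE.ιdga.2 _ _ h.hz)
      (by rw [← hE.ιdga.1, h.dz, map_zero])
    obtain ⟨ι', hι', e1, e2⟩ := h.univ (i1.comp ι) (hE.ιdga.comp h'.dga) h'.hw h'.dw
    have e1 : ∀ b, ι' (i0 b) = i1 (ι b) := fun b => DFunLike.congr_fun e1 b
    have e3 : ∀ t b l, i1 (i t) * ι' (i0 b * w ^ l) = i1 (i t * ι b) * w' ^ l := fun t b l => by
      rw [map_mul ι', map_pow, e1, e2, map_mul, mul_assoc]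
    refine ⟨E', inferInstance, i1.comp i, ι', ⟨hE.idga.comp h'.dga, hι', fun P hP x => ?_,
      fun M _ _ act φ => ?_⟩, fun hr => h'.resolvable (hres hr)⟩
    · refine h'.span P (fun x l => ?_) x
      refine hE.span (P.comap (LinearMap.mulRight ℚ (w' ^ l) ∘ₗ i1.toLinearMap)) (fun t b => ?_) x
      change i1 (i t * ι b) * w' ^ l ∈ P
      rw [← e3]; exact hP _ _
    · choose Φ hΦ using fun l : ℕ => hE.lin M act (φ ∘ₗ LinearMap.mulRight ℚ (w ^ l) ∘ₗ i0.toLinearMap)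
      have hΦ : ∀ l t b, Φ l (i t * ι b) = act t (φ (i0 b * w ^ l)) := hΦ
      obtain ⟨G, hG⟩ := h'.lin M Φ (fun hk l hl => hE.lext fun t b => by
        rw [hΦ, h.pow_zero_of_odd hk hl]; simp)
      refine ⟨G, fun t x => ?_⟩
      refine LinearMap.congr_fun (f := G ∘ₗ LinearMap.mulLeft ℚ (i1 (i t)) ∘ₗ ι'.toLinearMap)
        (g := act t ∘ₗ φ) (h.lext fun b l => ?_) x
      change G (i1 (i t) * ι' (i0 b * w ^ l)) = act t (φ (i0 b * w ^ l))
      rw [e3, hG, hΦ]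
  | iso B B' f g hf hg hfg hgf hB ih =>
    intro T _
    obtain ⟨E, _, i, ι, hE, hres⟩ := ih T
    refine ⟨E, inferInstance, i, ι.comp g, ⟨hE.idga, hg.comp hE.ιdga, fun P hP x => ?_,
      fun M _ _ act φ => ?_⟩, hres⟩
    · refine hE.span P (fun t b => ?_) x
      have := hP t (f b)
      rwa [AlgHom.comp_apply, hgf] at this
    · obtain ⟨Φ, hΦ⟩ := hE.lin M act (φ ∘ₗ f.toLinearMap)
      refine ⟨Φ, fun t b => ?_⟩
      rw [AlgHom.comp_apply, hΦ]
      simp [hfg]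

theorem TensorPower.hom_ext {A : Type} [GCDGA A] {r : ℕ} {T : Type} [GCDGA T]
    (TP : TensorPower A r T) {B : Type} [GCDGA B] {f g : T →ₐ[ℚ] B} (hf : IsDGAHom f)
    (hg : IsDGAHom g) (h : ∀ j x, f (TP.ι j x) = g (TP.ι j x)) : f = g :=
  (TP.coprod B (fun j => g.comp (TP.ι j)) (fun j => (TP.ι_dga j).comp hg)).unique
    ⟨hf, fun j => AlgHom.ext (h j)⟩ ⟨hg, fun _ => rfl⟩

theorem TensorPower.succ {A : Type} [GCDGA A] {r : ℕ} {T : Type} [GCDGA T]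
    (TP : TensorPower A r T) {E : Type} [GCDGA E] {i : T →ₐ[ℚ] E} {ι : A →ₐ[ℚ] E}
    (h : IsTens T A E i ι) : Nonempty (TensorPower A (r + 1) E) := by
  refine ⟨⟨Fin.snoc (α := fun _ => A →ₐ[ℚ] E) (fun j => i.comp (TP.ι j)) ι, fun j => ?_,
    fun B _ f hf => ?_⟩⟩
  · refine Fin.lastCases ?_ (fun j => ?_) j
    · rw [Fin.snoc_last]; exact h.ιdga
    · rw [Fin.snoc_castSucc]; exact (TP.ι_dga j).comp h.idga
  · obtain ⟨g0, ⟨hg0, e0⟩, -⟩ := TP.coprod B (fun j => f j.castSucc) (fun j => hf _)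
    obtain ⟨F, hF, F1, F2⟩ := h.univ hg0 (hf (Fin.last r))
    refine ⟨F, ⟨hF, fun j => ?_⟩, fun F' ⟨hF', hj⟩ => h.hom_ext (fun t => ?_) (fun b => ?_)⟩
    · refine Fin.lastCases ?_ (fun j => ?_) j
      · rw [Fin.snoc_last]; exact AlgHom.ext F2
      · rw [Fin.snoc_castSucc, ← e0 j]
        exact AlgHom.ext fun x => F1 _
    · rw [F1]
      have : F'.comp i = g0 := TP.hom_ext (h.idga.comp hF') hg0 fun j x => by
        have := DFunLike.congr_fun (hj j.castSucc) x
        rw [Fin.snoc_castSucc] at this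
        have h2 := DFunLike.congr_fun (e0 j) x
        exact this.trans h2.symm
      exact DFunLike.congr_fun this t
    · have := DFunLike.congr_fun (hj (Fin.last r)) b
      rw [Fin.snoc_last] at this
      rw [F2]; exact this

theorem exists_tensorPower {A : Type} [GCDGA A] (hA : Good A) (hb : Bdd A) (hc : Conn A) (r : ℕ) :
    ∃ (T : Type) (_ : GCDGA T), Nonempty (TensorPower A r T) ∧ Resolvable T ∧ Bdd T ∧ Conn T := by
  induction r with
  | zero =>
    obtain ⟨K, _, hK⟩ := exists_base
    refine ⟨K, inferInstance, ⟨⟨Fin.elim0, fun j => j.elim0, fun B _ f hf => ?_⟩⟩, hK.resolvable,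
      ⟨0, fun n hn x hx _ => ⟨0, ?_⟩⟩, fun x _ => ?_⟩
    · obtain ⟨u, hu⟩ := hK.exists_unit B
      exact ⟨u, ⟨hu, fun j => j.elim0⟩, fun g _ => hK.hom_ext _ _⟩
    · rw [map_zero, ← pr_same hx, pr_ne (hK.gr x) hn.ne]
    · obtain ⟨c, hc⟩ := hK.2 x
      exact ⟨c, hc.symm⟩
  | succ r ih =>
    obtain ⟨T, _, ⟨TP⟩, hr, hbT, hcT⟩ := ih
    obtain ⟨E, _, i, ι, hE, hres⟩ := hA T
    exact ⟨E, inferInstance, TP.succ hE, hres hr, hE.bdd hbT hb, hE.conn hcT hc⟩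

/-- Simultaneous adjunction of finitely many variables. -/
theorem exists_multi_hirsch (C0 : Type) [GCDGA C0] (n : ℕ) (k : Fin n → ℕ) (z : Fin n → C0)
    (hz : ∀ j, z j ∈ Gr C0 (k j + 1)) (dz : ∀ j, Dd C0 (z j) = 0) :
    ∃ (C : Type) (_ : GCDGA C) (i : C0 →ₐ[ℚ] C) (w : Fin n → C), IsDGAHom i ∧
      (∀ j, w j ∈ Gr C (k j)) ∧ (∀ j, Dd C (w j) = i (z j)) ∧
      (∀ (D : Type) [GCDGA D] (f : C0 →ₐ[ℚ] D) (c : Fin n → D), IsDGAHom f →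
        (∀ j, c j ∈ Gr D (k j)) → (∀ j, Dd D (c j) = f (z j)) →
        ∃ g : C →ₐ[ℚ] D, IsDGAHom g ∧ (∀ a, g (i a) = f a) ∧ ∀ j, g (w j) = c j) ∧
      ∀ Pd : (∀ (C : Type) [GCDGA C], (C0 →ₐ[ℚ] C) → Set C → Prop),
        Pd C0 (AlgHom.id ℚ C0) ∅ →
        (∀ (C C' : Type) [GCDGA C] [GCDGA C'] (i : C0 →ₐ[ℚ] C) (s : Set C) (i' : C →ₐ[ℚ] C') (j : Fin n)
          (w : C'), Pd C i s → IsHirsch C C' i' (k j) w (i (z j)) →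
          Pd C' (i'.comp i) (insert w (i' '' s))) → Pd C i (Set.range w) := by
  induction n with
  | zero =>
    refine ⟨C0, inferInstance, AlgHom.id ℚ C0, Fin.elim0, isDGAHom_id C0, fun j => j.elim0,
      fun j => j.elim0, fun D _ f c hf _ _ => ⟨f, hf, fun _ => rfl, fun j => j.elim0⟩,
      fun Pd h0 _ => ?_⟩
    rw [Set.range_eq_empty]; exact h0
  | succ n ih =>
    obtain ⟨C, _, i, w, hi, hw, dw, un, ind⟩ := ih (fun j => k j.succ) (fun j => z j.succ)
      (fun j => hz _) (fun j => dz _)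
    obtain ⟨C', _, i', w', h'⟩ := exists_hirsch C (k 0) (i (z 0)) (hi.2 _ _ (hz 0))
      (by rw [← hi.1, dz, map_zero])
    refine ⟨C', inferInstance, i'.comp i, Fin.cons w' (fun j => i' (w j)), hi.comp h'.dga, fun j => ?_,
      fun j => ?_, fun D _ f c hf hc dc => ?_, fun Pd h0 hs => ?_⟩
    · refine Fin.cases ?_ (fun j => ?_) j
      · exact h'.hw
      · exact h'.dga.2 _ _ (hw j)
    · refine Fin.cases ?_ (fun j => ?_) j
      · exact h'.dw
      · simp only [Fin.cons_succ]
        rw [← h'.dga.1, dw]; rfl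
    · obtain ⟨g, hg, g1, g2⟩ := un D f (fun j => c j.succ) hf (fun j => hc _) (fun j => dc _)
      obtain ⟨g', hg', e1, e2⟩ := h'.univ g hg (hc 0) (by rw [dc, g1])
      refine ⟨g', hg', fun a => ?_, fun j => ?_⟩
      · rw [← g1]; exact DFunLike.congr_fun e1 _
      · refine Fin.cases ?_ (fun j => ?_) j
        · exact e2
        · rw [← g2]; exact DFunLike.congr_fun e1 _
    · rw [Fin.range_cons, Set.range_comp' i' w]
      exact hs C C' i (Set.range w) i' 0 w' (ind Pd h0 fun C C' _ _ i s i' j w => hs C C' i s i' j.succ w) h'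

theorem multi_hirsch_gen {C0 : Type} [GCDGA C0] {n : ℕ} {k : Fin n → ℕ} {z : Fin n → C0} {s0 : Set C0}
    (hs0 : Algebra.adjoin ℚ s0 = ⊤) {C : Type} [GCDGA C] {i : C0 →ₐ[ℚ] C} {w : Fin n → C}
    (ind : ∀ Pd : (∀ (C : Type) [GCDGA C], (C0 →ₐ[ℚ] C) → Set C → Prop),
        Pd C0 (AlgHom.id ℚ C0) ∅ →
        (∀ (C C' : Type) [GCDGA C] [GCDGA C'] (i : C0 →ₐ[ℚ] C) (s : Set C) (i' : C →ₐ[ℚ] C') (j : Fin n)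
          (w : C'), Pd C i s → IsHirsch C C' i' (k j) w (i (z j)) →
          Pd C' (i'.comp i) (insert w (i' '' s))) → Pd C i (Set.range w)) :
    Algebra.adjoin ℚ (i '' s0 ∪ Set.range w) = ⊤ := by
  refine ind (fun C _ i s => Algebra.adjoin ℚ (i '' s0 ∪ s) = ⊤) ?_ ?_
  · simpa using hs0
  · intro C C' _ _ i s i' j w h h'
    rw [← h'.adjoin h]
    congr 1
    ext x
    simp only [Set.mem_union, Set.mem_image, Set.mem_insert_iff, AlgHom.comp_apply,
      Set.mem_singleton_iff]
    constructor
    · rintro (⟨a, ha, rfl⟩ | rfl | ⟨a, ha, rfl⟩)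
      exacts [Or.inl ⟨_, Or.inl ⟨a, ha, rfl⟩, rfl⟩, Or.inr rfl, Or.inl ⟨a, Or.inr ha, rfl⟩]
    · rintro (⟨_, ⟨a, ha, rfl⟩ | ha, rfl⟩ | rfl)
      exacts [Or.inl ⟨a, ha, rfl⟩, Or.inr (Or.inr ⟨_, ha, rfl⟩), Or.inr (Or.inl rfl)]

/-- The elements with no component in degrees below `k`. -/
def Ge (A : Type) [GCDGA A] (k : ℕ) : Submodule ℚ A where
  carrier := {x : A | ∀ n < k, pr A n x = 0}
  add_mem' hx hy n hn := by rw [map_add, hx n hn, hy n hn, add_zero]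
  zero_mem' n _ := map_zero _
  smul_mem' c x hx n hn := by rw [map_smul, hx n hn, smul_zero]

section ge
variable {A : Type} [GCDGA A]

theorem gr_le_ge {k n : ℕ} (h : k ≤ n) : Gr A n ≤ Ge A k := fun x hx m hm =>
  pr_ne hx (by omega)

theorem homog_ge (k : ℕ) : Homog (Ge A k) := fun x hx n => by
  by_cases h : n < k
  · rw [hx n h]; exact zero_mem _
  · exact gr_le_ge (not_lt.1 h) (pr_mem n x)

theorem ge_induction {k : ℕ} {P : Submodule ℚ A} (h : ∀ n, k ≤ n → Gr A n ≤ P) : Ge A k ≤ P :=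
  fun x hx => mem_of_pr fun n => by
    by_cases hn : n < k
    · rw [hx n hn]; exact zero_mem _
    · exact h n (not_lt.1 hn) (pr_mem n x)

theorem ge_mul (k l : ℕ) : Ge A k * Ge A l ≤ Ge A (k + l) := by
  rw [Submodule.mul_le]
  intro x hx y hy
  have h1 : Ge A k ≤ (Ge A (k + l)).comap (LinearMap.mulRight ℚ y) := ge_induction fun n hn x hx => by
    have h2 : Ge A l ≤ (Ge A (k + l)).comap (LinearMap.mulLeft ℚ x) := ge_induction fun m hm y hy =>
      gr_le_ge (add_le_add hn hm) (gr_mul hx hy)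
    exact h2 hy
  exact h1 hx

theorem ge_pow (k n : ℕ) : Ge A k ^ n ≤ Ge A (n * k) := by
  induction n with
  | zero =>
    intro _ _ n hn
    simp at hn
  | succ n ih =>
    rw [pow_succ, Nat.succ_mul]
    exact (mul_le_mul' ih le_rfl).trans (ge_mul _ _)

theorem ge_zero : Ge A 0 = ⊤ := eq_top_iff.2 fun _ _ n hn => absurd hn (Nat.not_lt_zero n)

theorem ge_anti {k l : ℕ} (h : k ≤ l) : Ge A l ≤ Ge A k := fun _ hx n hn => hx n (by omega)

end ge

/-- Free generators of a graded-commutative algebra. -/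
structure FreeOn (A : Type) [GCDGA A] {κ : Type} (v : κ → A) (deg : κ → ℕ) : Prop where
  mem : ∀ k, v k ∈ Gr A (deg k)
  ex : ∀ (D : Type) [GCDGA D] (c : κ → D), (∀ k, c k ∈ Gr D (deg k)) →
    ∃ g : A →ₐ[ℚ] D, (∀ i a, a ∈ Gr A i → g a ∈ Gr D i) ∧ ∀ k, g (v k) = c k
  uniq : ∀ (D : Type) [GCDGA D] (g g' : A →ₐ[ℚ] D), (∀ i a, a ∈ Gr A i → g a ∈ Gr D i) →
    (∀ i a, a ∈ Gr A i → g' a ∈ Gr D i) → (∀ k, g (v k) = g' (v k)) → g = g'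

theorem FreeOn.gen {A : Type} [GCDGA A] {κ : Type} {v : κ → A} {deg : κ → ℕ} (h : FreeOn A v deg) :
    Algebra.adjoin ℚ (Set.range v) = ⊤ := by
  obtain ⟨B, _, e, hB, he⟩ := exists_zero_d A
  let s : Subalgebra ℚ B := Algebra.adjoin ℚ (Set.range fun k => e (v k))
  have hs : Homog (Subalgebra.toSubmodule s) := by
    change Homog (Subalgebra.toSubmodule (Algebra.adjoin ℚ (Set.range fun k => e (v k))))
    rw [Algebra.adjoin_eq_span]
    refine homog_span fun x hx => ?_
    induction hx using Submonoid.closure_induction with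
    | mem x hx =>
      obtain ⟨k, rfl⟩ := hx
      exact ⟨deg k, (he _ _).1 (h.mem k)⟩
    | one => exact ⟨0, gr_one⟩
    | mul x y _ _ hx hy =>
      obtain ⟨n, hn⟩ := hx
      obtain ⟨m, hm⟩ := hy
      exact ⟨n + m, gr_mul hn hm⟩
  obtain ⟨C, _, i, hi, inj, im, refl⟩ := exists_sub s hs (fun x _ => by rw [hB]; exact zero_mem _)
  choose c hc using fun k => (im (e (v k))).1 (Algebra.subset_adjoin ⟨k, rfl⟩)
  obtain ⟨g, hg, gv⟩ := h.ex C c (fun k => refl _ _ (by rw [hc]; exact (he _ _).1 (h.mem k)))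
  have key : i.comp g = e.toAlgHom := h.uniq B _ _ (fun n a ha => hi.2 _ _ (hg n a ha))
    (fun n a ha => (he n a).1 ha) (fun k => by
      change i (g (v k)) = e (v k)
      rw [gv, hc])
  have h2 : ∀ a, e a ∈ s := fun a => (im _).2 ⟨g a, DFunLike.congr_fun key a⟩
  rw [eq_top_iff]
  intro a _
  have h3 : e a ∈ (Algebra.adjoin ℚ (Set.range v)).map e.toAlgHom := by
    rw [AlgHom.map_adjoin, ← Set.range_comp]
    exact h2 a
  obtain ⟨b, hb, hba⟩ := h3
  rwa [e.injective hba] at hb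

theorem MinimalSullivan.exists_freeOn {A : Type} [GCDGA A] (S : MinimalSullivan A)
    (hfd : FiniteDimensional ℚ (⨆ n, S.V n : Submodule ℚ A)) :
    ∃ (κ : Type) (_ : Fintype κ) (v : κ → A) (deg : κ → ℕ), FreeOn A v deg ∧
      (∀ k, v k ∈ S.V (deg k)) ∧ (∀ k, v k ≠ 0) ∧ S.lam 1 = Submodule.span ℚ (Set.range v) := by
  classical
  have := S.V_fin
  obtain ⟨N, hN⟩ : ∃ N, ∀ n, N < n → S.V n = ⊥ := by
    obtain ⟨s, hs⟩ := Module.Finite.iff_fg.1 hfd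
    choose N hN using fun a : A => pr_finite a
    refine ⟨s.sup N, fun n hn => (Submodule.eq_bot_iff _).2 fun x hx => ?_⟩
    have h1 : x ∈ Submodule.span ℚ (s : Set A) := hs ▸ Submodule.mem_iSup_of_mem n hx
    have h2 : Submodule.span ℚ (s : Set A) ≤ LinearMap.ker (pr A n) := Submodule.span_le.2
      fun a ha => hN a n (lt_of_le_of_lt (Finset.le_sup (f := N) ha) hn)
    rw [← pr_same (S.V_le n hx)]
    exact h2 h1
  let b : ∀ n, Module.Basis (Fin (Module.finrank ℚ (S.V n))) ℚ (S.V n) := fun n =>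
    Module.finBasis ℚ (S.V n)
  let κ := Σ n : Fin (N + 1), Fin (Module.finrank ℚ (S.V n))
  refine ⟨κ, inferInstance, fun k => b k.1 k.2, fun k => k.1, ⟨fun k => S.V_le _ (b k.1 k.2).2,
    fun D _ c hc => ?_, fun D _ g g' hg hg' hv => ?_⟩, fun k => (b k.1 k.2).2,
    fun k h => (b k.1).ne_zero k.2 (Subtype.ext h), ?_⟩
  · let f : ∀ n, S.V n →ₗ[ℚ] D := fun n =>
      if hn : n < N + 1 then (b n).constr ℚ fun t => c ⟨⟨n, hn⟩, t⟩ else 0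
    obtain ⟨g, ⟨hg, gv⟩, -⟩ := S.free D f (fun n v => by
      by_cases hn : n < N + 1
      · simp only [f, dif_pos hn, Module.Basis.constr_apply_fintype]
        exact Submodule.sum_mem _ fun t _ => Submodule.smul_mem _ _ (hc ⟨⟨n, hn⟩, t⟩)
      · simp only [f, dif_neg hn]; exact zero_mem _)
    refine ⟨g, hg, fun ⟨⟨n, hn⟩, t⟩ => ?_⟩
    rw [gv]
    simp only [f, dif_pos hn, Module.Basis.constr_basis]
  · refine (S.free D (fun n => g.toLinearMap ∘ₗ (S.V n).subtype)
      (fun n v => hg n _ (S.V_le n v.2))).unique ⟨hg, fun _ _ => rfl⟩ ⟨hg', fun n v => ?_⟩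
    change g' v = g v
    by_cases hn : n < N + 1
    · refine LinearMap.congr_fun (f := g'.toLinearMap ∘ₗ (S.V n).subtype)
        (g := g.toLinearMap ∘ₗ (S.V n).subtype) ((b n).ext fun t => ?_) v
      exact (hv ⟨⟨n, hn⟩, t⟩).symm
    · have : (v : A) = 0 := by
        exact (Submodule.eq_bot_iff _).1 (hN n (by omega)) v v.2
      rw [this, map_zero, map_zero]
  · rw [S.lam_one]
    refine le_antisymm (iSup_le fun n => ?_) (Submodule.span_le.2 ?_)
    · by_cases hn : n < N + 1
      · intro x hx
        have h1 := (b n).mem_span ⟨x, hx⟩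
        have h2 := Submodule.mem_map_of_mem (f := (S.V n).subtype) h1
        rw [Submodule.map_span, ← Set.range_comp] at h2
        refine Submodule.span_mono ?_ h2
        rintro _ ⟨t, rfl⟩
        exact ⟨⟨⟨n, hn⟩, t⟩, rfl⟩
      · rw [hN n (by omega)]; exact bot_le
    · rintro _ ⟨k, rfl⟩
      exact Submodule.mem_iSup_of_mem _ (b k.1 k.2).2

namespace MinimalSullivan
variable {A : Type} [GCDGA A] (S : MinimalSullivan A)

theorem exists_wp : ∃ w : ℕ → A →ₗ[ℚ] A, (∀ k a, w k a ∈ S.lam k) ∧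
    (∀ k a, a ∈ S.lam k → w k a = a) ∧ (∀ k l a, a ∈ S.lam k → k ≠ l → w l a = 0) ∧
    ∀ (P : Submodule ℚ A) a, (∀ k, w k a ∈ P) → a ∈ P := by
  classical
  let _ := S.lam_internal.chooseDecomposition
  refine ⟨fun k => (S.lam k).subtype ∘ₗ DirectSum.component ℚ ℕ (fun i => S.lam i) k ∘ₗ
    (DirectSum.decomposeLinearEquiv S.lam).toLinearMap, fun k a => Subtype.prop _, fun k a h => ?_,
    fun k l a h hkl => ?_, fun P a h => ?_⟩
  · exact DirectSum.decompose_of_mem_same S.lam h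
  · exact DirectSum.decompose_of_mem_ne S.lam h hkl
  · rw [← DirectSum.sum_support_decompose S.lam a]
    exact Submodule.sum_mem _ fun i _ => h i

theorem lam_eq_pow {s : Set A} (hs : Algebra.adjoin ℚ s = ⊤) (h1 : S.lam 1 = Submodule.span ℚ s)
    (k : ℕ) : S.lam k = S.lam 1 ^ k := by
  have hle : ∀ k, S.lam 1 ^ k ≤ S.lam k := fun k => by
    induction k with
    | zero => rw [S.lam_zero, pow_zero]
    | succ k ih => rw [pow_succ]; exact (mul_le_mul' ih le_rfl).trans (S.lam_mul k 1)
  have htop : ∀ a : A, a ∈ ⨆ k, S.lam 1 ^ k := fun a => by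
    have ha : a ∈ Algebra.adjoin ℚ s := hs ▸ Algebra.mem_top
    induction ha using Algebra.adjoin_induction with
    | mem x hx =>
      exact Submodule.mem_iSup_of_mem 1 (by rw [pow_one, h1]; exact Submodule.subset_span hx)
    | algebraMap c => exact Submodule.mem_iSup_of_mem 0 (by
        rw [pow_zero]; exact Submodule.algebraMap_mem c)
    | add x y _ _ hx hy => exact add_mem hx hy
    | mul x y _ _ hx hy =>
      have h2 : (⨆ k, S.lam 1 ^ k) * (⨆ k, S.lam 1 ^ k) ≤ ⨆ k, S.lam 1 ^ k := by
        rw [Submodule.iSup_mul]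
        refine iSup_le fun k => ?_
        rw [Submodule.mul_iSup]
        refine iSup_le fun l => ?_
        rw [← pow_add]
        exact le_iSup (fun k => S.lam 1 ^ k) (k + l)
      exact h2 (Submodule.mul_mem_mul hx hy)
  obtain ⟨w, -, w2, w3, -⟩ := S.exists_wp
  refine le_antisymm (fun a ha => ?_) (hle k)
  have h2 : (⨆ k, S.lam 1 ^ k) ≤ (S.lam 1 ^ k).comap (w k) := iSup_le fun l b hb => by
    change w k b ∈ S.lam 1 ^ k
    by_cases hkl : l = k
    · subst hkl; rwa [w2 _ _ (hle _ hb)]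
    · rw [w3 l k b (hle _ hb) hkl]; exact zero_mem _
  have h3 := h2 (htop a)
  change w k a ∈ S.lam 1 ^ k at h3
  rwa [w2 _ _ ha] at h3

end MinimalSullivan

/-- A presentation of a pure coformal algebra. -/
structure Pres (A : Type) [GCDGA A] {p q : ℕ} (x : Fin p → A) (y : Fin q → A) (dx : Fin p → ℕ)
    (dy : Fin q → ℕ) (β : Fin q → Fin p → Fin p → ℚ) : Prop where
  hx : ∀ i, x i ∈ Gr A (2 * dx i + 2)
  hy : ∀ j, y j ∈ Gr A (2 * dy j + 3)
  dx0 : ∀ i, Dd A (x i) = 0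
  dyj : ∀ j, Dd A (y j) = ∑ i, ∑ i', β j i i' • (x i * x i')
  symm : ∀ j i i', β j i i' = β j i' i
  deg : ∀ j i i', β j i i' ≠ 0 → dx i + dx i' = dy j
  gen : Algebra.adjoin ℚ (Set.range x ∪ Set.range y) = ⊤
  free : ∀ (D : Type) [GCDGA D] (a : Fin p → D) (b : Fin q → D), (∀ i, a i ∈ Gr D (2 * dx i + 2)) →
    (∀ j, b j ∈ Gr D (2 * dy j + 3)) → ∃ g : A →ₐ[ℚ] D, (∀ i a, a ∈ Gr A i → g a ∈ Gr D i) ∧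
      (∀ i, g (x i) = a i) ∧ ∀ j, g (y j) = b j

theorem MinimalSullivan.exists_pres {A : Type} [GCDGA A] (S : MinimalSullivan A)
    (hpure : S.Pure) (hcof : S.Coformal) (hfd : FiniteDimensional ℚ (⨆ n, S.V n : Submodule ℚ A)) :
    ∃ (p q : ℕ) (x : Fin p → A) (y : Fin q → A) (dx : Fin p → ℕ) (dy : Fin q → ℕ)
      (β : Fin q → Fin p → Fin p → ℚ), Pres A x y dx dy β ∧
      S.lam 1 = Submodule.span ℚ (Set.range x ∪ Set.range y) := by
  classical
  obtain ⟨κ, _, v, deg, hF, hV, hv0, hlam⟩ := S.exists_freeOn hfd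
  have deg2 : ∀ k, 2 ≤ deg k := fun k => by
    by_contra h
    have h1 := hV k
    have h2 : S.V (deg k) = ⊥ := by
      have : deg k = 0 ∨ deg k = 1 := by omega
      rcases this with h | h <;> rw [h]
      exacts [S.V0, S.V1]
    rw [h2] at h1
    exact hv0 k h1
  let e1 := Fintype.equivFin {k // Even (deg k)}
  let e2 := Fintype.equivFin {k // ¬ Even (deg k)}
  let p := Fintype.card {k // Even (deg k)}
  let q := Fintype.card {k // ¬ Even (deg k)}
  let x : Fin p → A := fun i => v (e1.symm i)
  let y : Fin q → A := fun j => v (e2.symm j)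
  have hrange : Set.range v = Set.range x ∪ Set.range y := by
    ext a
    constructor
    · rintro ⟨k, rfl⟩
      by_cases h : Even (deg k)
      · exact Or.inl ⟨e1 ⟨k, h⟩, by simp [x]⟩
      · exact Or.inr ⟨e2 ⟨k, h⟩, by simp [y]⟩
    · rintro (⟨i, rfl⟩ | ⟨j, rfl⟩) <;> exact ⟨_, rfl⟩
  let dx : Fin p → ℕ := fun i => (deg (e1.symm i) - 2) / 2
  let dy : Fin q → ℕ := fun j => (deg (e2.symm j) - 3) / 2
  have hdx : ∀ i, deg (e1.symm i) = 2 * dx i + 2 := fun i => by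
    obtain ⟨c, hc⟩ := (e1.symm i).2
    have := deg2 (e1.symm i)
    simp only [dx]; omega
  have hdy : ∀ j, deg (e2.symm j) = 2 * dy j + 3 := fun j => by
    obtain ⟨c, hc⟩ := Nat.not_even_iff_odd.1 (e2.symm j).2
    have := deg2 (e2.symm j)
    simp only [dy]; omega
  have hx : ∀ i, x i ∈ Gr A (2 * dx i + 2) := fun i => hdx i ▸ hF.mem _
  have hy : ∀ j, y j ∈ Gr A (2 * dy j + 3) := fun j => hdy j ▸ hF.mem _
  have hfree : ∀ (D : Type) [GCDGA D] (a : Fin p → D) (b : Fin q → D),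
      (∀ i, a i ∈ Gr D (2 * dx i + 2)) → (∀ j, b j ∈ Gr D (2 * dy j + 3)) →
      ∃ g : A →ₐ[ℚ] D, (∀ i a, a ∈ Gr A i → g a ∈ Gr D i) ∧
      (∀ i, g (x i) = a i) ∧ ∀ j, g (y j) = b j := by
    intro D _ a b ha hb
    obtain ⟨g, hg, gv⟩ := hF.ex D (fun k => if h : Even (deg k) then a (e1 ⟨k, h⟩) else b (e2 ⟨k, h⟩))
      (fun k => by
        by_cases h : Even (deg k)
        · simp only [dif_pos h]
          have := ha (e1 ⟨k, h⟩)
          rwa [← hdx, e1.symm_apply_apply] at this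
        · simp only [dif_neg h]
          have := hb (e2 ⟨k, h⟩)
          rwa [← hdy, e2.symm_apply_apply] at this)
    refine ⟨g, hg, fun i => ?_, fun j => ?_⟩
    · simp only [x, gv, dif_pos (e1.symm i).2, Subtype.coe_eta, e1.apply_symm_apply]
    · simp only [y, gv, dif_neg (e2.symm j).2, Subtype.coe_eta, e2.apply_symm_apply]
  have hgen : Algebra.adjoin ℚ (Set.range x ∪ Set.range y) = ⊤ := hrange ▸ hF.gen
  have hlam1 : S.lam 1 = Submodule.span ℚ (Set.range x ∪ Set.range y) := hrange ▸ hlam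
  have xeven : ∀ i, x i ∈ S.Veven := fun i => by
    refine Submodule.mem_iSup_of_mem (dx i + 1) ?_
    have := hV (e1.symm i)
    rwa [hdx] at this
  have yodd : ∀ j, y j ∈ S.Vodd := fun j => by
    refine Submodule.mem_iSup_of_mem (dy j + 1) ?_
    have := hV (e2.symm j)
    rwa [hdy] at this
  have hVe : S.Veven ≤ Submodule.span ℚ (Set.range x) := iSup_le fun n a ha => by
    have h1 : a ∈ S.lam 1 := by rw [S.lam_one]; exact Submodule.mem_iSup_of_mem _ ha
    rw [hlam1] at h1
    have h2 : Submodule.span ℚ (Set.range x ∪ Set.range y) ≤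
        (Submodule.span ℚ (Set.range x)).comap (pr A (2 * n)) := by
      refine Submodule.span_le.2 ?_
      rintro _ (⟨i, rfl⟩ | ⟨j, rfl⟩)
      · exact homog_span (s := Set.range x) (fun b hb => by obtain ⟨i, rfl⟩ := hb; exact ⟨_, hx i⟩) (x i)
          (Submodule.subset_span ⟨i, rfl⟩) _
      · change pr A (2 * n) (y j) ∈ Submodule.span ℚ (Set.range x)
        rw [pr_ne (hy j) (by omega)]; exact zero_mem _
    have h3 := h2 h1
    change pr A (2 * n) a ∈ Submodule.span ℚ (Set.range x) at h3
    rwa [pr_same (S.V_le _ ha)] at h3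
  obtain ⟨π, -, πx, πy⟩ := hfree A x (fun _ => 0) hx (fun _ => zero_mem _)
  have πfix : ∀ a ∈ Algebra.adjoin ℚ (S.Veven : Set A), π a = a := fun a ha => by
    have h1 : Algebra.adjoin ℚ (S.Veven : Set A) ≤ AlgHom.equalizer π (AlgHom.id ℚ A) := by
      refine Algebra.adjoin_le fun b hb => ?_
      have h2 : Submodule.span ℚ (Set.range x) ≤ LinearMap.eqLocus π.toLinearMap LinearMap.id := by
        refine Submodule.span_le.2 ?_
        rintro _ ⟨i, rfl⟩
        exact πx i
      exact h2 (hVe hb)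
    exact h1 ha
  have hsq : ∀ j, Dd A (y j) ∈ Submodule.span ℚ (Set.range fun t : Fin p × Fin p => x t.1 * x t.2) := by
    intro j
    have h1 : Dd A (y j) ∈ S.lam 2 := hcof _ _ (hV _)
    rw [S.lam_eq_pow hgen hlam1 2, hlam1, sq] at h1
    have h2 := Submodule.mem_map_of_mem (f := π.toLinearMap) h1
    rw [AlgHom.toLinearMap_apply, πfix _ (hpure.2 _ (yodd j)), Submodule.map_mul,
      Submodule.map_span] at h2
    have h3 : Submodule.span ℚ (π.toLinearMap '' (Set.range x ∪ Set.range y)) ≤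
        Submodule.span ℚ (Set.range x) := by
      refine Submodule.span_le.2 ?_
      rintro _ ⟨_, ⟨i, rfl⟩ | ⟨j, rfl⟩, rfl⟩
      · rw [AlgHom.toLinearMap_apply, πx]; exact Submodule.subset_span ⟨i, rfl⟩
      · rw [AlgHom.toLinearMap_apply, πy]; exact zero_mem _
    have h4 := mul_le_mul' h3 h3 h2
    rw [Submodule.span_mul_span] at h4
    refine Submodule.span_mono ?_ h4
    rintro _ ⟨_, ⟨i, rfl⟩, _, ⟨i', rfl⟩, rfl⟩
    exact ⟨(i, i'), rfl⟩
  choose c hc using fun j => (Submodule.mem_span_range_iff_exists_fun ℚ).1 (hsq j)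
  have hxx : ∀ i i', x i * x i' = x i' * x i := fun i i' =>
    mul_comm_even (hx i) (by rw [Nat.not_odd_iff_even]; exact ⟨dx i + 1, by ring⟩) _
  let c' : Fin q → Fin p → Fin p → ℚ := fun j i i' => if dx i + dx i' = dy j then c j (i, i') else 0
  have hc' : ∀ j, Dd A (y j) = ∑ i, ∑ i', c' j i i' • (x i * x i') := fun j => by
    rw [← pr_same (d_gr (hy j)), ← hc, map_sum, Fintype.sum_prod_type]
    refine Finset.sum_congr rfl fun i _ => Finset.sum_congr rfl fun i' _ => ?_
    rw [map_smul]
    by_cases h : dx i + dx i' = dy j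
    · simp only [c', if_pos h]
      rw [pr_same]
      have := gr_mul (hx i) (hx i')
      rwa [show 2 * dx i + 2 + (2 * dx i' + 2) = 2 * dy j + 3 + 1 by omega] at this
    · simp only [c', if_neg h]
      rw [pr_ne (gr_mul (hx i) (hx i')) (by omega), smul_zero, zero_smul]
  have hc'' : ∀ j, Dd A (y j) = ∑ i, ∑ i', c' j i' i • (x i * x i') := fun j => by
    rw [hc', Finset.sum_comm]
    exact Finset.sum_congr rfl fun i _ => Finset.sum_congr rfl fun i' _ => by rw [hxx]
  refine ⟨p, q, x, y, dx, dy, fun j i i' => (1 / 2 : ℚ) * (c' j i i' + c' j i' i), ⟨hx, hy,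
    fun i => hpure.1 _ (xeven i), fun j => ?_, fun j i i' => by ring, fun j i i' h => ?_, hgen,
    hfree⟩, hlam1⟩
  · have : Dd A (y j) = (1 / 2 : ℚ) • (Dd A (y j) + Dd A (y j)) := by
      rw [← two_smul ℚ, smul_smul]; norm_num
    rw [this]
    nth_rewrite 1 [hc' j]
    rw [hc'' j, ← Finset.sum_add_distrib, Finset.smul_sum]
    refine Finset.sum_congr rfl fun i _ => ?_
    rw [← Finset.sum_add_distrib, Finset.smul_sum]
    exact Finset.sum_congr rfl fun i' _ => by rw [← add_smul, smul_smul]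
  · by_contra h2
    apply h
    simp only [c', if_neg h2, if_neg (fun h3 => h2 ((add_comm _ _).trans h3) : ¬ dx i' + dx i = dy j)]
    norm_num

section pres
variable {A : Type} [GCDGA A] {p q : ℕ} {x : Fin p → A} {y : Fin q → A} {dx : Fin p → ℕ}
  {dy : Fin q → ℕ} {β : Fin q → Fin p → Fin p → ℚ}

theorem Pres.nontrivial (h : Pres A x y dx dy β) : Nontrivial A := by
  obtain ⟨K, _, hK⟩ := exists_base
  obtain ⟨g, -⟩ := h.free K (fun _ => 0) (fun _ => 0) (fun _ => zero_mem _) (fun _ => zero_mem _)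
  refine ⟨0, 1, fun h1 => ?_⟩
  have h2 : algebraMap ℚ K 0 = algebraMap ℚ K 1 := by
    rw [map_zero, map_one, ← map_one g, ← h1, map_zero]
  exact zero_ne_one (hK.1 h2)

theorem Pres.comm (h : Pres A x y dx dy β) (i : Fin p) (a : A) : x i * a = a * x i :=
  mul_comm_even (h.hx i) (by rw [Nat.not_odd_iff_even]; exact ⟨dx i + 1, by ring⟩) _

theorem Pres.tower (h : Pres A x y dx dy β) : Tower A := by
  obtain ⟨K, _, hK⟩ := exists_base
  obtain ⟨H0, _, i0, w0, hi0, hw0, dw0, un0, ind0⟩ := exists_multi_hirsch K p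
    (fun i => 2 * dx i + 2) (fun _ => 0) (fun _ => zero_mem _) (fun _ => map_zero _)
  have dw0' : ∀ i, Dd H0 (w0 i) = 0 := fun i => by rw [dw0, map_zero]
  let z : Fin q → H0 := fun j => ∑ i, ∑ i', β j i i' • (w0 i * w0 i')
  have hz : ∀ j, z j ∈ Gr H0 (2 * dy j + 3 + 1) := fun j =>
    Submodule.sum_mem _ fun i _ => Submodule.sum_mem _ fun i' _ => by
      by_cases hb : β j i i' = 0
      · rw [hb, zero_smul]; exact zero_mem _
      · have h1 := gr_mul (hw0 i) (hw0 i')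
        have h2 := h.deg j i i' hb
        rw [show 2 * dx i + 2 + (2 * dx i' + 2) = 2 * dy j + 3 + 1 by omega] at h1
        exact Submodule.smul_mem _ _ h1
  have dz : ∀ j, Dd H0 (z j) = 0 := fun j => by
    simp only [z, map_sum, map_smul, d_mul, dw0', zero_mul, mul_zero, add_zero, smul_zero,
      Finset.sum_const_zero]
  obtain ⟨H, _, i1, w1, hi1, hw1, dw1, un1, ind1⟩ := exists_multi_hirsch H0 q
    (fun j => 2 * dy j + 3) z hz dz
  have gK : Algebra.adjoin ℚ (∅ : Set K) = ⊤ := by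
    rw [Algebra.adjoin_empty, eq_top_iff]
    intro a _
    obtain ⟨c, rfl⟩ := hK.2 a
    exact Subalgebra.algebraMap_mem _ c
  have g0 := multi_hirsch_gen gK ind0
  rw [Set.image_empty, Set.empty_union] at g0
  have g1 := multi_hirsch_gen g0 ind1
  rw [← Set.range_comp] at g1
  have t0 : Tower H0 := ind0 (fun C _ _ _ => Tower C) (Tower.base _ hK)
    fun C C' _ _ i s i' j w hC h' => Tower.step _ _ _ _ _ _ h' hC
  have t1 : Tower H := ind1 (fun C _ _ _ => Tower C) t0
    fun C C' _ _ i s i' j w hC h' => Tower.step _ _ _ _ _ _ h' hC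
  obtain ⟨u, hu⟩ := hK.exists_unit A
  obtain ⟨f0, hf0, -, f0x⟩ := un0 A u x hu h.hx (fun i => by rw [h.dx0, map_zero])
  obtain ⟨f, hf, f1, fy⟩ := un1 A f0 y hf0 h.hy (fun j => by
    simp only [h.dyj, z, map_sum, map_smul, map_mul, f0x])
  have fx : ∀ i, f (i1 (w0 i)) = x i := fun i => by rw [f1, f0x]
  obtain ⟨g, hg, gx, gy⟩ := h.free H (fun i => i1 (w0 i)) w1 (fun i => hi1.2 _ _ (hw0 i)) hw1
  have hgdga : IsDGAHom g := dga_of_gen h.gen (by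
    rintro _ (⟨i, rfl⟩ | ⟨j, rfl⟩)
    · exact ⟨_, h.hx i, by rw [gx]; exact hi1.2 _ _ (hw0 i)⟩
    · exact ⟨_, h.hy j, by rw [gy]; exact hw1 j⟩) (by
    rintro _ (⟨i, rfl⟩ | ⟨j, rfl⟩)
    · rw [h.dx0, gx, ← hi1.1, dw0', map_zero, map_zero]
    · rw [h.dyj, gy, dw1]
      simp only [z, map_sum, map_smul, map_mul, gx])
  have hfg : f.comp g = AlgHom.id ℚ A := AlgHom.ext_of_adjoin_eq_top h.gen (by
    rintro _ (⟨i, rfl⟩ | ⟨j, rfl⟩)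
    · change f (g (x i)) = x i
      rw [gx, fx]
    · change f (g (y j)) = y j
      rw [gy, fy])
  have hgf : g.comp f = AlgHom.id ℚ H := AlgHom.ext_of_adjoin_eq_top g1 (by
    rintro _ (⟨i, rfl⟩ | ⟨j, rfl⟩)
    · change g (f (i1 (w0 i))) = i1 (w0 i)
      rw [fx, gx]
    · change g (f (w1 j)) = w1 j
      rw [fy, gy])
  exact Tower.iso H A f g hf hgdga (DFunLike.congr_fun hfg) (DFunLike.congr_fun hgf) t1

end pres

theorem bdd_of_finite {A : Type} [GCDGA A] (hfd : FiniteDimensional ℚ (CohClasses A)) : Bdd A := by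
  obtain ⟨s, hs⟩ := hfd.fg_top
  let R := (LinearMap.range (Dd A)).comap (LinearMap.ker (Dd A)).subtype
  have hsur : ∀ c : CohClasses A, ∃ a : LinearMap.ker (Dd A), R.mkQ a = c := R.mkQ_surjective
  choose l hl using hsur
  choose N hN using fun a : A => pr_finite a
  refine ⟨s.sup fun c => N (l c), fun n hn x hx dx => ?_⟩
  let P : Submodule ℚ (CohClasses A) := Submodule.map R.mkQ
    ((LinearMap.range (Dd A)).comap (pr A n ∘ₗ (LinearMap.ker (Dd A)).subtype))
  have h1 : Submodule.span ℚ (s : Set (CohClasses A)) ≤ P := Submodule.span_le.2 fun c hc => by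
    refine ⟨l c, ?_, hl c⟩
    change pr A n (l c) ∈ LinearMap.range (Dd A)
    rw [hN _ n (lt_of_le_of_lt (Finset.le_sup (f := fun c => N (l c)) hc) hn)]
    exact zero_mem _
  rw [hs] at h1
  obtain ⟨b, hb, hbx⟩ := h1 (Submodule.mem_top (x := R.mkQ ⟨x, dx⟩))
  have h2 : (b - ⟨x, dx⟩ : LinearMap.ker (Dd A)) ∈ R := (Submodule.Quotient.eq R).1 hbx
  have h3 : (b : A) - x ∈ LinearMap.range (Dd A) := h2
  have h4 := homog_range_d _ h3 n
  rw [map_sub, pr_same hx] at h4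
  have h5 : pr A n (b : A) ∈ LinearMap.range (Dd A) := hb
  obtain ⟨y, hy⟩ := (sub_mem h5 h4 : pr A n (b : A) - (pr A n (b : A) - x) ∈ _)
  exact ⟨y, by rw [hy, sub_sub_cancel]⟩

/-- A word-length filtration adapted to a presentation. -/
structure WordLength (A : Type) [GCDGA A] (lam : ℕ → Submodule ℚ A) : Prop where
  zero : lam 0 = 1
  pow : ∀ k, lam k = lam 1 ^ k
  homog : ∀ k, Homog (lam k)
  ge : ∀ k, lam k ≤ Ge A (2 * k)
  d_mem : ∀ k a, a ∈ lam k → Dd A a ∈ lam (k + 1)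
  proj : ∃ w : ℕ → A →ₗ[ℚ] A, (∀ k a, w k a ∈ lam k) ∧
    (∀ k a, a ∈ lam k → w k a = a) ∧ (∀ k l a, a ∈ lam k → k ≠ l → w l a = 0) ∧
    ∀ (P : Submodule ℚ A) a, (∀ k, w k a ∈ P) → a ∈ P

theorem MinimalSullivan.wordLength {A : Type} [GCDGA A] (S : MinimalSullivan A) (hcof : S.Coformal)
    {p q : ℕ} {x : Fin p → A} {y : Fin q → A} {dx : Fin p → ℕ}
    {dy : Fin q → ℕ} {β : Fin q → Fin p → Fin p → ℚ} (h : Pres A x y dx dy β)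
    (hlam : S.lam 1 = Submodule.span ℚ (Set.range x ∪ Set.range y)) : WordLength A S.lam := by
  have hpow := S.lam_eq_pow h.gen hlam
  have hom1 : Homog (S.lam 1) := by
    rw [hlam]
    refine homog_span ?_
    rintro _ (⟨i, rfl⟩ | ⟨j, rfl⟩)
    exacts [⟨_, h.hx i⟩, ⟨_, h.hy j⟩]
  have hhom : ∀ k, Homog (S.lam k) := fun k => by rw [hpow]; exact hom1.pow k
  have hge1 : S.lam 1 ≤ Ge A 2 := by
    rw [hlam]
    refine Submodule.span_le.2 ?_
    rintro _ (⟨i, rfl⟩ | ⟨j, rfl⟩)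
    exacts [gr_le_ge (by omega) (h.hx i), gr_le_ge (by omega) (h.hy j)]
  refine ⟨S.lam_zero, hpow, hhom, fun k => ?_, fun k => ?_, S.exists_wp⟩
  · rw [hpow, mul_comm]
    exact (pow_le_pow_left' hge1 k).trans (ge_pow 2 k)
  · have hd1 : ∀ a ∈ S.lam 1, Dd A a ∈ S.lam 2 := fun a ha => by
      rw [S.lam_one] at ha
      exact (iSup_le fun n v hv => hcof n v hv : (⨆ n, S.V n) ≤ (S.lam 2).comap (Dd A)) ha
    induction k with
    | zero =>
      intro a ha
      rw [S.lam_zero] at ha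
      obtain ⟨c, rfl⟩ := Submodule.mem_one.1 ha
      rw [d_algebraMap]; exact zero_mem _
    | succ k ih =>
      rw [hpow (k + 1), pow_succ, ← hpow k]
      intro a ha
      refine (Submodule.mul_le.2 fun u hu v hv => ?_ :
        S.lam k * S.lam 1 ≤ (S.lam (k + 1 + 1)).comap (Dd A)) ha
      change Dd A (u * v) ∈ S.lam (k + 1 + 1)
      rw [d_mul]
      exact add_mem (S.lam_mul (k + 1) 1 (Submodule.mul_mem_mul (ih u hu) hv))
        (S.lam_mul k 2 (Submodule.mul_mem_mul ((hhom k).sc_mem _ hu) (hd1 v hv)))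

namespace WordLength
variable {A : Type} [GCDGA A] {lam : ℕ → Submodule ℚ A}

theorem mem (h : WordLength A lam) {P : Submodule ℚ A} (hP : ∀ k, lam k ≤ P) (a : A) : a ∈ P := by
  obtain ⟨w, h1, -, -, h4⟩ := h.proj
  exact h4 P a fun k => hP k (h1 k a)

theorem mul (h : WordLength A lam) (k l : ℕ) : lam k * lam l ≤ lam (k + l) := by
  rw [h.pow k, h.pow l, h.pow (k + l), pow_add]

theorem conn (h : WordLength A lam) : Conn A := fun x hx => by
  have h1 : x ∈ (1 : Submodule ℚ A).comap (pr A 0) := h.mem (fun k a ha => by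
    change pr A 0 a ∈ (1 : Submodule ℚ A)
    rcases Nat.eq_zero_or_pos k with rfl | hk
    · rw [h.zero] at ha
      exact homog_one _ ha _
    · rw [h.ge k ha 0 (by omega)]; exact zero_mem _) x
  change pr A 0 x ∈ (1 : Submodule ℚ A) at h1
  rw [pr_same hx] at h1
  obtain ⟨c, hc⟩ := Submodule.mem_one.1 h1
  exact ⟨c, hc.symm⟩

theorem exists_max (h : WordLength A lam) (hA : Nontrivial A) (hb : Bdd A) : ∃ m,
    (∃ η ∈ lam m, Dd A η = 0 ∧ ∀ a, η ≠ Dd A a) ∧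
    ∀ a, Dd A a = 0 → a ∈ (⨆ k, ⨆ (_ : m < k), lam k) → ∃ b ∈ ⨆ k, ⨆ (_ : m ≤ k), lam k, a = Dd A b := by
  classical
  obtain ⟨N, hN⟩ := hb
  let Q : ℕ → Prop := fun k => ∃ η ∈ lam k, Dd A η = 0 ∧ ∀ a, η ≠ Dd A a
  have hQ0 : Q 0 := ⟨1, by rw [h.zero]; exact Submodule.one_le.1 le_rfl, d_one, fun a ha => by
    have := pr_zero_d a
    rw [← ha, pr_same gr_one] at this
    exact one_ne_zero this⟩
  have hQN : ∀ k, N < k → ¬ Q k := by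
    rintro k hk ⟨η, hη, dη, hne⟩
    have h1 : η ∈ LinearMap.range (Dd A) := mem_of_pr fun n => by
      by_cases hn : n < 2 * k
      · rw [h.ge k hη n hn]; exact zero_mem _
      · obtain ⟨y, hy⟩ := hN n (by omega) (pr A n η) (pr_mem n η)
          (by rw [← pr_d, dη, map_zero])
        exact ⟨y, hy.symm⟩
    obtain ⟨b, hb⟩ := h1
    exact hne b hb.symm
  obtain ⟨w, w1, w2, w3, w4⟩ := h.proj
  have wd : ∀ k a, w (k + 1) (Dd A a) = Dd A (w k a) := fun k a => by
    refine sub_eq_zero.1 (h.mem (P := LinearMap.ker (w (k + 1) ∘ₗ Dd A - Dd A ∘ₗ w k)) (fun l b hb => ?_) a)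
    change w (k + 1) (Dd A b) - Dd A (w k b) = 0
    by_cases hl : l = k
    · subst hl
      rw [w2 _ _ hb, w2 _ _ (h.d_mem _ _ hb), sub_self]
    · rw [w3 l k b hb hl, w3 (l + 1) (k + 1) _ (h.d_mem _ _ hb) (by omega), map_zero, sub_zero]
  refine ⟨Nat.findGreatest Q N, Nat.findGreatest_spec (Nat.zero_le _) hQ0, fun a da ha => ?_⟩
  set m := Nat.findGreatest Q N
  have h1 : a ∈ Submodule.map (Dd A) (⨆ k, ⨆ (_ : m ≤ k), lam k) := w4 _ _ fun k => by
    by_cases hk : m < k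
    · have hnQ : ¬ Q k := fun hQk => by
        by_cases hkN : N < k
        · exact hQN k hkN hQk
        · exact absurd (Nat.le_findGreatest (not_lt.1 hkN) hQk) (not_le.2 hk)
      have hd : Dd A (w k a) = 0 := by rw [← wd, da, map_zero]
      have h2 : ∃ b, w k a = Dd A b := by
        by_contra hcon
        exact hnQ ⟨w k a, w1 k a, hd, fun b hb => hcon ⟨b, hb⟩⟩
      obtain ⟨b, hb⟩ := h2
      obtain ⟨k, rfl⟩ : ∃ k', k = k' + 1 := ⟨k - 1, by omega⟩
      refine ⟨w k b, ?_, ?_⟩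
      · exact (le_iSup₂_of_le k (by omega) le_rfl : lam k ≤ ⨆ k, ⨆ (_ : m ≤ k), lam k) (w1 k b)
      · rw [← wd, ← hb, w2 _ _ (w1 _ _)]
    · have h2 : (⨆ k, ⨆ (_ : m < k), lam k) ≤ LinearMap.ker (w k) :=
        iSup₂_le fun l hl b hb => w3 l k b hb (by omega)
      rw [show w k a = 0 from h2 ha]
      exact zero_mem _
  obtain ⟨b, hb, rfl⟩ := h1
  exact ⟨b, hb, rfl⟩

end WordLength

namespace IsHirsch
variable {B B' : Type} [GCDGA B] [GCDGA B'] {i : B →ₐ[ℚ] B'} {k : ℕ} {w : B'} {z : B}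

theorem odd_d (h : IsHirsch B B' i k w z) (u v : B) :
    Dd B' (i u + i v * w) = i (Dd B u + sg B v * z) + i (Dd B v) * w := by
  rw [map_add, ← h.dga.1, d_mul, ← h.dga.1, h.dw, ← h.dga.sc, map_add, map_mul i]
  abel

theorem odd_mul (h : IsHirsch B B' i k w z) (hk : Odd k) (u v u' v' : B) :
    (i u + i v * w) * (i u' + i v' * w) = i (u * u') + i (u * v' + v * sg B u') * w := by
  have e : ∀ c, w * i c = i (sg B c) * w := fun c => by rw [mul_comm_odd h.hw hk, ← h.dga.sc]
  rw [add_mul, mul_add, mul_add, mul_assoc (i v), mul_assoc (i v), ← mul_assoc w, e, e,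
    mul_assoc (i (sg B v')), odd_sq h.hw hk]
  simp only [map_add, map_mul i, add_mul, mul_assoc, mul_zero, add_zero]
  abel

theorem odd_sg (h : IsHirsch B B' i k w z) (hk : Odd k) (u v : B) :
    sg B' (i u + i v * w) = i (sg B u) + i (- sg B v) * w := by
  rw [map_add, map_mul (sg B'), ← h.dga.sc, ← h.dga.sc, sg_hom h.hw, hk.neg_one_pow, neg_one_smul, map_neg]
  simp

end IsHirsch

/-- An iterated odd extension `C` of `A` with its top coefficient `t`, together with a
multiplicative family of submodules. -/
structure Bar (A C : Type) [GCDGA A] [GCDGA C] (i : A →ₐ[ℚ] C) {n : ℕ} (b : Fin n → C) (t : C →ₗ[ℚ] A)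
    (k : Fin n → ℕ) (x : Fin n → A) (L : ℕ → Submodule ℚ A) (N : ℕ → Submodule ℚ C) : Prop where
  dga : IsDGAHom i
  hb : ∀ j, b j ∈ Gr C (2 * k j + 1)
  db : ∀ j, Dd C (b j) = i (x j)
  td : ∀ c, t (Dd C c) = Dd A (t c)
  mul : ∀ m l a c, a ∈ N m → c ∈ N l → a * c ∈ N (m + l)
  sgN : ∀ m a, a ∈ N m → sg C a ∈ N m
  iN : ∀ m a, a ∈ L m → i a ∈ N m
  one : 1 ∈ N 0
  bN : ∀ j, b j ∈ N 0
  tN : ∀ m a, a ∈ N m → t a ∈ L m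

theorem Bar.step {A C C' : Type} [GCDGA A] [GCDGA C] [GCDGA C'] {i : A →ₐ[ℚ] C} {n : ℕ} {b : Fin n → C}
    {t : C →ₗ[ℚ] A} {k : Fin (n + 1) → ℕ} {x : Fin (n + 1) → A} {L : ℕ → Submodule ℚ A}
    {N : ℕ → Submodule ℚ C} (h : Bar A C i b t (fun j => k j.succ) (fun j => x j.succ) L N)
    {i' : C →ₐ[ℚ] C'} {w : C'} (h' : IsHirsch C C' i' (2 * k 0 + 1) w (i (x 0)))
    {bt tp : C' →ₗ[ℚ] C} (hbi : ∀ b, bt (i' b) = b) (hbw : ∀ b, bt (i' b * w) = 0)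
    (hti : ∀ b, tp (i' b) = 0) (htw : ∀ b, tp (i' b * w) = b) (hx : ∀ x, x = i' (bt x) + i' (tp x) * w) :
    Bar A C' (i'.comp i) (Fin.cons w fun j => i' (b j)) (t ∘ₗ tp) k x L
      (fun m => (N m).comap bt ⊓ (N m).comap tp) := by
  have hk : Odd (2 * k 0 + 1) := ⟨_, rfl⟩
  have hb' : ∀ u v, bt (i' u + i' v * w) = u := fun u v => by rw [map_add, hbi, hbw, add_zero]
  have ht' : ∀ u v, tp (i' u + i' v * w) = v := fun u v => by rw [map_add, hti, htw, zero_add]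
  refine ⟨h.dga.comp h'.dga, ?_, ?_, fun c => ?_, fun m l a c ha hc => ?_, fun m a ha => ?_,
    fun m a ha => ?_, ?_, ?_, fun m a ha => h.tN _ _ ha.2⟩
  · refine Fin.cases h'.hw fun j => ?_
    exact h'.dga.2 _ _ (h.hb j)
  · refine Fin.cases h'.dw fun j => ?_
    simp only [Fin.cons_succ]
    rw [← h'.dga.1, h.db]; rfl
  · change t (tp (Dd C' c)) = Dd A (t (tp c))
    rw [hx c, h'.odd_d, ht', ht', h.td]
  · rw [hx a, hx c, h'.odd_mul hk]
    constructor
    · change bt _ ∈ N (m + l)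
      rw [hb']
      exact h.mul _ _ _ _ ha.1 hc.1
    · change tp _ ∈ N (m + l)
      rw [ht']
      exact add_mem (h.mul _ _ _ _ ha.1 hc.2) (h.mul _ _ _ _ ha.2 (h.sgN _ _ hc.1))
  · rw [hx a, h'.odd_sg hk]
    constructor
    · change bt _ ∈ N m
      rw [hb']; exact h.sgN _ _ ha.1
    · change tp _ ∈ N m
      rw [ht']; exact neg_mem (h.sgN _ _ ha.2)
  · constructor
    · change bt (i' (i a)) ∈ N m
      rw [hbi]; exact h.iN _ _ ha
    · change tp (i' (i a)) ∈ N m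
      rw [hti]; exact zero_mem _
  · constructor
    · change bt 1 ∈ N 0
      rw [← map_one i', hbi]; exact h.one
    · change tp 1 ∈ N 0
      rw [← map_one i', hti]; exact zero_mem _
  · refine Fin.cases ?_ fun j => ?_
    · have e : w = i' 1 * w := by rw [map_one, one_mul]
      simp only [Fin.cons_zero]
      constructor
      · change bt w ∈ N 0
        rw [e, hbw]; exact zero_mem _
      · change tp w ∈ N 0
        rw [e, htw]; exact h.one
    · simp only [Fin.cons_succ]
      constructor
      · change bt (i' (b j)) ∈ N 0
        rw [hbi]; exact h.bN j
      · change tp (i' (b j)) ∈ N 0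
        rw [hti]; exact zero_mem _

/-- Submodules `G` and `G'` for which the Koszul process of extending cocycles works. -/
structure KosPair (A C : Type) [GCDGA A] [GCDGA C] (i : A →ₐ[ℚ] C) (X : Set A) (G G' : Submodule ℚ C) :
    Prop where
  sgG : ∀ a ∈ G, sg C a ∈ G
  ex : ∀ a ∈ G', Dd C a = 0 → ∃ b ∈ G, a = Dd C b
  mul : ∀ a ∈ G, ∀ x ∈ X, a * i x ∈ G'

theorem KosPair.step {A C C' : Type} [GCDGA A] [GCDGA C] [GCDGA C'] {i : A →ₐ[ℚ] C} {X : Set A}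
    {G G' : Submodule ℚ C} (h : KosPair A C i X G G') (hX : ∀ x ∈ X, sg A x = x) {k : ℕ} {x : A}
    (hxX : x ∈ X) (hi : IsDGAHom i)
    {i' : C →ₐ[ℚ] C'} {w : C'} (h' : IsHirsch C C' i' (2 * k + 1) w (i x))
    {bt tp : C' →ₗ[ℚ] C} (hbi : ∀ b, bt (i' b) = b) (hbw : ∀ b, bt (i' b * w) = 0)
    (hti : ∀ b, tp (i' b) = 0) (htw : ∀ b, tp (i' b * w) = b) (hx : ∀ x, x = i' (bt x) + i' (tp x) * w) :
    KosPair A C' (i'.comp i) X (G.comap bt ⊓ G.comap tp) (G'.comap bt ⊓ G'.comap tp) ∧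
    ∀ η ∈ G, Dd C η = 0 → ∃ η' ∈ G.comap bt ⊓ G.comap tp, Dd C' η' = 0 ∧ tp η' = η := by
  have hk : Odd (2 * k + 1) := ⟨_, rfl⟩
  have hb' : ∀ u v, bt (i' u + i' v * w) = u := fun u v => by rw [map_add, hbi, hbw, add_zero]
  have ht' : ∀ u v, tp (i' u + i' v * w) = v := fun u v => by rw [map_add, hti, htw, zero_add]
  have mk : ∀ (H : Submodule ℚ C) u v, u ∈ H → v ∈ H → i' u + i' v * w ∈ H.comap bt ⊓ H.comap tp :=
    fun H u v hu hv => ⟨by change bt _ ∈ H; rw [hb']; exact hu, by change tp _ ∈ H; rw [ht']; exact hv⟩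
  refine ⟨⟨fun a ha => ?_, fun a ha da => ?_, fun a ha y hy => ?_⟩, fun η hη dη => ?_⟩
  · rw [hx a, h'.odd_sg hk]
    exact mk G _ _ (h.sgG _ ha.1) (neg_mem (h.sgG _ ha.2))
  · have d1 : Dd C (bt a) + sg C (tp a) * i x = 0 := by
      have := congrArg bt da
      rwa [hx a, h'.odd_d, hb', map_zero]  at this
    have d2 : Dd C (tp a) = 0 := by
      have := congrArg tp da
      rwa [hx a, h'.odd_d, ht', map_zero] at this
    obtain ⟨θ, hθ, e⟩ := h.ex _ ha.2 d2
    obtain ⟨θ', hθ', e'⟩ := h.ex (bt a - sg C θ * i x)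
      (sub_mem ha.1 (h.mul _ (h.sgG _ hθ) _ hxX)) (by
        rw [map_sub, d_mul, h'.dz, mul_zero, add_zero]
        have : Dd C (sg C θ) = - sg C (tp a) := by rw [e, sg_d, neg_neg]
        rw [this, neg_mul, sub_neg_eq_add]; exact d1)
    refine ⟨i' θ' + i' θ * w, mk G _ _ hθ' hθ, ?_⟩
    rw [h'.odd_d, ← e', ← e, sub_add_cancel]
    exact hx a
  · have : i' (i y) = i' (i y) + i' 0 * w := by rw [map_zero, zero_mul, add_zero]
    change a * i' (i y) ∈ _
    rw [hx a, this, h'.odd_mul hk, ← hi.sc, hX _ hy, mul_zero, zero_add]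
    exact mk G' _ _ (h.mul _ ha.1 _ hy) (h.mul _ ha.2 _ hy)
  · obtain ⟨θ, hθ, e⟩ := h.ex (sg C η * i x) (h.mul _ (h.sgG _ hη) _ hxX) (by
      have : Dd C (sg C η) = 0 := by
        rw [← neg_neg (Dd C (sg C η)), ← sg_d, dη, map_zero, neg_zero]
      rw [d_mul, h'.dz, mul_zero, add_zero, this, zero_mul])
    refine ⟨i' (-θ) + i' η * w, mk G _ _ (neg_mem hθ) hη, ?_, ht' _ _⟩
    rw [h'.odd_d, dη, map_neg, ← e]; simp

theorem exists_bars {A T : Type} [GCDGA A] [GCDGA T] {ε : T →ₐ[ℚ] A} (hε : IsDGAHom ε) {X : Set A}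
    (hX : ∀ x ∈ X, sg A x = x) {L : ℕ → Submodule ℚ A} {L2 : ℕ → Submodule ℚ T}
    (hL : Bar A A (AlgHom.id ℚ A) (Fin.elim0 : Fin 0 → A) LinearMap.id Fin.elim0 Fin.elim0 L L)
    (hL2 : Bar T T (AlgHom.id ℚ T) (Fin.elim0 : Fin 0 → T) LinearMap.id Fin.elim0 Fin.elim0 L2 L2)
    {G G' : Submodule ℚ A} (hG : KosPair A A (AlgHom.id ℚ A) X G G') {η : A} (hη : η ∈ G)
    (dη : Dd A η = 0) (n : ℕ) (k : Fin n → ℕ) (x : Fin n → A) (w : Fin n → T)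
    (hx : ∀ j, x j ∈ Gr A (2 * k j + 2)) (hxX : ∀ j, x j ∈ X) (hw : ∀ j, w j ∈ Gr T (2 * k j + 2))
    (dx : ∀ j, Dd A (x j) = 0) (dw : ∀ j, Dd T (w j) = 0) (hwx : ∀ j, ε (w j) = x j) :
    ∃ (B B2 : Type) (_ : GCDGA B) (_ : GCDGA B2) (i : A →ₐ[ℚ] B) (i2 : T →ₐ[ℚ] B2) (ψ : B2 →ₐ[ℚ] B)
      (b : Fin n → B) (b2 : Fin n → B2) (t : B →ₗ[ℚ] A) (t2 : B2 →ₗ[ℚ] T) (N : ℕ → Submodule ℚ B)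
      (N2 : ℕ → Submodule ℚ B2) (H H' : Submodule ℚ B) (η' : B), Bar A B i b t k x L N ∧
      Bar T B2 i2 b2 t2 k w L2 N2 ∧ IsDGAHom ψ ∧ (∀ a, ψ (i2 a) = i (ε a)) ∧ (∀ j, ψ (b2 j) = b j) ∧
      (∀ c, t (ψ c) = ε (t2 c)) ∧ KosPair A B i X H H' ∧ η' ∈ H ∧ Dd B η' = 0 ∧ t η' = η ∧
      (∀ (D : Type) [GCDGA D] (f : A →ₐ[ℚ] D) (c : Fin n → D), IsDGAHom f →
        (∀ j, c j ∈ Gr D (2 * k j + 1)) → (∀ j, Dd D (c j) = f (x j)) →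
        ∃ g : B →ₐ[ℚ] D, IsDGAHom g ∧ (∀ a, g (i a) = f a) ∧ ∀ j, g (b j) = c j) ∧
      ∀ s : Set A, Algebra.adjoin ℚ s = ⊤ → Algebra.adjoin ℚ (i '' s ∪ Set.range b) = ⊤ := by
  induction n with
  | zero =>
    refine ⟨A, T, inferInstance, inferInstance, AlgHom.id ℚ A, AlgHom.id ℚ T, ε, Fin.elim0, Fin.elim0,
      LinearMap.id, LinearMap.id, L, L2, G, G', η, ?_, ?_, hε, fun _ => rfl, fun j => j.elim0,
      fun _ => rfl, hG, hη, dη, rfl, fun D _ f c hf _ _ => ⟨f, hf, fun _ => rfl, fun j => j.elim0⟩,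
      fun s hs => by simpa using hs⟩
    · rw [Subsingleton.elim k Fin.elim0, Subsingleton.elim x Fin.elim0]; exact hL
    · rw [Subsingleton.elim k Fin.elim0, Subsingleton.elim w Fin.elim0]; exact hL2
  | succ n ih =>
    obtain ⟨B, B2, _, _, i, i2, ψ, b, b2, t, t2, N, N2, H, H', η', hB, hB2, hψ, e1, e2, e3, hH, hη', dη',
      tη', un, gen⟩ := ih (fun j => k j.succ) (fun j => x j.succ) (fun j => w j.succ) (fun _ => hx _)
      (fun _ => hxX _) (fun _ => hw _) (fun _ => dx _) (fun _ => dw _) (fun _ => hwx _)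
    have hk : Odd (2 * k 0 + 1) := ⟨_, rfl⟩
    obtain ⟨C, _, j, u, h⟩ := exists_hirsch B (2 * k 0 + 1) (i (x 0)) (hB.dga.2 _ _ (hx 0))
      (by rw [← hB.dga.1, dx, map_zero])
    obtain ⟨C2, _, j2, u2, h2⟩ := exists_hirsch B2 (2 * k 0 + 1) (i2 (w 0)) (hB2.dga.2 _ _ (hw 0))
      (by rw [← hB2.dga.1, dw, map_zero])
    obtain ⟨ψ', hψ', f1, f2⟩ := h2.univ (j.comp ψ) (hψ.comp h.dga) (c := u) h.hw
      (by rw [h.dw, ← hwx, ← e1]; rfl)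
    obtain ⟨bt, tp, c1, c2, c3, c4, c5⟩ := h.coeffs hk
    obtain ⟨bt2, tp2, c1', c2', c3', c4', c5'⟩ := h2.coeffs hk
    obtain ⟨hK, hKη⟩ := hH.step hX (hxX 0) hB.dga h c1 c2 c3 c4 c5
    obtain ⟨η'', hη'', dη'', tη''⟩ := hKη η' hη' dη'
    have f1' : ∀ a, ψ' (j2 a) = j (ψ a) := fun a => DFunLike.congr_fun f1 a
    refine ⟨C, C2, inferInstance, inferInstance, j.comp i, j2.comp i2, ψ', _, _, _, _, _, _, _, _, η'',
      hB.step h c1 c2 c3 c4 c5, hB2.step h2 c1' c2' c3' c4' c5', hψ', fun a => ?_, ?_, fun c => ?_, hK,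
      hη'', dη'', ?_, fun D _ f c hf hc dc => ?_, fun s hs => ?_⟩
    · change ψ' (j2 (i2 a)) = j (i (ε a))
      rw [f1', e1]
    · refine Fin.cases f2 fun m => ?_
      simp only [Fin.cons_succ]
      rw [f1', e2]
    · change t (tp (ψ' c)) = ε (t2 (tp2 c))
      rw [c5' c, map_add, map_mul ψ', f1', f1', f2, map_add, c3, c4, zero_add, ← c5', e3]
    · change t (tp η'') = η
      rw [tη'', tη']
    · obtain ⟨g, hg, g1, g2⟩ := un D f (fun m => c m.succ) hf (fun _ => hc _) (fun _ => dc _)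
      obtain ⟨g', hg', g1', g2'⟩ := h.univ g hg (hc 0) (by rw [dc, g1])
      refine ⟨g', hg', fun a => ?_, ?_⟩
      · rw [← g1]; exact DFunLike.congr_fun g1' _
      · refine Fin.cases g2' fun m => ?_
        rw [← g2]; exact DFunLike.congr_fun g1' _
    · rw [← h.adjoin (gen s hs), Fin.range_cons, Set.range_comp' j b]
      congr 1
      ext a
      simp only [Set.mem_union, Set.mem_image, Set.mem_insert_iff, AlgHom.comp_apply,
        Set.mem_singleton_iff]
      constructor
      · rintro (⟨a, ha, rfl⟩ | rfl | ⟨a, ha, rfl⟩)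
        exacts [Or.inl ⟨_, Or.inl ⟨a, ha, rfl⟩, rfl⟩, Or.inr rfl, Or.inl ⟨a, Or.inr ha, rfl⟩]
      · rintro (⟨_, ⟨a, ha, rfl⟩ | ha, rfl⟩ | rfl)
        exacts [Or.inl ⟨a, ha, rfl⟩, Or.inr (Or.inr ⟨_, ha, rfl⟩), Or.inr (Or.inl rfl)]

/-- A contractible extension of the base field. -/
theorem exists_pairs (n : ℕ) (k : Fin n → ℕ) : ∃ (E : Type) (_ : GCDGA E) (b : Fin n → E),
    (∀ j, b j ∈ Gr E (2 * k j + 1)) ∧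
    (∀ (D : Type) [GCDGA D] (c : Fin n → D), (∀ j, c j ∈ Gr D (2 * k j + 1)) →
      ∃ g : E →ₐ[ℚ] D, IsDGAHom g ∧ ∀ j, g (b j) = c j) ∧
    ∀ x : E, Dd E x = 0 → ∃ (c : ℚ) (u : E), x = algebraMap ℚ E c + Dd E u := by
  induction n with
  | zero =>
    obtain ⟨K, _, hK⟩ := exists_base
    refine ⟨K, inferInstance, Fin.elim0, fun j => j.elim0, fun D _ c _ => ?_, fun x _ => ?_⟩
    · obtain ⟨u, hu⟩ := hK.exists_unit D
      exact ⟨u, hu, fun j => j.elim0⟩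
    · obtain ⟨c, rfl⟩ := hK.2 x
      exact ⟨c, 0, by rw [map_zero, add_zero]⟩
  | succ n ih =>
    obtain ⟨E, _, b, hb, un, hE⟩ := ih fun j => k j.succ
    obtain ⟨E1, _, i1, y, h1⟩ := exists_hirsch E (2 * k 0 + 1 + 1) 0 (zero_mem _) (map_zero _)
    obtain ⟨E2, _, i2, w, h2⟩ := exists_hirsch E1 (2 * k 0 + 1) y h1.hw (by rw [h1.dw, map_zero])
    obtain ⟨p, hp, -, -, -, hc⟩ := contract h1 h2
    refine ⟨E2, inferInstance, Fin.cons w fun j => i2 (i1 (b j)), ?_, fun D _ c hcD => ?_, fun x hx => ?_⟩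
    · refine Fin.cases h2.hw fun j => ?_
      exact h2.dga.2 _ _ (h1.dga.2 _ _ (hb j))
    · obtain ⟨g, hg, gb⟩ := un D (fun j => c j.succ) fun _ => hcD _
      obtain ⟨g1, hg1, e1, e1'⟩ := h1.univ g hg (c := Dd D (c 0)) (d_gr (hcD 0))
        (by rw [d_d, map_zero])
      obtain ⟨g2, hg2, e2, e2'⟩ := h2.univ g1 hg1 (hcD 0) e1'.symm
      refine ⟨g2, hg2, Fin.cases e2' fun j => ?_⟩
      simp only [Fin.cons_succ]
      rw [← gb]
      exact (DFunLike.congr_fun e2 _).trans (DFunLike.congr_fun e1 _)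
    · obtain ⟨u, hu⟩ := hc x hx
      obtain ⟨c, v, hv⟩ := hE (p x) (by rw [← hp.1, hx, map_zero])
      refine ⟨c, i2 (i1 v) + u, ?_⟩
      rw [map_add, ← h2.dga.1, ← h1.dga.1, ← add_assoc, ← AlgHom.commutes i2, ← AlgHom.commutes i1,
        ← map_add, ← map_add, ← hv]
      exact hu

theorem adjoin_cocycles {C C' : Type} [GCDGA C] [GCDGA C'] {i : C →ₐ[ℚ] C'} {k : ℕ} {u : C'}
    (h : IsHirsch C C' i k u 0) (hk : Odd k) {s : Set C}
    (hs : ∀ x, Dd C x = 0 → ∃ a ∈ Algebra.adjoin ℚ s, ∃ v, x = a + Dd C v) (x : C') (dx : Dd C' x = 0) :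
    ∃ a ∈ Algebra.adjoin ℚ (insert u (i '' s)), ∃ v, x = a + Dd C' v := by
  obtain ⟨bt, tp, c1, c2, c3, c4, c5⟩ := h.coeffs hk
  have hx := c5 x
  have d1 : i (Dd C (bt x)) + i (Dd C (tp x)) * u = 0 := by
    rw [hx, h.odd_d, mul_zero, add_zero] at dx; exact dx
  have d2 : Dd C (bt x) = 0 := by
    have := congrArg bt d1
    rwa [map_add, c1, c2, add_zero, map_zero] at this
  have d3 : Dd C (tp x) = 0 := by
    have := congrArg tp d1
    rwa [map_add, c3, c4, zero_add, map_zero] at this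
  obtain ⟨a, ha, v, hv⟩ := hs _ d2
  obtain ⟨a', ha', v', hv'⟩ := hs _ d3
  have hi : ∀ a ∈ Algebra.adjoin ℚ s, i a ∈ Algebra.adjoin ℚ (insert u (i '' s)) := fun a ha => by
    have h1 : i a ∈ (Algebra.adjoin ℚ s).map i := ⟨a, ha, rfl⟩
    rw [AlgHom.map_adjoin] at h1
    exact Algebra.adjoin_mono (Set.subset_insert _ _) h1
  refine ⟨i a + i a' * u, add_mem (hi _ ha) (mul_mem (hi _ ha')
    (Algebra.subset_adjoin (Set.mem_insert _ _))), i v + i v' * u, ?_⟩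
  rw [h.odd_d, mul_zero, add_zero]
  conv_lhs => rw [hx, hv, hv']
  rw [map_add, map_add, add_mul]
  abel

section pres
variable {A : Type} [GCDGA A] {p q : ℕ} {x : Fin p → A} {y : Fin q → A} {dx : Fin p → ℕ}
  {dy : Fin q → ℕ} {β : Fin q → Fin p → Fin p → ℚ}

/-- The canonical primitive of the quadratic part. -/
def Pres.prim (_ : Pres A x y dx dy β) (D : Type) [GCDGA D] (c : Fin p → D) (j : Fin q) : D :=
  ∑ l, ∑ l', β j l l' • (Dd D (c l') * c l)

theorem Pres.prim_gr (h : Pres A x y dx dy β) {D : Type} [GCDGA D] {c : Fin p → D}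
    (hc : ∀ l, c l ∈ Gr D (2 * dx l + 1)) (j : Fin q) : h.prim D c j ∈ Gr D (2 * dy j + 3) :=
  Submodule.sum_mem _ fun l _ => Submodule.sum_mem _ fun l' _ => by
    by_cases hb : β j l l' = 0
    · rw [hb, zero_smul]; exact zero_mem _
    · have h1 := gr_mul (d_gr (hc l')) (hc l)
      have h2 := h.deg j l l' hb
      rw [show 2 * dx l' + 1 + 1 + (2 * dx l + 1) = 2 * dy j + 3 by omega] at h1
      exact Submodule.smul_mem _ _ h1

theorem Pres.d_prim (h : Pres A x y dx dy β) {D : Type} [GCDGA D] {c : Fin p → D}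
    (hc : ∀ l, c l ∈ Gr D (2 * dx l + 1)) (j : Fin q) {f : A →ₐ[ℚ] D}
    (hf : ∀ l, f (x l) = Dd D (c l)) : Dd D (h.prim D c j) = f (Dd A (y j)) := by
  have e : ∀ l, sg D (Dd D (c l)) = Dd D (c l) := fun l => by
    rw [sg_hom (d_gr (hc l)), Even.neg_one_pow ⟨dx l + 1, by ring⟩, one_smul]
  simp only [Pres.prim, h.dyj, map_sum, map_smul, d_mul, d_d, zero_mul, zero_add, e]
  refine Finset.sum_congr rfl fun l _ => Finset.sum_congr rfl fun l' _ => ?_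
  rw [← hf, ← hf, ← map_mul f, h.comm]

theorem Pres.map_prim (h : Pres A x y dx dy β) {D D' : Type} [GCDGA D] [GCDGA D'] {c : Fin p → D}
    {f : D →ₐ[ℚ] D'} (hf : IsDGAHom f) (j : Fin q) :
    f (h.prim D c j) = h.prim D' (fun l => f (c l)) j := by
  simp only [Pres.prim, map_sum, map_smul, map_mul, hf.1]

theorem Pres.cocycles (h : Pres A x y dx dy β) {B : Type} [GCDGA B] {i : A →ₐ[ℚ] B} (hi : IsDGAHom i)
    {b : Fin p → B} (hb : ∀ j, b j ∈ Gr B (2 * dx j + 1)) (db : ∀ j, Dd B (b j) = i (x j))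
    (un : ∀ (D : Type) [GCDGA D] (f : A →ₐ[ℚ] D) (c : Fin p → D), IsDGAHom f →
        (∀ j, c j ∈ Gr D (2 * dx j + 1)) → (∀ j, Dd D (c j) = f (x j)) →
        ∃ g : B →ₐ[ℚ] D, IsDGAHom g ∧ (∀ a, g (i a) = f a) ∧ ∀ j, g (b j) = c j)
    (gen : ∀ s : Set A, Algebra.adjoin ℚ s = ⊤ → Algebra.adjoin ℚ (i '' s ∪ Set.range b) = ⊤)
    {z : Fin q → B} (hz : ∀ j, z j = i (y j) - h.prim B b j) :
    ∀ c, Dd B c = 0 → ∃ a ∈ Algebra.adjoin ℚ (Set.range z), ∃ v, c = a + Dd B v := by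
  obtain ⟨E, _, e, he, uE, cE⟩ := exists_pairs p dx
  obtain ⟨W, _, j, u, hj, hu, du, uW, ind⟩ := exists_multi_hirsch E q (fun j => 2 * dy j + 3)
    (fun _ => 0) (fun _ => zero_mem _) (fun _ => map_zero _)
  have cW : ∀ x : W, Dd W x = 0 → ∃ a ∈ Algebra.adjoin ℚ (Set.range u), ∃ v, x = a + Dd W v := by
    refine ind (fun C _ _ s => ∀ x : C, Dd C x = 0 → ∃ a ∈ Algebra.adjoin ℚ s, ∃ v, x = a + Dd C v)
      (fun x hx => ?_) fun C C' _ _ i s i' l w hs h' => ?_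
    · obtain ⟨c, u, hc⟩ := cE x hx
      exact ⟨_, Subalgebra.algebraMap_mem _ c, u, hc⟩
    · rw [map_zero] at h'
      exact adjoin_cocycles h' ⟨dy l + 1, by ring⟩ hs
  have hje : ∀ l, j (e l) ∈ Gr W (2 * dx l + 1) := fun l => hj.2 _ _ (he l)
  obtain ⟨f, hf, fx, fy⟩ := h.free W (fun l => Dd W (j (e l))) (fun l => u l + h.prim W (fun l => j (e l)) l)
    (fun l => d_gr (hje l)) (fun l => add_mem (hu l) (h.prim_gr hje l))
  have hf' : IsDGAHom f := dga_of_gen h.gen (by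
    rintro _ (⟨l, rfl⟩ | ⟨l, rfl⟩)
    · exact ⟨_, h.hx l, hf _ _ (h.hx l)⟩
    · exact ⟨_, h.hy l, hf _ _ (h.hy l)⟩) (by
    rintro _ (⟨l, rfl⟩ | ⟨l, rfl⟩)
    · rw [h.dx0, map_zero, fx, d_d]
    · rw [fy, map_add, du, map_zero, zero_add, h.d_prim hje l fx])
  obtain ⟨Θ, hΘ, Θi, Θb⟩ := un W f (fun l => j (e l)) hf' hje (fun l => (fx l).symm)
  obtain ⟨g, hg, gb⟩ := uE B b hb
  have dz : ∀ l, Dd B (z l) = 0 := fun l => by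
    rw [hz, map_sub, h.d_prim hb l (f := i) (fun l => (db l).symm), hi.1, sub_self]
  have zgr : ∀ l, z l ∈ Gr B (2 * dy l + 3) := fun l => by
    rw [hz]; exact sub_mem (hi.2 _ _ (h.hy l)) (h.prim_gr hb l)
  obtain ⟨Ψ, hΨ, Ψj, Ψu⟩ := uW B g z hg zgr (fun l => by rw [dz, map_zero])
  have Ψe : ∀ l, Ψ (j (e l)) = b l := fun l => by rw [Ψj, gb]
  have key : Ψ.comp Θ = AlgHom.id ℚ B := AlgHom.ext_of_adjoin_eq_top (gen _ h.gen) (by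
    rintro _ (⟨_, ⟨l, rfl⟩ | ⟨l, rfl⟩, rfl⟩ | ⟨l, rfl⟩)
    · change Ψ (Θ (i (x l))) = i (x l)
      rw [Θi, fx, hΨ.1, Ψe, db]
    · change Ψ (Θ (i (y l))) = i (y l)
      rw [Θi, fy, map_add, Ψu, h.map_prim hΨ, hz]
      simp only [Ψe, sub_add_cancel]
    · change Ψ (Θ (b l)) = b l
      rw [Θb, Ψe])
  intro c hc
  obtain ⟨a, ha, v, hv⟩ := cW (Θ c) (by rw [← hΘ.1, hc, map_zero])
  refine ⟨Ψ a, ?_, Ψ v, ?_⟩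
  · have h1 : Ψ a ∈ (Algebra.adjoin ℚ (Set.range u)).map Ψ := ⟨a, ha, rfl⟩
    rw [AlgHom.map_adjoin, ← Set.range_comp] at h1
    have h2 : (Ψ ∘ u) = z := funext Ψu
    exact h2 ▸ h1
  · rw [← hΨ.1, ← map_add, ← hv]
    exact (DFunLike.congr_fun key c).symm

/-- The key cocycle of weight `m` in a power of the ideal `K`. -/
theorem Pres.exists_weight (h : Pres A x y dx dy β) {lam : ℕ → Submodule ℚ A} (hW : WordLength A lam)
    (hxl : ∀ i, x i ∈ lam 1) (hyl : ∀ j, y j ∈ lam 1) {m : ℕ}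
    (hη : ∃ η ∈ lam m, Dd A η = 0 ∧ ∀ a, η ≠ Dd A a)
    (hm : ∀ a, Dd A a = 0 → a ∈ (⨆ k, ⨆ (_ : m < k), lam k) → ∃ b ∈ ⨆ k, ⨆ (_ : m ≤ k), lam k, a = Dd A b)
    {T : Type} [GCDGA T] {ι1 ι2 : A →ₐ[ℚ] T} (h1 : IsDGAHom ι1) (h2 : IsDGAHom ι2) {ε : T →ₐ[ℚ] A}
    (hε : IsDGAHom ε) (hεx : ∀ i, ε (ι1 (x i)) = 0) (hεy : ∀ j, ε (ι1 (y j)) = 0)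
    (hε2 : ∀ a, ε (ι2 a) = a) {K : Submodule ℚ T} (hK : Homog K) (hKl : ∀ a b, b ∈ K → a * b ∈ K)
    (hKr : ∀ a b, a ∈ K → a * b ∈ K) (hKι : ∀ a, ι2 a - ι1 a ∈ K) :
    ∃ Ω ∈ K ^ m, Dd T Ω = 0 ∧ ∀ a, ε Ω ≠ Dd A a := by
  obtain ⟨η, hηm, dη, hne⟩ := hη
  have leL : ∀ {n k}, n ≤ k → lam k ≤ ⨆ k, ⨆ (_ : n ≤ k), lam k := fun h =>
    le_iSup₂_of_le _ h le_rfl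
  have ltL : ∀ {n k}, n < k → lam k ≤ ⨆ k, ⨆ (_ : n < k), lam k := fun h =>
    le_iSup₂_of_le _ h le_rfl
  have sgx : ∀ i, sg A (x i) = x i := fun i => by
    rw [sg_hom (h.hx i), Even.neg_one_pow ⟨dx i + 1, by ring⟩, one_smul]
  have hL : Bar A A (AlgHom.id ℚ A) (Fin.elim0 : Fin 0 → A) LinearMap.id Fin.elim0 Fin.elim0 lam lam :=
    ⟨isDGAHom_id A, fun j => j.elim0, fun j => j.elim0, fun _ => rfl,
      fun m l a c ha hc => hW.mul m l (Submodule.mul_mem_mul ha hc), fun m a ha => (hW.homog m).sc_mem _ ha,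
      fun _ _ h => h, by rw [hW.zero]; exact Submodule.one_le.1 le_rfl, fun j => j.elim0, fun _ _ h => h⟩
  rcases Nat.eq_zero_or_pos m with rfl | hm0
  · refine ⟨1, by rw [pow_zero]; exact Submodule.one_le.1 le_rfl, d_one, fun a ha => ?_⟩
    rw [hW.zero] at hηm
    obtain ⟨c, hc⟩ := Submodule.mem_one.1 hηm
    refine hne (c • a) ?_
    rw [map_smul, ← ha, map_one, ← hc, Algebra.algebraMap_eq_smul_one]
  have hL2 : Bar T T (AlgHom.id ℚ T) (Fin.elim0 : Fin 0 → T) LinearMap.id Fin.elim0 Fin.elim0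
      (fun k => if k = 0 then ⊤ else K ^ k) (fun k => if k = 0 then ⊤ else K ^ k) := by
    refine ⟨isDGAHom_id T, fun j => j.elim0, fun j => j.elim0, fun _ => rfl,
      fun m l a c ha hc => ?_, fun m a ha => ?_,
      fun _ _ h => h, by simp, fun j => j.elim0, fun _ _ h => h⟩
    · have hl : ∀ n a b, b ∈ K ^ (n + 1) → a * b ∈ K ^ (n + 1) := fun n a b hb => by
        have : (⊤ : Submodule ℚ T) * K ≤ K := Submodule.mul_le.2 fun a _ b hb => hKl a b hb
        have h2 : (⊤ : Submodule ℚ T) * K ^ (n + 1) ≤ K ^ (n + 1) := by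
          rw [pow_succ', ← mul_assoc]; exact mul_le_mul' this le_rfl
        exact h2 (Submodule.mul_mem_mul trivial hb)
      have hr : ∀ n a b, a ∈ K ^ (n + 1) → a * b ∈ K ^ (n + 1) := fun n a b hb => by
        have : K * (⊤ : Submodule ℚ T) ≤ K := Submodule.mul_le.2 fun a ha b _ => hKr a b ha
        have h2 : K ^ (n + 1) * (⊤ : Submodule ℚ T) ≤ K ^ (n + 1) := by
          rw [pow_succ, mul_assoc]; exact mul_le_mul' le_rfl this
        exact h2 (Submodule.mul_mem_mul hb trivial)
      rcases m with _ | m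
      · rcases l with _ | l
        · simp
        · simpa using hl l a c (by simpa using hc)
      · rcases l with _ | l
        · simpa using hr m a c (by simpa using ha)
        · have := Submodule.mul_mem_mul (show a ∈ K ^ (m + 1) by simpa using ha)
            (show c ∈ K ^ (l + 1) by simpa using hc)
          rw [← pow_add] at this
          simpa using this
    · rcases m with _ | m
      · simp
      · simpa using (hK.pow (m + 1)).sc_mem (-1) (show a ∈ K ^ (m + 1) by simpa using ha)
  have hG : KosPair A A (AlgHom.id ℚ A) (Set.range x) (⨆ k, ⨆ (_ : m ≤ k), lam k)
      (⨆ k, ⨆ (_ : m < k), lam k) := by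
    refine ⟨fun a ha => ?_, fun a ha da => hm a da ha, fun a ha b hb => ?_⟩
    · exact (Homog.sup fun k => Homog.sup fun _ => hW.homog k).sc_mem (-1) ha
    · obtain ⟨l, rfl⟩ := hb
      have : (⨆ k, ⨆ (_ : m ≤ k), lam k) ≤ (⨆ k, ⨆ (_ : m < k), lam k).comap
          (LinearMap.mulRight ℚ (x l)) := by
        refine iSup₂_le fun k hk a ha => ?_
        exact ltL (Nat.lt_succ_of_le hk) (hW.mul k 1 (Submodule.mul_mem_mul ha (hxl l)))
      exact this ha
  obtain ⟨B, B2, _, _, i, i2, ψ, b, b2, t, t2, N, N2, H, H', η', hB, hB2, hψ, ψi, ψb, ψt, hKos, hη', dη',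
    tη', un, gen⟩ := exists_bars hε (by rintro _ ⟨l, rfl⟩; exact sgx l) hL hL2 hG (leL le_rfl hηm) dη p dx x
      (fun l => ι2 (x l) + ι1 (x l)) h.hx (fun l => ⟨l, rfl⟩)
      (fun l => add_mem (h2.2 _ _ (h.hx l)) (h1.2 _ _ (h.hx l))) h.dx0
      (fun l => by rw [map_add, ← h2.1, ← h1.1, h.dx0, map_zero, map_zero, add_zero])
      (fun l => by rw [map_add, hε2, hεx, add_zero])
  set z : Fin q → B := fun j => i (y j) - h.prim B b j with hz
  set z2 : Fin q → B2 := fun j => i2 (ι2 (y j) - ι1 (y j)) -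
    ∑ l, ∑ l', β j l l' • (i2 (ι2 (x l') - ι1 (x l')) * b2 l) with hz2
  have hψz : ∀ j, ψ (z2 j) = z j := fun j => by
    simp only [hz, hz2, map_sub, map_sum, map_smul, map_mul, ψi, ψb, hε2, hεx, hεy, sub_zero, Pres.prim,
      hB.db, map_zero]
  have hdz2 : ∀ j, Dd B2 (z2 j) = 0 := fun j => by
    have e1 : ∀ l, Dd T (ι2 (x l) - ι1 (x l)) = 0 := fun l => by
      rw [map_sub, ← h2.1, ← h1.1, h.dx0, map_zero, map_zero, sub_zero]
    have e2 : ∀ l, sg T (ι2 (x l) - ι1 (x l)) = ι2 (x l) - ι1 (x l) := fun l => by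
      rw [map_sub, ← h2.sc, ← h1.sc, sgx]
    have e3 : Dd B2 (∑ l, ∑ l', β j l l' • (i2 (ι2 (x l') - ι1 (x l')) * b2 l)) =
        i2 (∑ l, ∑ l', β j l l' • ((ι2 (x l') - ι1 (x l')) * (ι2 (x l) + ι1 (x l)))) := by
      simp only [map_sum, map_smul, d_mul, hB2.db, ← hB2.dga.1, e1, map_zero, zero_mul, zero_add,
        ← hB2.dga.sc, e2, map_mul i2]
    have e4 : ∑ l, ∑ l', β j l l' • ((ι2 (x l') - ι1 (x l')) * (ι2 (x l) + ι1 (x l))) =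
        ι2 (Dd A (y j)) - ι1 (Dd A (y j)) := by
      have c2 : ∀ l a, ι2 (x l) * a = a * ι2 (x l) := fun l a =>
        mul_comm_even (h2.2 _ _ (h.hx l)) (by simp [parity_simps]) a
      have c1 : ∀ l a, ι1 (x l) * a = a * ι1 (x l) := fun l a =>
        mul_comm_even (h1.2 _ _ (h.hx l)) (by simp [parity_simps]) a
      have e5 : ∀ l l', (ι2 (x l') - ι1 (x l')) * (ι2 (x l) + ι1 (x l)) =
          (ι2 (x l * x l') - ι1 (x l * x l')) + (ι2 (x l') * ι1 (x l) - ι2 (x l) * ι1 (x l')) := fun l l' => by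
        rw [map_mul, map_mul, sub_mul, mul_add, mul_add, c2 l' (ι2 (x l)), c1 l' (ι1 (x l)), c1 l' (ι2 (x l))]
        abel
      have e6 : ∑ l, ∑ l', β j l l' • (ι2 (x l') * ι1 (x l) - ι2 (x l) * ι1 (x l')) = 0 := by
        simp only [smul_sub, Finset.sum_sub_distrib]
        rw [sub_eq_zero, Finset.sum_comm]
        exact Finset.sum_congr rfl fun l _ => Finset.sum_congr rfl fun l' _ => by rw [h.symm j l' l]
      simp only [e5, smul_add, Finset.sum_add_distrib]
      rw [e6, add_zero, h.dyj]
      simp only [map_sum, map_smul, smul_sub, Finset.sum_sub_distrib]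
    rw [hz2]
    simp only [map_sub (Dd B2), e3, e4, ← hB2.dga.1]
    rw [map_sub (Dd T), ← h2.1, ← h1.1, sub_self]
  have hNz : ∀ j, z j ∈ N 1 := fun j => by
    refine sub_mem (hB.iN 1 _ (hyl j)) (sum_mem fun l _ => sum_mem fun l' _ => Submodule.smul_mem _ _ ?_)
    rw [hB.db]
    exact hB.mul 1 0 _ _ (hB.iN 1 _ (hxl l')) (hB.bN l)
  have hN2z : ∀ j, z2 j ∈ N2 1 := fun j => by
    have hK1 : ∀ a, i2 (ι2 a - ι1 a) ∈ N2 1 := fun a => hB2.iN 1 _ (by simpa using hKι a)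
    refine sub_mem (hK1 _) (sum_mem fun l _ => sum_mem fun l' _ => Submodule.smul_mem _ _ ?_)
    exact hB2.mul 1 0 _ _ (hK1 _) (hB2.bN l)
  have hZN : ∀ k, Submodule.span ℚ (Set.range z) ^ k ≤ N k := fun k => by
    induction k with
    | zero => rw [pow_zero]; exact Submodule.one_le.2 hB.one
    | succ k ih =>
      rw [pow_succ]
      refine Submodule.mul_le.2 fun a ha c hc => hB.mul k 1 _ _ (ih ha) ?_
      exact Submodule.span_le.2 (by rintro _ ⟨j, rfl⟩; exact hNz j) hc
  have hZ2 : ∀ k, Submodule.span ℚ (Set.range z2) ^ k ≤ N2 k ⊓ LinearMap.ker (Dd B2) := fun k => by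
    induction k with
    | zero => rw [pow_zero]; exact Submodule.one_le.2 ⟨hB2.one, d_one⟩
    | succ k ih =>
      rw [pow_succ]
      refine Submodule.mul_le.2 fun a ha c hc => ?_
      have hc' : c ∈ N2 1 ⊓ LinearMap.ker (Dd B2) :=
        Submodule.span_le.2 (by rintro _ ⟨j, rfl⟩; exact ⟨hN2z j, hdz2 j⟩) hc
      refine ⟨hB2.mul k 1 _ _ (ih ha).1 hc'.1, ?_⟩
      have d1 : Dd B2 a = 0 := (ih ha).2
      have d2 : Dd B2 c = 0 := hc'.2
      change Dd B2 (a * c) = 0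
      rw [d_mul, d1, d2, zero_mul, mul_zero, add_zero]
  obtain ⟨w, wm, ws, wo, -⟩ := hW.proj
  have wd : ∀ a, ∃ u, w m (Dd A a) = Dd A u := fun a => by
    have : ∀ a, a ∈ (LinearMap.range (Dd A)).comap (w m ∘ₗ Dd A) := by
      refine hW.mem fun k a ha => ?_
      change w m (Dd A a) ∈ LinearMap.range (Dd A)
      by_cases hk : k + 1 = m
      · exact ⟨a, by rw [← hk, ws _ _ (hW.d_mem k a ha)]⟩
      · rw [wo _ _ _ (hW.d_mem k a ha) hk]; exact zero_mem _
    obtain ⟨u, hu⟩ := this a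
    exact ⟨u, hu.symm⟩
  have key : ∃ s ∈ Submodule.span ℚ (Set.range z) ^ m, ∀ a, t s ≠ Dd A a := by
    by_contra hcon
    push Not at hcon
    obtain ⟨a, ha, v, hav⟩ := h.cocycles hB.dga hB.hb hB.db un gen (fun j => rfl) η' dη'
    have hle : ∀ k, Submodule.span ℚ (Set.range z) ^ k ≤
        (LinearMap.range (Dd A)).comap (w m ∘ₗ t) := fun k s hs => by
      change w m (t s) ∈ LinearMap.range (Dd A)
      have hs' := hB.tN _ _ (hZN k hs)
      by_cases hk : k = m
      · subst hk
        obtain ⟨u, hu⟩ := hcon s hs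
        exact ⟨u, by rw [← hu, ws _ _ hs']⟩
      · rw [wo _ _ _ hs' hk]; exact zero_mem _
    have hadj : ∀ a ∈ Algebra.adjoin ℚ (Set.range z),
        a ∈ ⨆ k, Submodule.span ℚ (Set.range z) ^ k := fun a ha => by
      induction ha using Algebra.adjoin_induction with
      | mem a ha => exact Submodule.mem_iSup_of_mem 1 (by rw [pow_one]; exact Submodule.subset_span ha)
      | algebraMap c => exact Submodule.mem_iSup_of_mem 0 (by
          rw [pow_zero]; exact Submodule.algebraMap_mem c)
      | add a c _ _ ha hc => exact add_mem ha hc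
      | mul a c _ _ ha hc =>
        have := Submodule.mul_mem_mul ha hc
        rw [Submodule.iSup_mul] at this
        simp only [Submodule.mul_iSup, ← pow_add] at this
        refine (iSup_le fun k => iSup_le fun l => ?_ : _ ≤ ⨆ k, Submodule.span ℚ (Set.range z) ^ k) this
        exact le_iSup (fun k => Submodule.span ℚ (Set.range z) ^ k) (k + l)
    obtain ⟨u, hu⟩ := iSup_le hle (hadj a ha)
    obtain ⟨u', hu'⟩ := wd (t v)
    refine hne (u + u') ?_
    rw [map_add, hu, ← hu', ← hB.td, ← ws m η hηm, ← tη', hav, map_add, map_add]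
    rfl
  obtain ⟨s, hs, hsn⟩ := key
  have hmap : Submodule.span ℚ (Set.range z) = (Submodule.span ℚ (Set.range z2)).map ψ.toLinearMap := by
    rw [Submodule.map_span, ← Set.range_comp]
    congr 2
    ext j
    exact (hψz j).symm
  rw [hmap, ← Submodule.map_pow] at hs
  obtain ⟨s2, hs2, rfl⟩ := hs
  obtain ⟨n2, d2⟩ := hZ2 m hs2
  refine ⟨t2 s2, by simpa [hm0.ne'] using hB2.tN _ _ n2, ?_, fun a ha => hsn a ?_⟩
  · rw [← hB2.td, LinearMap.mem_ker.1 d2, map_zero]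
  · rw [← ha, ← ψt]; rfl

end pres

theorem Homog.exists_compl {A : Type} [GCDGA A] {P G : Submodule ℚ A} (hP : Homog P) (hG : Homog G) :
    ∃ M : Submodule ℚ A, Homog M ∧ M ≤ G ∧ (P ≤ G → G ≤ P ⊔ M) ∧ P ⊓ M = ⊥ := by
  choose C hC using fun n => Submodule.exists_isCompl (P ⊓ Gr A n)
  let M : ℕ → Submodule ℚ A := fun n => C n ⊓ (G ⊓ Gr A n)
  have hM : ∀ n, ∀ x ∈ ⨆ k, M k, pr A n x ∈ M n := fun n x hx => by
    have : (⨆ k, M k) ≤ (M n).comap (pr A n) := iSup_le fun k y hy => by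
      change pr A n y ∈ M n
      by_cases h : k = n
      · subst h; rwa [pr_same hy.2.2]
      · rw [pr_ne hy.2.2 h]; exact zero_mem _
    exact this hx
  refine ⟨⨆ n, M n, fun x hx n => Submodule.mem_iSup_of_mem n (hM n x hx),
    iSup_le fun n => inf_le_right.trans inf_le_left, fun hle x hx => mem_of_pr fun n => ?_, ?_⟩
  · have h1 : pr A n x ∈ (P ⊓ Gr A n) ⊔ C n := by rw [(hC n).sup_eq_top]; trivial
    obtain ⟨u, hu, v, hv, huv⟩ := Submodule.mem_sup.1 h1
    rw [← huv]
    refine Submodule.add_mem_sup hu.1 (Submodule.mem_iSup_of_mem n ⟨hv, ?_⟩)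
    rw [← eq_sub_iff_add_eq'] at huv
    rw [huv]
    exact ⟨sub_mem (hG x hx n) (hle hu.1), sub_mem (pr_mem n x) hu.2⟩
  · rw [eq_bot_iff]
    rintro x ⟨h1, h2⟩
    refine mem_of_pr fun n => ?_
    have h3 := hM n x h2
    have h4 : pr A n x ∈ (P ⊓ Gr A n) ⊓ C n := ⟨⟨hP x h1 n, pr_mem n x⟩, h3.1⟩
    rwa [(hC n).inf_eq_bot] at h4

/-- A homogeneous two-sided differential ideal. -/
structure DIdeal {T : Type} [GCDGA T] (I : Submodule ℚ T) : Prop where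
  l : ∀ a, ∀ x ∈ I, a * x ∈ I
  r : ∀ a, ∀ x ∈ I, x * a ∈ I
  homog : Homog I
  d : ∀ x ∈ I, Dd T x ∈ I

theorem DIdeal.ker {A B : Type} [GCDGA A] [GCDGA B] {f : A →ₐ[ℚ] B} (hf : IsDGAHom f) :
    DIdeal (LinearMap.ker f.toLinearMap) := by
  refine ⟨fun a x hx => ?_, fun a x hx => ?_, homog_ker hf, fun x hx => ?_⟩ <;>
    rw [LinearMap.mem_ker, AlgHom.toLinearMap_apply] at hx ⊢
  · rw [map_mul, hx, mul_zero]
  · rw [map_mul, hx, zero_mul]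
  · rw [hf.1, hx, map_zero]

theorem DIdeal.mul {T : Type} [GCDGA T] {I J : Submodule ℚ T} (hI : DIdeal I) (hJ : DIdeal J) :
    DIdeal (I * J) := by
  refine ⟨fun a x hx => ?_, fun a x hx => ?_, hI.homog.mul hJ.homog, fun x hx => ?_⟩
  · have : I * J ≤ (I * J).comap (LinearMap.mulLeft ℚ a) := Submodule.mul_le.2 fun u hu v hv => by
      change a * (u * v) ∈ I * J
      rw [← mul_assoc]; exact Submodule.mul_mem_mul (hI.l a u hu) hv
    exact this hx
  · have : I * J ≤ (I * J).comap (LinearMap.mulRight ℚ a) := Submodule.mul_le.2 fun u hu v hv => by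
      change u * v * a ∈ I * J
      rw [mul_assoc]; exact Submodule.mul_mem_mul hu (hJ.r a v hv)
    exact this hx
  · have : I * J ≤ (I * J).comap (Dd T) := Submodule.mul_le.2 fun u hu v hv => by
      change Dd T (u * v) ∈ I * J
      rw [d_mul]
      exact add_mem (Submodule.mul_mem_mul (hI.d u hu) hv)
        (Submodule.mul_mem_mul (hI.homog.sc_mem _ hu) (hJ.d v hv))
    exact this hx

theorem DIdeal.pow {T : Type} [GCDGA T] {I : Submodule ℚ T} (hI : DIdeal I) (n : ℕ) :
    DIdeal (I ^ (n + 1)) := by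
  induction n with
  | zero => simpa using hI
  | succ n ih => rw [pow_succ]; exact ih.mul hI

theorem DIdeal.exists_quotient {T : Type} [GCDGA T] {I : Submodule ℚ T} (hI : DIdeal I) :
    ∃ (Q : Type) (_ : GCDGA Q) (ρ : T →ₐ[ℚ] Q), IsDGAHom ρ ∧ Function.Surjective ρ ∧
      LinearMap.ker ρ.toLinearMap = I :=
  RHT.exists_quotient I hI.l hI.r hI.homog hI.d

theorem exists_acyclic {T : Type} [GCDGA T] (hT : Conn T) {F G : Submodule ℚ T} (hF : DIdeal F)
    (hG : Homog G) (hFG : F ≤ G) (hl : ∀ a ∈ Ge T 1, ∀ g ∈ G, a * g ∈ F)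
    (hr : ∀ a ∈ Ge T 1, ∀ g ∈ G, g * a ∈ F) (hd : ∀ g ∈ G, Dd T g ∈ F)
    (hex : ∀ a ∈ F, Dd T a = 0 → ∃ b ∈ G, a = Dd T b) :
    ∃ I, F ≤ I ∧ DIdeal I ∧ ∀ a ∈ I, Dd T a = 0 → ∃ b ∈ I, a = Dd T b := by
  have hZ : Homog (LinearMap.ker (Dd T) ⊓ G) := homog_ker_d.inf hG
  obtain ⟨M, hM, hMG, hsup, hinf⟩ := (hZ.sup2 hF.homog).exists_compl hG
  have hIG : F ⊔ M ≤ G := sup_le hFG hMG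
  have hpos : ∀ a : T, ∃ (c : ℚ), ∃ a' ∈ Ge T 1, a = algebraMap ℚ T c + a' := fun a => by
    obtain ⟨c, hc⟩ := hT _ (pr_mem 0 a)
    refine ⟨c, a - algebraMap ℚ T c, fun n hn => ?_, by abel⟩
    obtain rfl : n = 0 := by omega
    rw [← hc, map_sub, pr_same (pr_mem 0 a), sub_self]
  refine ⟨F ⊔ M, le_sup_left, ⟨fun a x hx => ?_, fun a x hx => ?_, hF.homog.sup2 hM,
    fun x hx => Submodule.mem_sup_left (hd x (hIG hx))⟩, fun a ha da => ?_⟩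
  · obtain ⟨c, a, h, rfl⟩ := hpos a
    rw [add_mul, ← Algebra.smul_def]
    exact add_mem (Submodule.smul_mem _ _ hx) (Submodule.mem_sup_left (hl a h x (hIG hx)))
  · obtain ⟨c, a, h, rfl⟩ := hpos a
    rw [mul_add, ← Algebra.commutes, ← Algebra.smul_def]
    exact add_mem (Submodule.smul_mem _ _ hx) (Submodule.mem_sup_left (hr a h x (hIG hx)))
  · obtain ⟨f, hf, m, hm, rfl⟩ := Submodule.mem_sup.1 ha
    have hm0 : m ∈ (LinearMap.ker (Dd T) ⊓ G ⊔ F) ⊓ M := by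
      refine ⟨?_, hm⟩
      have : m = (f + m) - f := by abel
      rw [this]
      exact sub_mem (Submodule.mem_sup_left ⟨da, hIG ha⟩) (Submodule.mem_sup_right hf)
    rw [hinf, Submodule.mem_bot] at hm0
    subst hm0
    rw [add_zero] at da ⊢
    obtain ⟨g, hg, rfl⟩ := hex f hf da
    obtain ⟨u, hu, m', hm', rfl⟩ := Submodule.mem_sup.1 (hsup (sup_le inf_le_right hFG) hg)
    obtain ⟨z, hz, f', hf', rfl⟩ := Submodule.mem_sup.1 hu
    refine ⟨f' + m', Submodule.add_mem_sup hf' hm', ?_⟩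
    have hz0 : Dd T z = 0 := hz.1
    rw [map_add, map_add, hz0, zero_add, map_add]

theorem htpyRetraction_of_acyclic {T Q : Type} [GCDGA T] [GCDGA Q] {ρ : T →ₐ[ℚ] Q} (hρ : IsDGAHom ρ)
    (ρs : Function.Surjective ρ) {I : Submodule ℚ T} (hI : DIdeal I)
    (hk : LinearMap.ker ρ.toLinearMap ≤ I)
    (hac : ∀ a ∈ I, Dd T a = 0 → ∃ b ∈ I, a = Dd T b) : Nonempty (HtpyRetraction ρ) := by
  obtain ⟨P, _, p, q, hp, hq, pair, ext, -⟩ := exists_prod T Q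
  let S : Subalgebra ℚ P :=
    { carrier := {c : P | ∃ t : T, ρ t = q c ∧ p c - t ∈ I}
      mul_mem' := by
        rintro c c' ⟨t, h1, h2⟩ ⟨t', h1', h2'⟩
        refine ⟨t * t', by rw [map_mul, map_mul, h1, h1'], ?_⟩
        have e : p (c * c') - t * t' = (p c - t) * p c' + t * (p c' - t') := by
          rw [map_mul]; noncomm_ring
        rw [e]
        exact add_mem (hI.r _ _ h2) (hI.l _ _ h2')
      add_mem' := by
        rintro c c' ⟨t, h1, h2⟩ ⟨t', h1', h2'⟩
        refine ⟨t + t', by rw [map_add, map_add, h1, h1'], ?_⟩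
        rw [map_add, add_sub_add_comm]
        exact add_mem h2 h2'
      algebraMap_mem' := fun c => ⟨algebraMap ℚ T c, by simp, by simp⟩ }
  have hS : ∀ c, c ∈ S ↔ ∃ t : T, ρ t = q c ∧ p c - t ∈ I := fun c => Iff.rfl
  obtain ⟨C, _, i, hi, inj, mem, gr⟩ := exists_sub S (by
    rintro c ⟨t, h1, h2⟩ n
    refine ⟨pr T n t, ?_, ?_⟩
    · rw [← hρ.pr, ← hq.pr, h1]
    · rw [← hp.pr, ← map_sub]; exact hI.homog _ h2 n) (by
    rintro c ⟨t, h1, h2⟩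
    exact ⟨Dd T t, by rw [hρ.1, hq.1, h1], by rw [hp.1, ← map_sub]; exact hI.d _ h2⟩)
  have ext' : ∀ c c', p (i c) = p (i c') → q (i c) = q (i c') → c = c' := fun c c' h h' =>
    inj (ext _ _ h h')
  have pair' : ∀ t a, a - t ∈ I → ∃ c, p (i c) = a ∧ q (i c) = ρ t := fun t a h => by
    obtain ⟨c, h1, h2⟩ := pair a (ρ t)
    obtain ⟨y, rfl⟩ := (mem c).1 ⟨t, h2.symm, by rwa [h1]⟩
    exact ⟨y, h1, h2⟩
  choose j j1 j2 using fun t => pair' t t (by rw [sub_self]; exact zero_mem _)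
  let J : T →ₐ[ℚ] C :=
    { toFun := j
      map_one' := ext' _ _ (by simp [j1]) (by simp [j2])
      map_mul' := fun a b => ext' _ _ (by simp [j1]) (by simp [j2])
      map_zero' := ext' _ _ (by simp [j1]) (by simp [j2])
      map_add' := fun a b => ext' _ _ (by simp [j1]) (by simp [j2])
      commutes' := fun a => ext' _ _ (by simp [j1]) (by simp [j2]) }
  have hJ : ∀ t, J t = j t := fun _ => rfl
  refine ⟨⟨C, J, q.comp i, p.comp i, ⟨fun a => ?_, fun n a ha => ?_⟩, hi.comp hq, hi.comp hp, fun b => ?_,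
    ⟨fun b db => ?_, fun c dc h => ?_⟩, AlgHom.ext j2, AlgHom.ext j1⟩⟩
  · rw [hJ, hJ]
    exact ext' _ _ (by rw [j1, hi.1, hp.1, j1]) (by rw [j2, hi.1, hq.1, j2, hρ.1])
  · rw [hJ]
    have : j a = pr C n (j a) := ext' _ _
      (by rw [← hi.pr, ← hp.pr, j1, pr_same ha]) (by rw [← hi.pr, ← hq.pr, j2, hρ.pr, pr_same ha])
    rw [this]; exact pr_mem _ _
  · obtain ⟨t, rfl⟩ := ρs b
    exact ⟨j t, j2 t⟩
  · obtain ⟨t, rfl⟩ := ρs b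
    obtain ⟨s, hs, hts⟩ := hac (Dd T t) (hk (by
      rw [LinearMap.mem_ker, AlgHom.toLinearMap_apply, hρ.1, db])) (d_d t)
    obtain ⟨c, h1, h2⟩ := pair' t (t - s) (by rw [sub_sub_cancel_left]; exact neg_mem hs)
    refine ⟨c, ext' _ _ ?_ ?_, 0, ?_⟩
    · rw [hi.1, hp.1, h1, map_sub, hts, sub_self, map_zero, map_zero]
    · rw [hi.1, hq.1, h2, db, map_zero, map_zero]
    · rw [map_zero, sub_eq_zero]; exact h2
  · obtain ⟨b, hb⟩ := h
    obtain ⟨t', rfl⟩ := ρs b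
    obtain ⟨t, h1, h2⟩ := (hS (i c)).1 ((mem _).2 ⟨c, rfl⟩)
    have hb' : q (i c) = Dd Q (ρ t') := hb
    have h3 : t - Dd T t' ∈ I := hk (by
      rw [LinearMap.mem_ker, AlgHom.toLinearMap_apply, map_sub, hρ.1, h1, hb', sub_self])
    obtain ⟨s, hs, hs'⟩ := hac (p (i c) - Dd T t') (by
      have := add_mem h2 h3
      rwa [sub_add_sub_cancel] at this) (by
      rw [map_sub, d_d, sub_zero, ← hp.1, ← hi.1, dc, map_zero, map_zero])
    obtain ⟨e, e1, e2⟩ := pair' t' (t' + s) (by rwa [add_sub_cancel_left])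
    refine ⟨e, ext' _ _ ?_ ?_⟩
    · rw [hi.1, hp.1, e1, map_add, ← hs']; abel
    · rw [hi.1, hq.1, e2, hb']

theorem HtpyRetraction.toMod {T Q : Type} [GCDGA T] [GCDGA Q] {ρ : T →ₐ[ℚ] Q} (R : HtpyRetraction ρ) :
    Nonempty (ModHtpyRetraction ρ) :=
  have h : ∀ t, R.τ (R.j t) = t := fun t => AlgHom.congr_fun R.hτj t
  ⟨⟨R.C, R.j, R.q, R.τ.toLinearMap, R.j_dga, R.q_dga, R.q_surj, R.q_quasi, R.hqj, R.τ_dga.1,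
    fun t c => by rw [AlgHom.toLinearMap_apply, map_mul, h]; rfl, h⟩⟩

theorem WordLength.dideal {A : Type} [GCDGA A] {lam : ℕ → Submodule ℚ A} (h : WordLength A lam) (m : ℕ) :
    DIdeal (⨆ k, ⨆ (_ : m < k), lam k) := by
  have le : ∀ {k}, m < k → lam k ≤ ⨆ k, ⨆ (_ : m < k), lam k := fun h => le_iSup₂_of_le _ h le_rfl
  refine ⟨fun a x hx => ?_, fun a x hx => ?_, Homog.sup fun k => Homog.sup fun _ => h.homog k,
    fun x hx => ?_⟩
  · refine h.mem (P := (⨆ k, ⨆ (_ : m < k), lam k).comap (LinearMap.mulRight ℚ x)) (fun l a ha => ?_) a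
    refine (iSup₂_le fun k hk y hy => ?_ : (⨆ k, ⨆ (_ : m < k), lam k) ≤
      (⨆ k, ⨆ (_ : m < k), lam k).comap (LinearMap.mulLeft ℚ a)) hx
    exact le (by omega) (h.mul l k (Submodule.mul_mem_mul ha hy))
  · refine h.mem (P := (⨆ k, ⨆ (_ : m < k), lam k).comap (LinearMap.mulLeft ℚ x)) (fun l a ha => ?_) a
    refine (iSup₂_le fun k hk y hy => ?_ : (⨆ k, ⨆ (_ : m < k), lam k) ≤
      (⨆ k, ⨆ (_ : m < k), lam k).comap (LinearMap.mulRight ℚ a)) hx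
    exact le (by omega) (h.mul k l (Submodule.mul_mem_mul hy ha))
  · refine (iSup₂_le fun k hk y hy => ?_ : (⨆ k, ⨆ (_ : m < k), lam k) ≤
      (⨆ k, ⨆ (_ : m < k), lam k).comap (Dd A)) hx
    exact le (by omega) (h.d_mem k y hy)

theorem WordLength.exists_catWitness {A : Type} [GCDGA A] (S : MinimalSullivan A)
    (h : WordLength A S.lam) {m : ℕ}
    (hm : ∀ a, Dd A a = 0 → a ∈ (⨆ k, ⨆ (_ : m < k), S.lam k) →
      ∃ b ∈ ⨆ k, ⨆ (_ : m ≤ k), S.lam k, a = Dd A b) : Nonempty (CatWitness A S m) := by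
  have le : ∀ {k}, m < k → S.lam k ≤ ⨆ k, ⨆ (_ : m < k), S.lam k := fun h => le_iSup₂_of_le _ h le_rfl
  have hF := h.dideal m
  have hge : Ge A 1 ≤ ⨆ k, ⨆ (_ : 0 < k), S.lam k := fun a ha => by
    have : ∀ a, a - pr A 0 a ∈ ⨆ k, ⨆ (_ : 0 < k), S.lam k := fun a => by
      refine h.mem (P := (⨆ k, ⨆ (_ : 0 < k), S.lam k).comap (LinearMap.id - pr A 0)) (fun k a ha => ?_) a
      change a - pr A 0 a ∈ ⨆ k, ⨆ (_ : 0 < k), S.lam k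
      rcases Nat.eq_zero_or_pos k with rfl | hk
      · rw [h.zero] at ha
        obtain ⟨c, rfl⟩ := Submodule.mem_one.1 ha
        rw [pr_same (by rw [Algebra.algebraMap_eq_smul_one]; exact Submodule.smul_mem _ _ gr_one), sub_self]
        exact zero_mem _
      · have h0 : pr A 0 a = 0 := h.ge k ha 0 (by omega)
        rw [h0, sub_zero]
        exact Submodule.mem_iSup_of_mem k (Submodule.mem_iSup_of_mem hk ha)
    have h2 := this a
    rwa [ha 0 (by omega), sub_zero] at h2
  obtain ⟨I, hFI, hI, hac⟩ := exists_acyclic (h.conn) hF (G := ⨆ k, ⨆ (_ : m ≤ k), S.lam k)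
    (Homog.sup fun k => Homog.sup fun _ => h.homog k)
    (iSup₂_le fun k hk => le_iSup₂_of_le k hk.le le_rfl)
    (fun a ha g hg => by
      refine (iSup₂_le fun l hl b hb => ?_ : (⨆ k, ⨆ (_ : 0 < k), S.lam k) ≤
        (⨆ k, ⨆ (_ : m < k), S.lam k).comap (LinearMap.mulRight ℚ g)) (hge ha)
      refine (iSup₂_le fun k hk g hg => ?_ : (⨆ k, ⨆ (_ : m ≤ k), S.lam k) ≤
        (⨆ k, ⨆ (_ : m < k), S.lam k).comap (LinearMap.mulLeft ℚ b)) hg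
      exact le (by omega) (h.mul l k (Submodule.mul_mem_mul hb hg)))
    (fun a ha g hg => by
      refine (iSup₂_le fun l hl b hb => ?_ : (⨆ k, ⨆ (_ : 0 < k), S.lam k) ≤
        (⨆ k, ⨆ (_ : m < k), S.lam k).comap (LinearMap.mulLeft ℚ g)) (hge ha)
      refine (iSup₂_le fun k hk g hg => ?_ : (⨆ k, ⨆ (_ : m ≤ k), S.lam k) ≤
        (⨆ k, ⨆ (_ : m < k), S.lam k).comap (LinearMap.mulRight ℚ b)) hg
      exact le (by omega) (h.mul k l (Submodule.mul_mem_mul hg hb)))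
    (fun g hg => by
      refine (iSup₂_le fun k hk g hg => ?_ : (⨆ k, ⨆ (_ : m ≤ k), S.lam k) ≤
        (⨆ k, ⨆ (_ : m < k), S.lam k).comap (Dd A)) hg
      exact le (by omega) (h.d_mem k g hg))
    (fun a ha da => hm a da ha)
  obtain ⟨Q, _, ρ, hρ, ρs, ρk⟩ := hF.exists_quotient
  exact ⟨⟨Q, ρ, hρ, ρs, ρk, htpyRetraction_of_acyclic hρ ρs hI (ρk.le.trans hFI) hac⟩⟩

theorem TensorPower.mu_dga {A T : Type} [GCDGA A] [GCDGA T] {r : ℕ} (TP : TensorPower A r T) :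
    IsDGAHom TP.mu :=
  (TP.coprod A (fun _ => AlgHom.id ℚ A) (fun _ => isDGAHom_id A)).choose_spec.1.1

theorem TensorPower.mu_ι {A T : Type} [GCDGA A] [GCDGA T] {r : ℕ} (TP : TensorPower A r T) (j : Fin r)
    (a : A) : TP.mu (TP.ι j a) = a :=
  AlgHom.congr_fun
    ((TP.coprod A (fun _ => AlgHom.id ℚ A) (fun _ => isDGAHom_id A)).choose_spec.1.2 j) a

theorem TensorPower.kerMu_dideal {A T : Type} [GCDGA A] [GCDGA T] {r : ℕ} (TP : TensorPower A r T) :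
    DIdeal TP.kerMu :=
  DIdeal.ker TP.mu_dga

theorem TensorPower.kerMu_le {A T : Type} [GCDGA A] [Nontrivial A] [GCDGA T] {r : ℕ}
    (TP : TensorPower A r T) (hT : Conn T) : TP.kerMu ≤ Ge T 1 := fun x hx n hn => by
  obtain rfl : n = 0 := by omega
  obtain ⟨c, hc⟩ := hT _ (pr_mem 0 x)
  have h : TP.mu (pr T 0 x) = 0 := TP.kerMu_dideal.homog x hx 0
  rw [hc, AlgHom.commutes, map_eq_zero_iff _ (algebraMap ℚ A).injective] at h
  rw [hc, h, map_zero]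

theorem exists_mtcWitness {A : Type} [GCDGA A] [Nontrivial A] (hA : Good A) (hb : Bdd A) (hc : Conn A)
    (r : ℕ) : ∃ n, Nonempty (MTCWitness A r n) := by
  obtain ⟨T, _, ⟨TP⟩, -, ⟨N, hN⟩, hT⟩ := exists_tensorPower hA hb hc r
  have hJ := TP.kerMu_dideal.pow N
  have hle : TP.kerMu ^ (N + 1) ≤ Ge T (N + 1) :=
    (pow_le_pow_left' (TP.kerMu_le hT) (N + 1)).trans (by simpa using ge_pow (A := T) 1 (N + 1))
  have dge : ∀ g ∈ Ge T N, Dd T g ∈ Ge T (N + 1) := fun g hg n hn => by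
    rcases n with _ | n
    · exact pr_zero_d _
    · rw [pr_d, hg n (by omega), map_zero]
  have gl : ∀ k l, ∀ a ∈ Ge T k, ∀ b ∈ Ge T l, a * b ∈ Ge T (k + l) := fun k l a ha b hb =>
    ge_mul k l (Submodule.mul_mem_mul ha hb)
  have top : ∀ a, a ∈ Ge T 0 := fun a => by rw [ge_zero]; trivial
  have hF : DIdeal (Ge T (N + 1)) := ⟨fun a x hx => by simpa using gl 0 (N + 1) a (top a) x hx,
    fun a x hx => gl (N + 1) 0 x hx a (top a), homog_ge _,
    fun x hx => dge x (ge_anti (Nat.le_succ N) hx)⟩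
  obtain ⟨I, hFI, hI, hac⟩ := exists_acyclic hT hF (homog_ge N) (ge_anti (Nat.le_succ N))
    (fun a ha g hg => by simpa [add_comm] using gl 1 N a ha g hg) (fun a ha g hg => gl N 1 g hg a ha) dge
    (fun a ha da => by
      have : a ∈ (Ge T N).map (Dd T) := mem_of_pr fun n => by
        rcases Nat.lt_or_ge n (N + 1) with hn | hn
        · rw [ha n hn]; exact zero_mem _
        · obtain ⟨k, rfl⟩ : ∃ k, n = k + 1 := ⟨n - 1, by omega⟩
          obtain ⟨y, hy⟩ := hN (k + 1) (by omega) _ (pr_mem (k + 1) a) (homog_ker_d a da (k + 1))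
          exact ⟨pr T k y, gr_le_ge (by omega) (pr_mem k y), (exact_hom hy (pr_mem _ _)).symm⟩
      obtain ⟨b, hb, rfl⟩ := this
      exact ⟨b, hb, rfl⟩)
  obtain ⟨Q, _, ρ, hρ, ρs, ρk⟩ := hJ.exists_quotient
  obtain ⟨R⟩ := htpyRetraction_of_acyclic hρ ρs hI (ρk.le.trans (hle.trans hFI)) hac
  exact ⟨N, ⟨⟨T, TP, Q, ρ, hρ, ρs, ρk, R.toMod⟩⟩⟩

theorem DIdeal.pow_anti {T : Type} [GCDGA T] {I : Submodule ℚ T} (hI : DIdeal I) {k l : ℕ}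
    (h : k + 1 ≤ l) : I ^ l ≤ I ^ (k + 1) := by
  obtain ⟨d, rfl⟩ := Nat.exists_eq_add_of_le h
  rw [pow_add]
  exact Submodule.mul_le.2 fun a ha b _ => (hI.pow k).r b a ha

theorem TensorPower.one_notMem_kerMu_pow {A : Type} [GCDGA A] [Nontrivial A] {T : Type} [GCDGA T] {r : ℕ}
    (TP : TensorPower A r T) (n : ℕ) : (1 : T) ∉ TP.kerMu ^ (n + 1) := fun h => by
  have h1 : (1 : T) ∈ TP.kerMu := by
    have := TP.kerMu_dideal.pow_anti (k := 0) (l := n + 1) (by omega) h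
    rwa [zero_add, pow_one] at this
  have h2 : TP.mu 1 = 0 := h1
  rw [map_one] at h2
  exact one_ne_zero h2

/-- A functional on `A` of degree `-N` detecting a nonexact cocycle of degree `N`. -/
theorem exists_functional {A : Type} [GCDGA A] {N : ℕ} {ω : A} (hω : ω ∈ Gr A N)
    (hn : ∀ a, ω ≠ Dd A a) : ∃ φ : A →ₗ[ℚ] ℚ, φ ω = 1 ∧ (∀ a, φ (Dd A a) = 0) ∧
      ∀ n a, a ∈ Gr A n → n ≠ N → φ a = 0 := by
  have h : ω ∉ LinearMap.range (Dd A) := by rintro ⟨a, ha⟩; exact hn a ha.symm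
  obtain ⟨f, hf, hle⟩ := Submodule.exists_le_ker_of_notMem h
  refine ⟨(f ω)⁻¹ • (f ∘ₗ pr A N), ?_, fun a => ?_, fun n a ha h => ?_⟩
  · change (f ω)⁻¹ * f (pr A N ω) = 1
    rw [pr_same hω, inv_mul_cancel₀ hf]
  · change (f ω)⁻¹ * f (pr A N (Dd A a)) = 0
    have : f (pr A N (Dd A a)) = 0 := hle (homog_range_d _ ⟨a, rfl⟩ N)
    rw [this, mul_zero]
  · change (f ω)⁻¹ * f (pr A N a) = 0
    rw [pr_ne ha h, map_zero, mul_zero]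

/-- Integration along the second factor of a tensor product. -/
theorem IsTens.exists_integral {T A E : Type} [GCDGA T] [GCDGA A] [GCDGA E] {i : T →ₐ[ℚ] E} {ι : A →ₐ[ℚ] E}
    (h : IsTens T A E i ι) {N : ℕ} (φ : A →ₗ[ℚ] ℚ) (φd : ∀ a, φ (Dd A a) = 0)
    (φN : ∀ n a, a ∈ Gr A n → n ≠ N → φ a = 0) : ∃ Φ : E →ₗ[ℚ] T,
      (∀ t a, Φ (i t * ι a) = φ a • t) ∧ (∀ t x, Φ (i t * x) = t * Φ x) ∧
      (∀ x, Φ (Dd E x) = Dd T (Φ x)) ∧ ∀ x ∈ Gr E N, Φ x ∈ Gr T 0 := by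
  obtain ⟨Φ, hΦ⟩ := h.bil (LinearMap.mk₂ ℚ (fun (t : T) (a : A) => φ a • t) (by simp)
    (fun c t a => by rw [smul_comm]) (by simp [add_smul]) (by simp [mul_smul]))
  simp only [LinearMap.mk₂_apply] at hΦ
  refine ⟨Φ, hΦ, fun t x => ?_, fun x => ?_, fun x hx => ?_⟩
  · refine LinearMap.congr_fun (f := Φ ∘ₗ LinearMap.mulLeft ℚ (i t)) (g := LinearMap.mulLeft ℚ t ∘ₗ Φ)
      (h.lext fun t' b => ?_) x
    change Φ (i t * (i t' * ι b)) = t * Φ (i t' * ι b)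
    rw [← mul_assoc, ← map_mul, hΦ, hΦ, mul_smul_comm]
  · refine LinearMap.congr_fun (f := Φ ∘ₗ Dd E) (g := Dd T ∘ₗ Φ) (h.lext fun t b => ?_) x
    change Φ (Dd E (i t * ι b)) = Dd T (Φ (i t * ι b))
    rw [d_mul, ← h.idga.1, ← h.idga.sc, ← h.ιdga.1, map_add, hΦ, hΦ, hΦ, φd, zero_smul, add_zero, map_smul]
  · have : x ∈ (Gr T 0).comap (Φ ∘ₗ pr E N) := h.span_hom _ (fun m n t b ht hb => by
      change Φ (pr E N (i t * ι b)) ∈ Gr T 0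
      have hm := gr_mul (h.idga.2 _ _ ht) (h.ιdga.2 _ _ hb)
      by_cases h0 : m + n = N
      · rw [← h0, pr_same hm, hΦ]
        by_cases h1 : n = N
        · obtain rfl : m = 0 := by omega
          exact Submodule.smul_mem _ _ ht
        · rw [φN n b hb h1, zero_smul]; exact zero_mem _
      · rw [pr_ne hm h0, map_zero]; exact zero_mem _) x
    change Φ (pr E N x) ∈ Gr T 0 at this
    rwa [pr_same hx] at this

theorem Pres.exists_aug {A : Type} [GCDGA A] {p q : ℕ} {x : Fin p → A} {y : Fin q → A} {dx : Fin p → ℕ}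
    {dy : Fin q → ℕ} {β : Fin q → Fin p → Fin p → ℚ} (h : Pres A x y dx dy β) (K : Type) [GCDGA K] :
    ∃ e : A →ₐ[ℚ] K, IsDGAHom e ∧ (∀ i, e (x i) = 0) ∧ ∀ j, e (y j) = 0 := by
  obtain ⟨g, hg, gx, gy⟩ := h.free K (fun _ => 0) (fun _ => 0) (fun _ => zero_mem _) (fun _ => zero_mem _)
  refine ⟨g, dga_of_gen h.gen (fun a ha => ?_) (fun a ha => ?_), gx, gy⟩
  · rcases ha with ⟨l, rfl⟩ | ⟨l, rfl⟩
    · exact ⟨_, h.hx l, hg _ _ (h.hx l)⟩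
    · exact ⟨_, h.hy l, hg _ _ (h.hy l)⟩
  · rcases ha with ⟨l, rfl⟩ | ⟨l, rfl⟩
    · rw [gx, h.dx0, map_zero, map_zero]
    · rw [gy, h.dyj, map_zero]
      simp only [map_sum, map_smul, map_mul, gx, mul_zero, smul_zero, Finset.sum_const_zero]

theorem Pres.exists_class {A : Type} [GCDGA A] {p q : ℕ} {x : Fin p → A} {y : Fin q → A} {dx : Fin p → ℕ}
    {dy : Fin q → ℕ} {β : Fin q → Fin p → Fin p → ℚ} (h : Pres A x y dx dy β)
    {lam : ℕ → Submodule ℚ A} (hW : WordLength A lam)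
    (hxl : ∀ i, x i ∈ lam 1) (hyl : ∀ j, y j ∈ lam 1) {m : ℕ}
    (hη : ∃ η ∈ lam m, Dd A η = 0 ∧ ∀ a, η ≠ Dd A a)
    (hm : ∀ a, Dd A a = 0 → a ∈ (⨆ k, ⨆ (_ : m < k), lam k) → ∃ b ∈ ⨆ k, ⨆ (_ : m ≤ k), lam k, a = Dd A b)
    {r : ℕ} {T T' : Type} [GCDGA T] [GCDGA T'] (TP : TensorPower A (r + 1) T)
    (TP' : TensorPower A (r + 2) T') (hT : Conn T) :
    ∃ (i : T →ₐ[ℚ] T') (Ω : T') (I : T' →ₗ[ℚ] T), IsDGAHom i ∧ (∀ t, TP'.mu (i t) = TP.mu t) ∧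
      Ω ∈ TP'.kerMu ^ m ∧ Dd T' Ω = 0 ∧ (∀ a, Ω ≠ Dd T' a) ∧ (∀ x, I (Dd T' x) = Dd T (I x)) ∧
      (∀ t x, I (i t * x) = t * I x) ∧ I Ω = 1 := by
  have hA : Good A := h.tower.good
  have hnt : Nontrivial A := h.nontrivial
  obtain ⟨E, _, iE, ιE, hE, -⟩ := hA T
  obtain ⟨K, _, hK⟩ := exists_base
  obtain ⟨u, hu⟩ := hK.exists_unit A
  obtain ⟨e, he, ex, ey⟩ := h.exists_aug K
  obtain ⟨εK, ⟨hεK, εKι⟩, -⟩ := TP.coprod K (fun _ => e) (fun _ => he)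
  obtain ⟨i, ⟨hi, iι⟩, -⟩ := TP.coprod T' (fun j => TP'.ι j.castSucc) (fun j => TP'.ι_dga _)
  obtain ⟨ψ, ⟨hψ, ψι⟩, -⟩ := TP'.coprod E (Fin.lastCases ιE fun j => iE.comp (TP.ι j))
    (fun j => by
      refine Fin.lastCases ?_ (fun j => ?_) j
      · rw [Fin.lastCases_last]; exact hE.ιdga
      · rw [Fin.lastCases_castSucc]; exact (TP.ι_dga j).comp hE.idga)
  have iι' : ∀ j a, i (TP.ι j a) = TP'.ι j.castSucc a := fun j a => AlgHom.congr_fun (iι j) a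
  have ψl : ∀ a, ψ (TP'.ι (Fin.last _) a) = ιE a := fun a => by
    have := AlgHom.congr_fun (ψι (Fin.last _)) a
    rwa [Fin.lastCases_last] at this
  have ψc : ∀ j a, ψ (TP'.ι (Fin.castSucc j) a) = iE (TP.ι j a) := fun j a => by
    have := AlgHom.congr_fun (ψι (Fin.castSucc j)) a
    rwa [Fin.lastCases_castSucc] at this
  have ψi : ∀ t, ψ (i t) = iE t := fun t => AlgHom.congr_fun
    (TP.hom_ext (hi.comp hψ) hE.idga (fun j a => by
      change ψ (i (TP.ι j a)) = iE (TP.ι j a)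
      rw [iι', ψc])) t
  have μi : ∀ t, TP'.mu (i t) = TP.mu t := fun t => AlgHom.congr_fun
    (TP.hom_ext (hi.comp TP'.mu_dga) TP.mu_dga (fun j a => by
      change TP'.mu (i (TP.ι j a)) = TP.mu (TP.ι j a)
      rw [iι', TP'.mu_ι, TP.mu_ι])) t
  obtain ⟨εE, hεE, εEi, εEι⟩ := hE.univ (hεK.comp hu) (isDGAHom_id A)
  let ε : T' →ₐ[ℚ] A := εE.comp ψ
  have hε : IsDGAHom ε := hψ.comp hεE
  have hε0 : ∀ a, ε (TP'.ι (Fin.castSucc 0) a) = u (e a) := fun a => by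
    change εE (ψ (TP'.ι (Fin.castSucc 0) a)) = u (e a)
    rw [ψc, εEi]
    change u (εK (TP.ι 0 a)) = _
    rw [← εKι 0]; rfl
  obtain ⟨Ω, hΩ, dΩ, nΩ⟩ := h.exists_weight hW hxl hyl hη hm (TP'.ι_dga (Fin.castSucc 0))
    (TP'.ι_dga (Fin.last _)) hε (fun l => by rw [hε0, ex, map_zero]) (fun l => by rw [hε0, ey, map_zero])
    (fun a => by change εE (ψ (TP'.ι (Fin.last _) a)) = a; rw [ψl, εEι]; rfl)
    TP'.kerMu_dideal.homog TP'.kerMu_dideal.l (fun a b ha => TP'.kerMu_dideal.r b a ha)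
    (fun a => by
      change TP'.mu _ = 0
      rw [map_sub, TP'.mu_ι, TP'.mu_ι, sub_self])
  obtain ⟨N, hN⟩ : ∃ N, ∀ a, pr A N (ε Ω) ≠ Dd A a := by
    by_contra hcon
    push Not at hcon
    have : ε Ω ∈ LinearMap.range (Dd A) := mem_of_pr fun n => by
      obtain ⟨a, ha⟩ := hcon n
      exact ⟨a, ha.symm⟩
    obtain ⟨a, ha⟩ := this
    exact nΩ a ha.symm
  rw [hε.pr] at hN
  obtain ⟨φ, φ1, φd, φN⟩ := exists_functional (hε.2 _ _ (pr_mem N Ω)) hN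
  obtain ⟨Φ, hΦ, Φl, Φd, Φ0⟩ := hE.exists_integral φ φd φN
  refine ⟨i, pr T' N Ω, Φ ∘ₗ ψ.toLinearMap, hi, μi, (TP'.kerMu_dideal.homog.pow m) _ hΩ N,
    by rw [← pr_d, dΩ, map_zero], fun a ha => hN (ε a) (by rw [ha, hε.1]), fun x => ?_, fun t x => ?_, ?_⟩
  · change Φ (ψ (Dd T' x)) = Dd T (Φ (ψ x))
    rw [hψ.1, Φd]
  · change Φ (ψ (i t * x)) = t * Φ (ψ x)
    rw [map_mul, ψi, Φl]
  · change Φ (ψ (pr T' N Ω)) = 1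
    obtain ⟨c, hc⟩ := hT _ (Φ0 _ (hψ.2 _ _ (pr_mem N Ω)))
    have key : ∀ x, εK (Φ x) = algebraMap ℚ K (φ (εE x)) := fun x => by
      refine LinearMap.congr_fun (f := εK.toLinearMap ∘ₗ Φ)
        (g := Algebra.linearMap ℚ K ∘ₗ φ ∘ₗ εE.toLinearMap) (hE.lext fun t a => ?_) x
      change εK (Φ (iE t * ιE a)) = algebraMap ℚ K (φ (εE (iE t * ιE a)))
      obtain ⟨s, hs⟩ := hK.2 (εK t)
      rw [hΦ, map_mul, εEi, εEι, map_smul]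
      change _ = algebraMap ℚ K (φ (u (εK t) * a))
      rw [← hs, AlgHom.commutes, ← Algebra.smul_def, map_smul, Algebra.smul_def, ← map_mul, smul_eq_mul,
        mul_comm]
    have h1 := key (ψ (pr T' N Ω))
    have h2 : φ (εE (ψ (pr T' N Ω))) = 1 := φ1
    rw [h2, hc, AlgHom.commutes] at h1
    rw [hc, hK.1 h1, map_one]

theorem SemiFree.lift_over {T C C' Q Q' : Type} [GCDGA T] [GCDGA C] [GCDGA C'] [GCDGA Q] [GCDGA Q']
    {j : T →ₐ[ℚ] C} (hj : IsDGAHom j) (h : SemiFree j) {q : C →ₐ[ℚ] Q} (hq : IsDGAHom q)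
    {q' : C' →ₐ[ℚ] Q'} (hq' : IsDGAHom q') (qs : Function.Surjective q') (qq : QuasiIso q')
    {i : T →ₐ[ℚ] C'} (hi : IsDGAHom i) {f : Q →ₗ[ℚ] Q'} (fl : ∀ t b, f (q (j t) * b) = q' (i t) * f b)
    (fd : ∀ b, f (Dd Q b) = Dd Q' (f b)) {m : C'} (dm : Dd C' m = 0) (hm : q' m = f 1) :
    ∃ F : C →ₗ[ℚ] C', (∀ t c, F (j t * c) = i t * F c) ∧ (∀ c, F (Dd C c) = Dd C' (F c)) ∧ F 1 = m := by
  obtain ⟨F, h1, h2, -, h3⟩ := h.lift hj (dM := Dd C') (dN := Dd Q') (p := q'.toLinearMap)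
    ((Algebra.lmul ℚ C').comp i) ((Algebra.lmul ℚ Q').comp (q'.comp i))
    (fun t m => by
      change Dd C' (i t * m) = i (Dd T t) * m + i (sg T t) * Dd C' m
      rw [d_mul, hi.1, hi.sc])
    (fun t m => map_mul q' _ _) d_d hq'.1 qs qq.1 qq.2 (f ∘ₗ q.toLinearMap)
    (fun t c => by
      change f (q (j t * c)) = q' (i t) * f (q c)
      rw [map_mul, fl])
    (fun c => by
      change f (q (Dd C c)) = Dd Q' (f (q c))
      rw [hq.1, fd])
    dm (by change q' m = f (q 1); rw [hm, map_one q])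
  exact ⟨F, h1, h2, h3⟩

theorem Pres.mtc_step {A : Type} [GCDGA A] {p q : ℕ} {x : Fin p → A} {y : Fin q → A} {dx : Fin p → ℕ}
    {dy : Fin q → ℕ} {β : Fin q → Fin p → Fin p → ℚ} (h : Pres A x y dx dy β) (hb : Bdd A)
    {lam : ℕ → Submodule ℚ A} (hW : WordLength A lam)
    (hxl : ∀ i, x i ∈ lam 1) (hyl : ∀ j, y j ∈ lam 1) {m : ℕ}
    (hη : ∃ η ∈ lam m, Dd A η = 0 ∧ ∀ a, η ≠ Dd A a)
    (hm : ∀ a, Dd A a = 0 → a ∈ (⨆ k, ⨆ (_ : m < k), lam k) → ∃ b ∈ ⨆ k, ⨆ (_ : m ≤ k), lam k, a = Dd A b)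
    {r n : ℕ} (hn : Nonempty (MTCWitness A (r + 2) n)) :
    m ≤ n ∧ Nonempty (MTCWitness A (r + 1) (n - m)) := by
  have hnt : Nontrivial A := h.nontrivial
  obtain ⟨T', TP', Q', ρ', hρ', ρs', ρk', ⟨C', j', q', τ', hj', hq', qs', qq', hqj', τd', τl', hτj'⟩⟩ := hn
  have hqj : ∀ t, q' (j' t) = ρ' t := fun t => AlgHom.congr_fun hqj' t
  obtain ⟨T, _, ⟨TP⟩, res, -, hT⟩ := exists_tensorPower h.tower.good hb hW.conn (r + 1)
  obtain ⟨i, Ω, I, hi, μi, hΩ, dΩ, nΩ, Id, Il, I1⟩ := h.exists_class hW hxl hyl hη hm TP TP' hT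
  have hmn : m ≤ n := by
    by_contra hcon
    have h1 : Ω ∈ LinearMap.ker ρ'.toLinearMap := by
      rw [ρk']; exact TP'.kerMu_dideal.pow_anti (by omega) hΩ
    have h2 : ρ' Ω = 0 := h1
    obtain ⟨c, hc⟩ := qq'.2 (j' Ω) (by rw [← hj'.1, dΩ, map_zero]) ⟨0, by rw [hqj, h2, map_zero]⟩
    exact nΩ (τ' c) (by rw [← τd', ← hc, hτj'])
  refine ⟨hmn, ?_⟩
  have hJ := TP.kerMu_dideal.pow (n - m)
  obtain ⟨Q, _, ρ, hρ, ρs, ρk⟩ := hJ.exists_quotient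
  have hQ : Nontrivial Q := ⟨⟨1, 0, fun h0 => by
    refine TensorPower.one_notMem_kerMu_pow TP (n - m) ?_
    rw [← ρk, LinearMap.mem_ker, AlgHom.toLinearMap_apply, map_one, h0]⟩⟩
  obtain ⟨C, _, j, q, hj, hq, qs, qq, qj, sf⟩ := res Q ρ hρ
  have hiK : (TP.kerMu ^ (n - m + 1)).map i.toLinearMap ≤ TP'.kerMu ^ (n - m + 1) := by
    rw [Submodule.map_pow]
    refine pow_le_pow_left' (Submodule.map_le_iff_le_comap.2 fun t ht => ?_) _
    have h0 : TP.mu t = 0 := ht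
    change TP'.mu (i t) = 0
    rw [μi, h0]
  obtain ⟨f, hf⟩ := desc ρ.toLinearMap ρs (ρ'.toLinearMap ∘ₗ LinearMap.mulRight ℚ Ω ∘ₗ i.toLinearMap)
    (fun t ht => by
      have h1 : t ∈ TP.kerMu ^ (n - m + 1) := by rw [← ρk]; exact ht
      have h2 : i t * Ω ∈ LinearMap.ker ρ'.toLinearMap := by
        have := Submodule.mul_mem_mul (hiK ⟨t, h1, rfl⟩) hΩ
        rw [← pow_add, show n - m + 1 + m = n + 1 by omega] at this
        rw [ρk']; exact this
      exact h2)
  have hf' : ∀ t, f (ρ t) = ρ' (i t * Ω) := fun t => hf t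
  obtain ⟨F, Fl, Fd, F1⟩ := sf.lift_over hj hq hq' qs' qq' (hi.comp hj') (f := f)
    (fun t b => by
      obtain ⟨s, rfl⟩ := ρs b
      rw [qj, ← map_mul, hf', hf', map_mul i, mul_assoc, map_mul ρ']
      congr 1
      exact (hqj _).symm)
    (fun b => by
      obtain ⟨s, rfl⟩ := ρs b
      rw [← hρ.1, hf', hf', ← hρ'.1, d_mul, dΩ, mul_zero, add_zero, hi.1])
    (m := j' Ω) (by rw [← hj'.1, dΩ, map_zero])
    (by rw [hqj, ← map_one ρ, hf', map_one, one_mul])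
  have Fl' : ∀ t c, F (j t * c) = j' (i t) * F c := Fl
  have τl : ∀ t c, I (τ' (F (j t * c))) = t * I (τ' (F c)) := fun t c => by rw [Fl', τl', Il]
  exact ⟨⟨T, TP, Q, ρ, hρ, ρs, ρk, ⟨⟨C, j, q, I ∘ₗ τ' ∘ₗ F, hj, hq, qs, qq, AlgHom.ext qj,
    fun c => by
      change I (τ' (F (Dd C c))) = Dd T (I (τ' (F c)))
      rw [Fd, τd', Id],
    τl, fun t => by
      change I (τ' (F (j t))) = t
      rw [← mul_one (j t), τl, F1, hτj', I1, mul_one]⟩⟩⟩⟩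

/-- For a pure coformal elliptic minimal Sullivan model and
any `r ≥ 2`, `(r−2)·cat(ΛV) + MTC(ΛV) ≤ MTC_r(ΛV)`, where `MTC = MTC₂` is the
usual module rational topological complexity. -/
theorem MTC_ge_of_pure_coformal_elliptic (A : Type) [GCDGA A] (S : MinimalSullivan A)
    (hpure : S.Pure) (hcof : S.Coformal) (hell : Elliptic A S)
    (r : ℕ) (hr : 2 ≤ r) :
    (r - 2) * cat A S + MTC A 2 ≤ MTC A r := by
  obtain ⟨p, q, x, y, dx, dy, β, h, hlam⟩ := S.exists_pres hpure hcof hell.1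
  have hnt : Nontrivial A := h.nontrivial
  have hb : Bdd A := bdd_of_finite hell.2
  have hW := S.wordLength hcof h hlam
  have hxl : ∀ i, x i ∈ S.lam 1 := fun i => by
    rw [hlam]; exact Submodule.subset_span (Or.inl ⟨i, rfl⟩)
  have hyl : ∀ j, y j ∈ S.lam 1 := fun j => by
    rw [hlam]; exact Submodule.subset_span (Or.inr ⟨j, rfl⟩)
  obtain ⟨m, hη, hm⟩ := hW.exists_max hnt hb
  have hcat : cat A S ≤ m := Nat.sInf_le (hW.exists_catWitness S hm)
  have key : ∀ s n, Nonempty (MTCWitness A (s + 2) n) → s * m + MTC A 2 ≤ n := fun s => by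
    induction s with
    | zero => exact fun n hn => by rw [zero_mul, zero_add]; exact Nat.sInf_le hn
    | succ s ih =>
      intro n hn
      obtain ⟨h1, h2⟩ := h.mtc_step hb hW hxl hyl hη hm (r := s + 1) hn
      have h3 := ih _ h2
      rw [Nat.succ_mul]
      omega
  obtain ⟨s, rfl⟩ : ∃ s, r = s + 2 := ⟨r - 2, by omega⟩
  have hmem : Nonempty (MTCWitness A (s + 2) (MTC A (s + 2))) :=
    Nat.sInf_mem (s := {n | Nonempty (MTCWitness A (s + 2) n)})
      (exists_mtcWitness h.tower.good hb hW.conn (s + 2))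
  refine le_trans ?_ (key s _ hmem)
  rw [Nat.add_sub_cancel]
  exact Nat.add_le_add_right (Nat.mul_le_mul_left s hcat) _

end RHT
end
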